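/- For every ε > 0 there is a constant C = C(ε) > 0 with the following property. Let T ≥ 2, let V satisfy T^{1/10+ε} ≤ V ≤ T^{1/6}, and let T < t₁ < t₂ < ⋯ < t_R ≤ 2T be points with t_{r+1} − t_r ≥ 1 for r = 1, …, R−1 and |ζ(1/2 + i t_r)| ≥ V for all r. Then R ≤ C · T^{2+ε} V^{−12}. -/

import Mathlib

open Real MeasureTheory
open scoped ContDiff ComplexConjugate FourierTransform SchwartzMap

/-- The second-order Taylor remainder of `x ↦ x ^ (1 - s)` between `n + 1` and `n + 2`. -/
noncomputable def zetaRemainder (n : ℕ) (s : ℂ) : ℂ :=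
  (s - 1) * ((n + 1 : ℝ) : ℂ) ^ (-s) + (((n + 2 : ℝ) : ℂ) ^ (1 - s) - ((n + 1 : ℝ) : ℂ) ^ (1 - s))

lemma hasDerivAt_cpow_of_pos {s : ℂ} {x : ℝ} (hx : 0 < x) :
    HasDerivAt (fun y : ℝ => (y : ℂ) ^ s) (s * (x : ℂ) ^ (s - 1)) x := by
  have := ((hasDerivAt_id (x : ℂ)).cpow_const (c := s) (Or.inl (by simpa using hx))).comp_ofReal
  simpa using this

lemma norm_zetaRemainder_le (n : ℕ) {s : ℂ} (hs : 0 < s.re) :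
    ‖zetaRemainder n s‖ ≤ ‖s - 1‖ * ‖s‖ * (n + 1 : ℝ) ^ (-s.re - 1) := by
  set a : ℝ := n + 1 with ha
  have ha0 : 0 < a := by positivity
  set K : ℝ := ‖s‖ * a ^ (-s.re - 1)
  have hK : 0 ≤ K := by positivity
  have h1 : ∀ x ∈ Set.Icc a (a + 1), ‖(x : ℂ) ^ (-s) - (a : ℂ) ^ (-s)‖ ≤ K := by
    intro x hx
    have := (convex_Icc a (a + 1)).norm_image_sub_le_of_norm_hasDerivWithin_le
      (f := fun y : ℝ => (y : ℂ) ^ (-s)) (f' := fun y => -s * (y : ℂ) ^ (-s - 1)) (C := K)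
      (fun y hy => (hasDerivAt_cpow_of_pos (ha0.trans_le hy.1)).hasDerivWithinAt)
      (fun y hy => by
        have hy0 := ha0.trans_le hy.1
        rw [norm_mul, norm_neg, Complex.norm_cpow_eq_rpow_re_of_pos hy0]
        simp only [Complex.sub_re, Complex.neg_re, Complex.one_re]
        exact mul_le_mul_of_nonneg_left
          (Real.rpow_le_rpow_of_nonpos ha0 hy.1 (by linarith)) (norm_nonneg _))
      (Set.left_mem_Icc.2 (by linarith)) hx
    refine this.trans ?_
    rw [Real.norm_eq_abs, abs_of_nonneg (by linarith [hx.1])]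
    nlinarith [hx.2]
  have h2 := (convex_Icc a (a + 1)).norm_image_sub_le_of_norm_hasDerivWithin_le
      (f := fun y : ℝ => (y : ℂ) ^ (1 - s) + (s - 1) * (a : ℂ) ^ (-s) * y)
      (f' := fun y => (1 - s) * (y : ℂ) ^ (1 - s - 1) + (s - 1) * (a : ℂ) ^ (-s) * 1)
      (C := ‖s - 1‖ * K)
      (fun y hy => ((hasDerivAt_cpow_of_pos (ha0.trans_le hy.1)).add
        ((hasDerivAt_id y).ofReal_comp.const_mul _)).hasDerivWithinAt)
      (fun y hy => by
        have : (1 - s) * (y : ℂ) ^ (1 - s - 1) + (s - 1) * (a : ℂ) ^ (-s) * 1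
          = -((s - 1) * ((y : ℂ) ^ (-s) - (a : ℂ) ^ (-s))) := by
          rw [show 1 - s - 1 = -s by ring]; ring
        rw [this, norm_neg, norm_mul]
        exact mul_le_mul_of_nonneg_left (h1 y hy) (norm_nonneg _))
      (Set.left_mem_Icc.2 (by linarith)) (Set.right_mem_Icc.2 (by linarith))
  have h3 : zetaRemainder n s = ((a + 1 : ℝ) : ℂ) ^ (1 - s) + (s - 1) * (a : ℂ) ^ (-s) * (a + 1 : ℝ)
      - ((a : ℂ) ^ (1 - s) + (s - 1) * (a : ℂ) ^ (-s) * a) := by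
    simp only [zetaRemainder, ← ha]
    rw [show (n + 2 : ℝ) = a + 1 by rw [ha]; ring]
    push_cast; ring
  rw [h3]
  refine h2.trans (le_of_eq ?_)
  simp [K]; ring

lemma sum_zetaRemainder (Y : ℕ) (s : ℂ) :
    ∑ n ∈ Finset.range Y, zetaRemainder n s =
      (s - 1) * ∑ n ∈ Finset.range Y, ((n + 1 : ℝ) : ℂ) ^ (-s) + ((Y + 1 : ℝ) : ℂ) ^ (1 - s) - 1 := by
  induction Y with
  | zero => simp
  | succ Y ih =>
    rw [Finset.sum_range_succ, ih, Finset.sum_range_succ, zetaRemainder]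
    rw [show ((Y + 1 : ℕ) + 1 : ℝ) = (Y + 2 : ℝ) by push_cast; ring]
    ring

lemma summable_shift_rpow {p : ℝ} (hp : 1 < p) :
    Summable fun n : ℕ => (n + 1 : ℝ) ^ (-p) := by
  have := (summable_nat_add_iff 1).2 (Real.summable_nat_rpow (p := -p)|>.2 (by linarith))
  simpa using this

lemma hasSum_zetaRemainder_of_one_lt {s : ℂ} (hs : 1 < s.re) :
    HasSum (fun n => zetaRemainder n s) ((s - 1) * riemannZeta s - 1) := by
  have hsum : Summable fun n => zetaRemainder n s := by
    refine Summable.of_norm_bounded (g := fun n : ℕ => ‖s - 1‖ * ‖s‖ * (n + 1 : ℝ) ^ (-s.re - 1)) ?_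
      (fun n => norm_zetaRemainder_le n (by linarith))
    refine Summable.mul_left _ ?_
    simpa [neg_add, sub_eq_add_neg, add_comm] using summable_shift_rpow (p := s.re + 1) (by linarith)
  have h1 := hsum.hasSum.tendsto_sum_nat
  have hz : Summable fun n : ℕ => 1 / (n + 1 : ℂ) ^ s := by
    have := (summable_nat_add_iff 1).2 (Complex.summable_one_div_nat_cpow.2 hs)
    simpa using this
  have h2 : Filter.Tendsto (fun Y : ℕ => ∑ n ∈ Finset.range Y, zetaRemainder n s) Filter.atTop
      (nhds ((s - 1) * riemannZeta s + 0 - 1)) := by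
    simp_rw [sum_zetaRemainder]
    refine (Filter.Tendsto.add (Filter.Tendsto.const_mul _ ?_) ?_).sub_const _
    · rw [zeta_eq_tsum_one_div_nat_add_one_cpow hs]
      refine hz.hasSum.tendsto_sum_nat.congr fun Y => ?_
      refine Finset.sum_congr rfl fun n _ => ?_
      rw [Complex.cpow_neg]; push_cast; rw [one_div]
    · rw [tendsto_zero_iff_norm_tendsto_zero]
      have : Filter.Tendsto (fun Y : ℕ => ((Y + 1 : ℕ) : ℝ) ^ (-(s.re - 1))) Filter.atTop (nhds 0) :=
        ((tendsto_rpow_neg_atTop (by linarith)).comp tendsto_natCast_atTop_atTop).comp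
          (Filter.tendsto_add_atTop_nat 1)
      refine this.congr fun Y => ?_
      rw [Complex.norm_cpow_eq_rpow_re_of_pos (by positivity)]
      simp
  have := tendsto_nhds_unique h1 h2
  rw [add_zero] at this
  exact this ▸ hsum.hasSum

lemma hasSum_zetaRemainder {s : ℂ} (hs : 1 / 4 < s.re) (hs1 : s ≠ 1) :
    HasSum (fun n => zetaRemainder n s) ((s - 1) * riemannZeta s - 1) := by
  set B : ℝ := ‖s‖ + 3
  set U : Set ℂ := {z | 1 / 4 < z.re} ∩ Metric.ball 0 B
  have hUo : IsOpen U := (isOpen_lt continuous_const Complex.continuous_re).inter Metric.isOpen_ball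
  have hUc : IsPreconnected U :=
    ((convex_halfSpace_re_gt (1 / 4)).inter (convex_ball 0 B)).isPreconnected
  set u : ℕ → ℝ := fun n => (B + 1) * B * (n + 1 : ℝ) ^ (-(5 / 4 : ℝ))
  have hu : Summable u := (summable_shift_rpow (by norm_num)).mul_left _
  have hbound : ∀ n w, w ∈ U → ‖zetaRemainder n w‖ ≤ u n := by
    intro n w hw
    have hw1 : 1 / 4 < w.re := hw.1
    have hw2 : ‖w‖ < B := by simpa using hw.2
    refine (norm_zetaRemainder_le n (by linarith)).trans ?_
    refine mul_le_mul (mul_le_mul ?_ hw2.le (norm_nonneg _) (by positivity)) ?_ (by positivity)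
      (by positivity)
    · exact (norm_sub_le _ _).trans (by simpa using hw2.le)
    · exact Real.rpow_le_rpow_of_exponent_le (by linarith [n.cast_nonneg (α := ℝ)]) (by linarith)
  have hd : DifferentiableOn ℂ (fun w => ∑' n, zetaRemainder n w) U := by
    refine Complex.differentiableOn_tsum_of_summable_norm hu (fun n => ?_) hUo hbound
    intro w hw
    refine DifferentiableAt.differentiableWithinAt ?_
    unfold zetaRemainder
    have h1 : ((n + 1 : ℝ) : ℂ) ≠ 0 := by norm_cast
    have h2 : ((n + 2 : ℝ) : ℂ) ≠ 0 := by norm_cast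
    refine DifferentiableAt.add ((differentiableAt_id.sub_const 1).mul ?_) (DifferentiableAt.sub ?_ ?_)
    · exact DifferentiableAt.const_cpow (by fun_prop) (Or.inl h1)
    · exact DifferentiableAt.const_cpow (by fun_prop) (Or.inl h2)
    · exact DifferentiableAt.const_cpow (by fun_prop) (Or.inl h1)
  have hd2 : DifferentiableOn ℂ (fun w => riemannZeta₁ w - 1) U :=
    (differentiable_riemannZeta₁.sub_const 1).differentiableOn
  have h2U : (2 : ℂ) ∈ U := ⟨by norm_num, by
    simp only [Metric.mem_ball, dist_zero_right, B]; norm_num; linarith [norm_nonneg s]⟩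
  have hsU : s ∈ U := ⟨hs, by simp [B]⟩
  have heq := (hd.analyticOnNhd hUo).eqOn_of_preconnected_of_eventuallyEq
    (hd2.analyticOnNhd hUo) hUc h2U (by
      filter_upwards [(isOpen_lt continuous_const Complex.continuous_re).mem_nhds
        (show (1 : ℝ) < (2 : ℂ).re by norm_num)] with w hw
      have hw1 : w ≠ 1 := by rintro rfl; simp at hw
      rw [(hasSum_zetaRemainder_of_one_lt hw).tsum_eq, riemannZeta_eq_inv_sub_mul hw1]
      field_simp [sub_ne_zero.2 hw1])
  have hfin := heq hsU
  simp only at hfin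
  have hsm : Summable fun n => zetaRemainder n s := Summable.of_norm_bounded hu fun n => hbound n s hsU
  have : (s - 1) * riemannZeta s - 1 = ∑' n, zetaRemainder n s := by
    rw [hfin, riemannZeta_eq_inv_sub_mul hs1]
    field_simp [sub_ne_zero.2 hs1]
  rw [this]; exact hsm.hasSum

lemma inv_sqrt_cube_le_telescope {x : ℝ} (hx : 0 < x) :
    (x + 1) ^ (-(3 / 2) : ℝ) ≤ 2 * (1 / √x - 1 / √(x + 1)) := by
  have h1 : 0 < √x := Real.sqrt_pos.2 hx
  have h2 : 0 < √(x + 1) := Real.sqrt_pos.2 (by linarith)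
  have h3 : √x ≤ √(x + 1) := Real.sqrt_le_sqrt (by linarith)
  have e1 : √x ^ 2 = x := Real.sq_sqrt hx.le
  have e2 : √(x + 1) ^ 2 = x + 1 := Real.sq_sqrt (by linarith)
  have h4 : (x + 1) ^ (-(3 / 2) : ℝ) = 1 / √(x + 1) ^ 3 := by
    rw [Real.rpow_neg (by linarith), Real.sqrt_eq_rpow, ← Real.rpow_natCast, ← Real.rpow_mul (by linarith)]
    norm_num
  rw [h4, div_sub_div _ _ h1.ne' h2.ne', ← mul_div_assoc, div_le_div_iff₀ (by positivity) (by positivity)]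
  set p := √x
  set q := √(x + 1)
  have : (q - p) * (q + p) = 1 := by nlinarith
  have h5 : p * q * (q + p) ≤ 2 * q ^ 3 := by
    nlinarith [mul_pos h1 h2, mul_nonneg h2.le (sub_nonneg.2 h3),
      mul_nonneg h1.le (mul_nonneg h2.le (sub_nonneg.2 h3)), mul_nonneg h2.le (mul_nonneg h2.le (sub_nonneg.2 h3))]
  have h6 : 0 ≤ q - p := by linarith
  nlinarith [mul_le_mul_of_nonneg_left h5 h6, mul_pos h1 h2]

lemma norm_zeta_sub_sum_le {t : ℝ} (ht : 1 ≤ t) {Y : ℕ} (hY : 1 ≤ Y) :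
    ‖riemannZeta (1 / 2 + t * Complex.I) -
      ∑ n ∈ Finset.range Y, ((n + 1 : ℝ) : ℂ) ^ (-(1 / 2 + t * Complex.I : ℂ))‖
      ≤ √(Y + 1) / t + 4 * t / √Y := by
  set s : ℂ := 1 / 2 + t * Complex.I with hs
  have hre : s.re = 1 / 2 := by simp [hs]
  have him : s.im = t := by simp [hs]
  have hs1 : s ≠ 1 := fun h => by rw [h] at hre; norm_num at hre
  have hsn : ‖s‖ ≤ 2 * t := by
    refine (Complex.norm_le_abs_re_add_abs_im s).trans ?_
    rw [hre, him, abs_of_pos (by norm_num), abs_of_pos (by linarith)]; linarith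
  have hsm : t ≤ ‖s - 1‖ := by
    have := Complex.abs_im_le_norm (s - 1)
    rw [Complex.sub_im, him, Complex.one_im, sub_zero] at this
    exact (le_abs_self t).trans this
  have hY0 : (0 : ℝ) < Y := by exact_mod_cast hY
  have hpart : ∀ k : ℕ, ‖∑ n ∈ Finset.range (Y + k), zetaRemainder n s
      - ∑ n ∈ Finset.range Y, zetaRemainder n s‖ ≤
      ‖s - 1‖ * ‖s‖ * (2 * (1 / √Y - 1 / √(Y + k))) := by
    intro k
    induction k with
    | zero => simp
    | succ k ih =>
      rw [← Nat.add_assoc, Finset.sum_range_succ]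
      have h1 := norm_zetaRemainder_le (Y + k) (s := s) (by rw [hre]; norm_num)
      have h2 := inv_sqrt_cube_le_telescope (x := (Y + k : ℝ)) (by positivity)
      rw [hre] at h1
      have h3 : ‖zetaRemainder (Y + k) s‖ ≤ ‖s - 1‖ * ‖s‖ * (2 * (1 / √(Y + k) - 1 / √(Y + k + 1))) := by
        refine h1.trans (mul_le_mul_of_nonneg_left ?_ (by positivity))
        push_cast
        rw [show (-(1 / 2) - 1 : ℝ) = -(3 / 2) by norm_num]; exact h2
      calc _ = ‖(∑ n ∈ Finset.range (Y + k), zetaRemainder n s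
            - ∑ n ∈ Finset.range Y, zetaRemainder n s) + zetaRemainder (Y + k) s‖ := by ring_nf
        _ ≤ _ := (norm_add_le _ _).trans (add_le_add ih h3)
        _ = _ := by push_cast; rw [add_assoc (Y : ℝ)]; ring
  have hlim := (((hasSum_zetaRemainder (s := s) (by rw [hre]; norm_num) hs1).tendsto_sum_nat.comp
    (Filter.tendsto_add_atTop_nat Y)).sub_const (∑ n ∈ Finset.range Y, zetaRemainder n s)).norm
  have hb : ‖(s - 1) * riemannZeta s - 1 - ∑ n ∈ Finset.range Y, zetaRemainder n s‖ ≤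
      ‖s - 1‖ * ‖s‖ * (2 * (1 / √Y)) := by
    refine le_of_tendsto hlim (Filter.Eventually.of_forall fun k => ?_)
    simp only [Function.comp_apply]
    rw [add_comm k Y]
    refine (hpart k).trans (mul_le_mul_of_nonneg_left ?_ (by positivity))
    have : 0 ≤ 1 / √((Y : ℝ) + k) := by positivity
    linarith
  rw [sum_zetaRemainder] at hb
  set S := ∑ n ∈ Finset.range Y, ((n + 1 : ℝ) : ℂ) ^ (-s)
  have hpow : ‖((Y + 1 : ℝ) : ℂ) ^ (1 - s)‖ = √(Y + 1) := by
    rw [Complex.norm_cpow_eq_rpow_re_of_pos (by positivity), Complex.sub_re, hre, Real.sqrt_eq_rpow]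
    norm_num
  have h5 : ‖s - 1‖ * ‖riemannZeta s - S‖ ≤ ‖s - 1‖ * ‖s‖ * (2 * (1 / √Y)) + √(Y + 1) := by
    rw [← norm_mul]
    calc _ = ‖((s - 1) * riemannZeta s - 1 - ((s - 1) * S + ((Y + 1 : ℝ) : ℂ) ^ (1 - s) - 1)) +
          ((Y + 1 : ℝ) : ℂ) ^ (1 - s)‖ := by congr 1; ring
      _ ≤ _ := (norm_add_le _ _).trans (add_le_add hb hpow.le)
  have hpos : 0 < ‖s - 1‖ := by linarith
  have h6 : ‖riemannZeta s - S‖ ≤ ‖s‖ * (2 * (1 / √Y)) + √(Y + 1) / ‖s - 1‖ := by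
    rw [← mul_le_mul_iff_right₀ hpos]
    refine h5.trans (le_of_eq ?_)
    field_simp
  refine h6.trans ?_
  have h7 : √(Y + 1 : ℝ) / ‖s - 1‖ ≤ √(Y + 1) / t := by gcongr
  have h8 : ‖s‖ * (2 * (1 / √(Y : ℝ))) ≤ 2 * t * (2 * (1 / √Y)) := by gcongr
  have h9 : 2 * t * (2 * (1 / √(Y : ℝ))) = 4 * t / √Y := by ring
  linarith

/-- The inverse of `1 - e^{-iδ}`, which turns `n^{-it}` into a difference. -/
noncomputable def kuzminFactor (t x : ℝ) : ℂ :=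
  (1 - Complex.exp (-(t * Real.log (1 + 1 / x) : ℝ) * Complex.I))⁻¹

lemma norm_one_sub_exp_neg_ge {δ : ℝ} (h0 : 0 ≤ δ) (h2 : δ ≤ 2) :
    δ / 2 ≤ ‖1 - Complex.exp (-(δ : ℝ) * Complex.I)‖ := by
  have h : ‖1 - Complex.exp (-(δ : ℝ) * Complex.I)‖ = ‖2 * Real.sin (δ / 2)‖ := by
    have := Complex.norm_exp_I_mul_ofReal_sub_one (-δ)
    rw [norm_sub_rev, mul_comm]
    push_cast at this ⊢
    rw [this, neg_div, Real.sin_neg, mul_neg, norm_neg]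
  rw [h, Real.norm_eq_abs]
  refine le_trans ?_ (le_abs_self _)
  have := Real.mul_le_sin (x := δ / 2) (by linarith) (by linarith [Real.pi_gt_three])
  have hpi : 1 / 2 ≤ 2 / π := by
    rw [div_le_div_iff₀ (by norm_num) Real.pi_pos]; linarith [Real.pi_lt_four]
  nlinarith

lemma log_one_add_inv_bounds {x : ℝ} (hx : 0 < x) :
    1 / (x + 1) ≤ Real.log (1 + 1 / x) ∧ Real.log (1 + 1 / x) ≤ 1 / x := by
  constructor
  · have := Real.one_sub_inv_le_log_of_pos (x := 1 + 1 / x) (by positivity)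
    refine le_trans (le_of_eq ?_) this
    field_simp; ring
  · have := Real.log_le_sub_one_of_pos (x := 1 + 1 / x) (by positivity)
    linarith

lemma norm_kuzminFactor_le {t x : ℝ} (ht : 0 < t) (hx : 1 ≤ x) (htx : t ≤ 2 * x) :
    ‖kuzminFactor t x‖ ≤ 4 * x / t := by
  have hb := log_one_add_inv_bounds (x := x) (by linarith)
  set l := Real.log (1 + 1 / x)
  have hx0 : 0 < x := by linarith
  have h1 : t / (x + 1) ≤ t * l := by
    have := mul_le_mul_of_nonneg_left hb.1 ht.le; rwa [mul_one_div] at this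
  have h2 : t * l ≤ 2 := by
    have := mul_le_mul_of_nonneg_left hb.2 ht.le
    rw [mul_one_div] at this
    exact this.trans ((div_le_iff₀ hx0).2 htx)
  have h3 := norm_one_sub_exp_neg_ge (δ := t * l) (le_trans (by positivity) h1) h2
  rw [kuzminFactor, norm_inv]
  have h4 : t / (4 * x) ≤ ‖1 - Complex.exp (-(t * l : ℝ) * Complex.I)‖ := by
    refine le_trans ?_ h3
    have : t / (4 * x) ≤ t / (x + 1) / 2 := by
      rw [div_div]
      exact div_le_div_of_nonneg_left ht.le (by positivity) (by linarith)
    linarith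
  calc _ ≤ (t / (4 * x))⁻¹ := inv_anti₀ (by positivity) h4
    _ = _ := by rw [inv_div]

lemma norm_exp_neg_sub_exp_neg_le (a b : ℝ) :
    ‖Complex.exp (-(a : ℝ) * Complex.I) - Complex.exp (-(b : ℝ) * Complex.I)‖ ≤ |a - b| := by
  have h : Complex.exp (-(a : ℝ) * Complex.I) - Complex.exp (-(b : ℝ) * Complex.I) =
      Complex.exp ((-b : ℝ) * Complex.I) * (Complex.exp (Complex.I * ((b - a : ℝ) : ℂ)) - 1) := by
    rw [mul_sub, ← Complex.exp_add]; push_cast; ring_nf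
  rw [h, norm_mul, Complex.norm_exp_ofReal_mul_I, one_mul]
  refine (Real.norm_exp_I_mul_ofReal_sub_one_le).trans ?_
  rw [Real.norm_eq_abs, abs_sub_comm]

lemma norm_kuzminFactor_sub_le {t x : ℝ} (ht : 0 < t) (hx : 1 ≤ x) (htx : t ≤ 2 * x) :
    ‖kuzminFactor t (x + 1) - kuzminFactor t x‖ ≤ 32 / t := by
  have hx0 : 0 < x := by linarith
  have hA := norm_kuzminFactor_le ht hx htx
  have hB := norm_kuzminFactor_le (x := x + 1) ht (by linarith) (by linarith)
  have nz : ∀ y : ℝ, 1 ≤ y → t ≤ 2 * y →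
      1 - Complex.exp (-(t * Real.log (1 + 1 / y) : ℝ) * Complex.I) ≠ 0 := by
    intro y hy hty h0
    have hb := log_one_add_inv_bounds (x := y) (by linarith)
    have h1 : 0 < t * Real.log (1 + 1 / y) := mul_pos ht (lt_of_lt_of_le (by positivity) hb.1)
    have h2 : t * Real.log (1 + 1 / y) ≤ 2 := by
      have := mul_le_mul_of_nonneg_left hb.2 ht.le
      rw [mul_one_div] at this
      exact this.trans ((div_le_iff₀ (by linarith)).2 hty)
    have := norm_one_sub_exp_neg_ge h1.le h2
    rw [h0, norm_zero] at this; linarith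
  have n1 := nz x hx htx
  have n2 := nz (x + 1) (by linarith) (by linarith)
  have heq : kuzminFactor t (x + 1) - kuzminFactor t x = kuzminFactor t (x + 1) * kuzminFactor t x *
      (Complex.exp (-(t * Real.log (1 + 1 / (x + 1)) : ℝ) * Complex.I) -
        Complex.exp (-(t * Real.log (1 + 1 / x) : ℝ) * Complex.I)) := by
    unfold kuzminFactor
    generalize Complex.exp (-(t * Real.log (1 + 1 / (x + 1)) : ℝ) * Complex.I) = a at n2 ⊢
    generalize Complex.exp (-(t * Real.log (1 + 1 / x) : ℝ) * Complex.I) = b at n1 ⊢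
    field_simp; ring
  have hd : |t * Real.log (1 + 1 / (x + 1)) - t * Real.log (1 + 1 / x)| ≤ t / (x * (x + 1)) := by
    have e1 : t * Real.log (1 + 1 / (x + 1)) - t * Real.log (1 + 1 / x) =
        -(t * Real.log ((1 + 1 / x) / (1 + 1 / (x + 1)))) := by
      rw [Real.log_div (by positivity) (by positivity)]; ring
    have hq : (1 + 1 / x) / (1 + 1 / (x + 1)) = 1 + 1 / (x * (x + 2)) := by field_simp; ring
    have hl := Real.log_le_sub_one_of_pos (x := 1 + 1 / (x * (x + 2))) (by positivity)
    have hl0 : 0 ≤ Real.log (1 + 1 / (x * (x + 2))) := Real.log_nonneg (by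
      have : 0 ≤ 1 / (x * (x + 2)) := by positivity
      linarith)
    rw [e1, abs_neg, hq, abs_of_nonneg (by positivity)]
    have : 1 / (x * (x + 2)) ≤ 1 / (x * (x + 1)) := by gcongr; linarith
    calc _ ≤ t * (1 / (x * (x + 1))) := by gcongr; linarith
      _ = _ := by ring
  rw [heq, norm_mul, norm_mul]
  calc _ ≤ (4 * (x + 1) / t) * (4 * x / t) * (t / (x * (x + 1))) := by
        gcongr
        exact (norm_exp_neg_sub_exp_neg_le _ _).trans hd
    _ = 16 / t := by field_simp; ring
    _ ≤ _ := by gcongr; norm_num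

lemma cpow_neg_mul_I_succ {t x : ℝ} (hx : 0 < x) :
    ((x + 1 : ℝ) : ℂ) ^ (-(t * Complex.I)) = (x : ℂ) ^ (-(t * Complex.I)) *
      Complex.exp (-(t * Real.log (1 + 1 / x) : ℝ) * Complex.I) := by
  have h1 : (x + 1 : ℝ) = x * (1 + 1 / x) := by field_simp
  rw [h1, Complex.ofReal_mul, Complex.mul_cpow_ofReal_nonneg hx.le (by positivity)]
  congr 1
  rw [Complex.cpow_def_of_ne_zero (by norm_cast; positivity), ← Complex.ofReal_log (by positivity)]
  congr 1; push_cast; ring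

lemma norm_cpow_neg_mul_I {t x : ℝ} (hx : 0 < x) : ‖(x : ℂ) ^ (-(t * Complex.I))‖ = 1 := by
  rw [Complex.norm_cpow_eq_rpow_re_of_pos hx]; simp

/-- Partial summation in the range `t ≤ 2 n`, where `n^{-it}` is close to a difference. -/
lemma norm_sum_weight_mul_cpow_le {t C₁ : ℝ} (ht : 0 < t) (hC₁ : 0 ≤ C₁) {X : ℕ} (hX : 1 ≤ X)
    (htX : t ≤ 2 * X) {v : ℕ → ℝ} (hv : ∀ n, X ≤ n → |v n| ≤ 1 / √n)
    (hv' : ∀ n, X ≤ n → |v (n + 1) - v n| ≤ C₁ / (n * √n)) (k : ℕ) :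
    ‖∑ n ∈ Finset.Ico X (X + k), (v n : ℂ) * ((n : ℝ) : ℂ) ^ (-(t * Complex.I))‖
      ≤ 4 * √X / t + 4 * √(X + k) / t + (96 + 12 * C₁) * √(X + k) / t := by
  set z : ℕ → ℂ := fun n => ((n : ℝ) : ℂ) ^ (-(t * Complex.I)) with hz
  set d : ℕ → ℂ := fun n => kuzminFactor t n with hd
  have hpos : ∀ n, X ≤ n → (1 : ℝ) ≤ n ∧ t ≤ 2 * n := fun n hn => by
    have h1 : (X : ℝ) ≤ n := by exact_mod_cast hn
    have h2 : (1 : ℝ) ≤ X := by exact_mod_cast hX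
    exact ⟨by linarith, by linarith⟩
  have hznorm : ∀ n, X ≤ n → ‖z n‖ = 1 := fun n hn =>
    norm_cpow_neg_mul_I (by linarith [(hpos n hn).1])
  have hvd : ∀ n, X ≤ n → ‖(v n : ℂ) * d n‖ ≤ 4 * √n / t := by
    intro n hn
    have hn1 := (hpos n hn).1
    have hs : 0 < √(n : ℝ) := Real.sqrt_pos.2 (by linarith)
    have h1 := norm_kuzminFactor_le ht (hpos n hn).1 (hpos n hn).2
    rw [norm_mul, Complex.norm_real, Real.norm_eq_abs]
    calc _ ≤ 1 / √(n : ℝ) * (4 * n / t) := by gcongr; exact hv n hn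
      _ = _ := by
        have : (n : ℝ) = √n * √n := (Real.mul_self_sqrt (by linarith)).symm
        field_simp; rw [sq]; exact this
  have hstep : ∀ n, X ≤ n → (v n : ℂ) * z n = v n * d n * (z n - z (n + 1)) := by
    intro n hn
    have hn1 := (hpos n hn).1
    have e : z (n + 1) = z n * Complex.exp (-(t * Real.log (1 + 1 / n) : ℝ) * Complex.I) := by
      have := cpow_neg_mul_I_succ (t := t) (x := n) (by linarith)
      simpa [hz] using this
    have hne : 1 - Complex.exp (-(t * Real.log (1 + 1 / n) : ℝ) * Complex.I) ≠ 0 := by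
      intro h0
      have hb := log_one_add_inv_bounds (x := n) (by linarith)
      have h1 : 0 < t * Real.log (1 + 1 / n) := mul_pos ht (lt_of_lt_of_le (by positivity) hb.1)
      have h2 : t * Real.log (1 + 1 / n) ≤ 2 := by
        have := mul_le_mul_of_nonneg_left hb.2 ht.le
        rw [mul_one_div] at this
        exact this.trans ((div_le_iff₀ (by linarith)).2 (hpos n hn).2)
      have := norm_one_sub_exp_neg_ge h1.le h2
      rw [h0, norm_zero] at this; linarith
    rw [e, hd]; simp only [kuzminFactor]
    generalize Complex.exp (-(t * Real.log (1 + 1 / n) : ℝ) * Complex.I) = a at hne ⊢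
    field_simp
  have hdiff : ∀ n, X ≤ n → ‖(v (n + 1) : ℂ) * d (n + 1) - v n * d n‖ ≤
      (96 + 12 * C₁) / t * (√(n + 1) - √n) := by
    intro n hn
    have hn1 := (hpos n hn).1
    have hs : 0 < √(n : ℝ) := Real.sqrt_pos.2 (by linarith)
    have hs1 : √(n : ℝ) ≤ √(n + 1) := Real.sqrt_le_sqrt (by linarith)
    have e0 : √(n : ℝ) ^ 2 = n := Real.sq_sqrt (by linarith)
    have e1 : √(n + 1 : ℝ) ^ 2 = n + 1 := Real.sq_sqrt (by linarith)
    have hgap : 1 / √(n : ℝ) ≤ 3 * (√(n + 1) - √n) := by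
      have h2 : √(n + 1 : ℝ) ≤ 2 * √n := by
        rw [show (2 : ℝ) * √n = √(4 * n) by
          rw [Real.sqrt_mul (by norm_num), show (4 : ℝ) = 2 ^ 2 by norm_num, Real.sqrt_sq (by norm_num)]]
        exact Real.sqrt_le_sqrt (by linarith)
      rw [div_le_iff₀ hs]
      have h3 : (√(n + 1 : ℝ) - √n) * (√(n + 1) + √n) = 1 := by nlinarith
      nlinarith [mul_le_mul_of_nonneg_left h2 (sub_nonneg.2 hs1)]
    have hK := norm_kuzminFactor_sub_le ht (hpos n hn).1 (hpos n hn).2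
    have hK0 := norm_kuzminFactor_le ht (hpos n hn).1 (hpos n hn).2
    have hv1 : |v (n + 1)| ≤ 1 / √(n : ℝ) := by
      refine (hv (n + 1) (by omega)).trans ?_
      push_cast; gcongr
    calc _ = ‖(v (n + 1) : ℂ) * (kuzminFactor t (n + 1) - kuzminFactor t n) +
          ((v (n + 1) - v n : ℝ) : ℂ) * kuzminFactor t n‖ := by
          congr 1; simp only [hd]; push_cast; ring
      _ ≤ |v (n + 1)| * ‖kuzminFactor t (n + 1) - kuzminFactor t n‖ +
          |v (n + 1) - v n| * ‖kuzminFactor t n‖ := by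
          refine (norm_add_le _ _).trans (le_of_eq ?_)
          rw [norm_mul, norm_mul, Complex.norm_real, Complex.norm_real, Real.norm_eq_abs,
            Real.norm_eq_abs]
      _ ≤ 1 / √(n : ℝ) * (32 / t) + C₁ / (n * √n) * (4 * n / t) := by
          gcongr; exact hv' n hn
      _ = (32 + 4 * C₁) / t * (1 / √n) := by field_simp
      _ ≤ (32 + 4 * C₁) / t * (3 * (√(n + 1) - √n)) := by gcongr
      _ = _ := by ring
  have hmain : ∀ k : ℕ, ‖∑ n ∈ Finset.Ico X (X + k), (v n : ℂ) * z n - v X * d X * z X +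
      v (X + k) * d (X + k) * z (X + k)‖ ≤ (96 + 12 * C₁) / t * (√(X + k) - √X) := by
    intro k
    induction k with
    | zero => simp
    | succ k ih =>
      rw [← Nat.add_assoc, Finset.sum_Ico_succ_top (by omega), hstep (X + k) (by omega)]
      have h1 := hdiff (X + k) (by omega)
      calc _ = ‖(∑ n ∈ Finset.Ico X (X + k), (v n : ℂ) * z n - v X * d X * z X +
            v (X + k) * d (X + k) * z (X + k)) +
            (v (X + k + 1) * d (X + k + 1) - v (X + k) * d (X + k)) * z (X + k + 1)‖ := by
            congr 1; ring
        _ ≤ _ := norm_add_le _ _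
        _ ≤ (96 + 12 * C₁) / t * (√(X + k) - √X) +
            (96 + 12 * C₁) / t * (√((X + k : ℕ) + 1) - √(X + k : ℕ)) := by
            rw [norm_mul, hznorm _ (by omega), mul_one]
            exact add_le_add ih h1
        _ = _ := by push_cast; rw [add_assoc (X : ℝ)]; ring
  have h0 := hmain k
  have hX0 := hvd X le_rfl
  have hXk := hvd (X + k) (by omega)
  calc _ = ‖(∑ n ∈ Finset.Ico X (X + k), (v n : ℂ) * z n - v X * d X * z X +
      v (X + k) * d (X + k) * z (X + k)) + v X * d X * z X - v (X + k) * d (X + k) * z (X + k)‖ := by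
        congr 1; ring
    _ ≤ (96 + 12 * C₁) / t * (√(X + k) - √X) + 4 * √X / t + 4 * √(X + k) / t := by
        refine (norm_sub_le _ _).trans (add_le_add ((norm_add_le _ _).trans (add_le_add h0 ?_)) ?_)
        · rw [norm_mul, hznorm _ le_rfl, mul_one]; exact hX0
        · rw [norm_mul, hznorm _ (by omega), mul_one]; exact_mod_cast hXk
    _ ≤ _ := by
        have : 0 ≤ (96 + 12 * C₁) / t * √X := by positivity
        have e : (96 + 12 * C₁) * √(X + k : ℝ) / t = (96 + 12 * C₁) / t * √(X + k) := by ring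
        rw [e]; linarith

/-- A smooth cutoff equal to `1` on `(-∞, 1]` and to `0` on `[2, ∞)`. -/
noncomputable def cutoff (x : ℝ) : ℝ := Real.smoothTransition (2 - x)

lemma cutoff_of_le_one {x : ℝ} (hx : x ≤ 1) : cutoff x = 1 :=
  Real.smoothTransition.one_of_one_le (by linarith)

lemma cutoff_of_two_le {x : ℝ} (hx : 2 ≤ x) : cutoff x = 0 :=
  Real.smoothTransition.zero_of_nonpos (by linarith)

lemma contDiff_cutoff : ContDiff ℝ ∞ cutoff :=
  Real.smoothTransition.contDiff.comp (contDiff_const.sub contDiff_id)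

lemma cutoff_mem (x : ℝ) : 0 ≤ cutoff x ∧ cutoff x ≤ 1 :=
  ⟨Real.smoothTransition.nonneg _, Real.smoothTransition.le_one _⟩

lemma exists_cutoff_lipschitz : ∃ K : ℝ, 0 ≤ K ∧ ∀ x y, |cutoff x - cutoff y| ≤ K * |x - y| := by
  have hd : Differentiable ℝ cutoff := contDiff_cutoff.differentiable (by simp)
  have hc : Continuous (deriv cutoff) := contDiff_cutoff.continuous_deriv (by simp)
  obtain ⟨K, hK⟩ := isCompact_Icc.exists_bound_of_continuousOn (s := Set.Icc (0 : ℝ) 3) hc.continuousOn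
  have hK0 : 0 ≤ K := (norm_nonneg _).trans (hK 0 (by norm_num))
  refine ⟨K, hK0, fun x y => ?_⟩
  have hb : ∀ z, ‖deriv cutoff z‖ ≤ K := by
    intro z
    by_cases h1 : z < 1
    · have : cutoff =ᶠ[nhds z] fun _ => (1 : ℝ) :=
        Filter.eventually_of_mem (Iio_mem_nhds h1) fun w hw => cutoff_of_le_one (le_of_lt hw)
      rw [this.deriv_eq]; simpa using hK0
    by_cases h2 : 2 < z
    · have : cutoff =ᶠ[nhds z] fun _ => (0 : ℝ) :=
        Filter.eventually_of_mem (Ioi_mem_nhds h2) fun w hw => cutoff_of_two_le (le_of_lt hw)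
      rw [this.deriv_eq]; simpa using hK0
    · exact hK z ⟨by linarith, by linarith⟩
  have := convex_univ.norm_image_sub_le_of_norm_deriv_le (f := cutoff) (C := K)
    (fun z _ => hd z) (fun z _ => hb z) (Set.mem_univ y) (Set.mem_univ x)
  simpa [Real.norm_eq_abs] using this

/-- Smoothed Dirichlet polynomial approximation to `ζ` on the critical line. -/
lemma exists_zeta_sub_smooth_sum_le : ∃ C : ℝ, 0 < C ∧ ∀ T t : ℝ, ∀ X : ℕ, 2 ≤ T → T < t → t ≤ 2 * T →
    T ≤ X → (X : ℝ) ≤ 2 * T →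
    ‖riemannZeta (1 / 2 + t * Complex.I) - ∑ n ∈ Finset.Icc 1 (2 * X),
      ((cutoff (n / X) / √n : ℝ) : ℂ) * ((n : ℝ) : ℂ) ^ (-(t * Complex.I))‖ ≤ C := by
  obtain ⟨K, hK0, hK⟩ := exists_cutoff_lipschitz
  set C₁ : ℝ := 2 * K + 1
  refine ⟨3 + 8 + (16 + 3 * (100 + 12 * C₁)), by positivity, fun T t X hT h1 h2 hX hX2 => ?_⟩
  set Y : ℕ := ⌈4 * T ^ 2⌉₊
  have hY1 : 4 * T ^ 2 ≤ Y := Nat.le_ceil _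
  have hY2 : (Y : ℝ) ≤ 4 * T ^ 2 + 1 := (Nat.ceil_lt_add_one (by positivity)).le
  have hX0 : (0 : ℝ) < X := by linarith
  have hXn : 1 ≤ X := by exact_mod_cast hX0
  have hXY : 2 * X ≤ Y := by
    have : (2 * X : ℝ) ≤ Y := by nlinarith
    exact_mod_cast this
  have ht : 0 < t := by linarith
  have hY0 : (0 : ℝ) < Y := by nlinarith
  have hz := norm_zeta_sub_sum_le (t := t) (by linarith) (Y := Y) (by omega)
  have hsY : √((Y : ℝ) + 1) ≤ 3 * T := by
    rw [Real.sqrt_le_left (by linarith)]; nlinarith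
  have hsY' : 2 * T ≤ √(Y : ℝ) := Real.le_sqrt_of_sq_le (by nlinarith)
  have e1 : √((Y : ℝ) + 1) / t ≤ 3 := by rw [div_le_iff₀ ht]; linarith
  have e2 : 4 * t / √(Y : ℝ) ≤ 8 := by
    rw [div_le_iff₀ (by linarith)]; linarith
  set v : ℕ → ℝ := fun n => (1 - cutoff (n / X)) / √n
  have hv : ∀ n, X ≤ n → |v n| ≤ 1 / √n := by
    intro n hn
    have := cutoff_mem (n / X)
    rw [abs_div, abs_of_nonneg (Real.sqrt_nonneg _), abs_of_nonneg (by linarith)]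
    gcongr; linarith
  have hv' : ∀ n, X ≤ n → |v (n + 1) - v n| ≤ C₁ / (n * √n) := by
    intro n hn
    have hXn' : (X : ℝ) ≤ n := by exact_mod_cast hn
    have hn0 : (0 : ℝ) < n := by linarith
    have hs : 0 < √(n : ℝ) := Real.sqrt_pos.2 hn0
    have hs1 : √(n : ℝ) ≤ √(n + 1) := Real.sqrt_le_sqrt (by linarith)
    have hs1' : 0 < √(n + 1 : ℝ) := hs.trans_le hs1
    have q0 : √(n : ℝ) ^ 2 = n := Real.sq_sqrt hn0.le
    have q1 : √(n + 1 : ℝ) ^ 2 = n + 1 := Real.sq_sqrt (by linarith)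
    have hc : |cutoff (n / X) - cutoff ((n + 1) / X)| ≤ 2 * K / n := by
      by_cases h : (n : ℝ) ≤ 2 * X
      · refine (hK _ _).trans ?_
        rw [← sub_div, show (n : ℝ) - (n + 1) = -1 by ring, abs_div, abs_neg, abs_one,
          abs_of_pos hX0, mul_one_div, div_le_div_iff₀ hX0 hn0]
        nlinarith
      · push Not at h
        rw [cutoff_of_two_le (by rw [le_div_iff₀ hX0]; linarith),
          cutoff_of_two_le (by rw [le_div_iff₀ hX0]; linarith)]
        simp only [sub_self, abs_zero]; positivity
    have hg : 1 / √(n : ℝ) - 1 / √(n + 1) ≤ 1 / (n * √n) := by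
      rw [div_sub_div _ _ hs.ne' hs1'.ne', div_le_div_iff₀ (by positivity) (by positivity)]
      have h3 : (√(n + 1 : ℝ) - √n) * (√(n + 1) + √n) = 1 := by nlinarith
      have h4 : (√(n + 1 : ℝ) - √n) * √(n : ℝ) ≤ 1 := by nlinarith [sub_nonneg.2 hs1]
      have : (√(n + 1 : ℝ) - √n) * n ≤ √n := by
        calc _ = (√(n + 1 : ℝ) - √n) * √n * √n := by rw [mul_assoc, ← sq, q0]
          _ ≤ 1 * √n := by gcongr
          _ = _ := one_mul _
      nlinarith
    have hc1 := cutoff_mem (n / X)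
    calc |v (n + 1) - v n| = |(cutoff (n / X) - cutoff ((n + 1) / X)) / √(n + 1)
          - (1 - cutoff (n / X)) * (1 / √n - 1 / √(n + 1))| := by
          congr 1; simp only [v]; push_cast; ring
      _ ≤ |cutoff (n / X) - cutoff ((n + 1) / X)| / √(n + 1)
          + (1 - cutoff (n / X)) * (1 / √n - 1 / √(n + 1)) := by
          refine (abs_sub _ _).trans (le_of_eq ?_)
          have h6 : 0 ≤ 1 / √(n : ℝ) - 1 / √(n + 1) := sub_nonneg.2 (by gcongr)
          rw [abs_div, abs_of_pos hs1', abs_mul, abs_of_nonneg (by linarith : 0 ≤ 1 - cutoff (n / X)),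
            abs_of_nonneg h6]
      _ ≤ 2 * K / n / √n + 1 * (1 / (n * √n)) := by
          have h6 : 0 ≤ 1 / √(n : ℝ) - 1 / √(n + 1) := sub_nonneg.2 (by gcongr)
          gcongr; linarith
      _ = _ := by simp only [C₁]; field_simp
  have hw := norm_sum_weight_mul_cpow_le ht (C₁ := C₁) (by positivity) hXn
    (by linarith : t ≤ 2 * X) hv hv' (Y + 1 - X)
  rw [show X + (Y + 1 - X) = Y + 1 by omega,
    show (X : ℝ) + ((Y + 1 - X : ℕ) : ℝ) = Y + 1 by
      rw [Nat.cast_sub (by omega)]; push_cast; ring] at hw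
  have hsX : √(X : ℝ) / t ≤ 2 := by
    rw [div_le_iff₀ ht, Real.sqrt_le_left (by linarith)]; nlinarith
  have hw2 : 4 * √(X : ℝ) / t + 4 * √((Y : ℝ) + 1) / t + (96 + 12 * C₁) * √((Y : ℝ) + 1) / t
      ≤ 16 + 3 * (100 + 12 * C₁) := by
    have : 0 ≤ C₁ := by positivity
    calc _ = 4 * (√(X : ℝ) / t) + (100 + 12 * C₁) * (√((Y : ℝ) + 1) / t) := by ring
      _ ≤ 4 * 2 + (100 + 12 * C₁) * 3 := by gcongr
      _ ≤ _ := by linarith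
  have hpow : ∀ n : ℕ, 1 ≤ n → ((n : ℝ) : ℂ) ^ (-(1 / 2 + t * Complex.I)) =
      ((1 / √n : ℝ) : ℂ) * ((n : ℝ) : ℂ) ^ (-(t * Complex.I)) := by
    intro n hn
    have hn0 : (0 : ℝ) < n := by exact_mod_cast hn
    have hsq : 1 / √(n : ℝ) = (n : ℝ) ^ (-(1 / 2) : ℝ) := by
      rw [Real.sqrt_eq_rpow, Real.rpow_neg hn0.le, one_div]
    rw [neg_add, Complex.cpow_add _ _ (by exact_mod_cast hn0.ne'), hsq,
      Complex.ofReal_cpow hn0.le]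
    push_cast; rfl
  have hsum : ∑ n ∈ Finset.range Y, ((n + 1 : ℝ) : ℂ) ^ (-(1 / 2 + t * Complex.I)) =
      ∑ n ∈ Finset.Icc 1 (2 * X), ((cutoff (n / X) / √n : ℝ) : ℂ) * ((n : ℝ) : ℂ) ^ (-(t * Complex.I))
      + ∑ n ∈ Finset.Ico X (Y + 1), (v n : ℂ) * ((n : ℝ) : ℂ) ^ (-(t * Complex.I)) := by
    have a1 : ∑ n ∈ Finset.range Y, ((n + 1 : ℝ) : ℂ) ^ (-(1 / 2 + t * Complex.I)) =
        ∑ n ∈ Finset.Ico 1 (Y + 1), ((n : ℝ) : ℂ) ^ (-(1 / 2 + t * Complex.I)) := by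
      rw [Finset.sum_Ico_eq_sum_range]
      simp only [Nat.add_sub_cancel]
      refine Finset.sum_congr rfl fun n _ => ?_
      push_cast; rw [add_comm]
    have a2 : ∑ n ∈ Finset.Icc 1 (2 * X), ((cutoff (n / X) / √n : ℝ) : ℂ) *
        ((n : ℝ) : ℂ) ^ (-(t * Complex.I)) = ∑ n ∈ Finset.Ico 1 (Y + 1),
        ((cutoff (n / X) / √n : ℝ) : ℂ) * ((n : ℝ) : ℂ) ^ (-(t * Complex.I)) := by
      refine Finset.sum_subset (fun n hn => ?_) (fun n hn hn' => ?_)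
      · simp only [Finset.mem_Icc, Finset.mem_Ico] at hn ⊢; omega
      · simp only [Finset.mem_Icc, Finset.mem_Ico] at hn hn'
        have : ((2 * X : ℕ) : ℝ) ≤ n := by exact_mod_cast (by omega : 2 * X ≤ n)
        push_cast at this
        rw [cutoff_of_two_le (by rw [le_div_iff₀ hX0]; linarith)]; simp
    have a3 : ∑ n ∈ Finset.Ico X (Y + 1), (v n : ℂ) * ((n : ℝ) : ℂ) ^ (-(t * Complex.I)) =
        ∑ n ∈ Finset.Ico 1 (Y + 1), (v n : ℂ) * ((n : ℝ) : ℂ) ^ (-(t * Complex.I)) := by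
      refine Finset.sum_subset (fun n hn => ?_) (fun n hn hn' => ?_)
      · simp only [Finset.mem_Ico] at hn ⊢; omega
      · simp only [Finset.mem_Ico] at hn hn'
        have : (n : ℝ) ≤ X := by exact_mod_cast (by omega : n ≤ X)
        simp only [v]
        rw [cutoff_of_le_one (by rw [div_le_iff₀ hX0]; linarith)]; simp
    rw [a1, a2, a3, ← Finset.sum_add_distrib]
    refine Finset.sum_congr rfl fun n hn => ?_
    rw [hpow n (Finset.mem_Ico.1 hn).1]; simp only [v]; push_cast; ring
  set S := ∑ n ∈ Finset.Icc 1 (2 * X), ((cutoff (n / X) / √n : ℝ) : ℂ) * ((n : ℝ) : ℂ) ^ (-(t * Complex.I))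
  set S' := ∑ n ∈ Finset.Ico X (Y + 1), (v n : ℂ) * ((n : ℝ) : ℂ) ^ (-(t * Complex.I))
  calc _ = ‖(riemannZeta (1 / 2 + t * Complex.I) - (S + S')) + S'‖ := by congr 1; ring
    _ ≤ (3 + 8) + (16 + 3 * (100 + 12 * C₁)) := by
      refine (norm_add_le _ _).trans (add_le_add ?_ (hw.trans hw2))
      rw [← hsum]; exact hz.trans (add_le_add e1 e2)
    _ = _ := by ring

/-- A smooth function supported in `[1/2, 2]` whose dyadic dilates resolve `cutoff x / √x`. -/
noncomputable def dyadicBump (x : ℝ) : ℝ := (cutoff x - cutoff (2 * x)) / √x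

lemma dyadicBump_eq_zero {x : ℝ} (hx : x ≤ 1 / 2 ∨ 2 ≤ x) : dyadicBump x = 0 := by
  unfold dyadicBump
  rcases hx with h | h
  · rw [cutoff_of_le_one (by linarith), cutoff_of_le_one (by linarith)]; simp
  · rw [cutoff_of_two_le (by linarith), cutoff_of_two_le (by linarith)]; simp

lemma contDiff_dyadicBump : ContDiff ℝ ∞ dyadicBump := by
  rw [contDiff_iff_contDiffAt]
  intro x
  by_cases hx : x < 1 / 2
  · have : dyadicBump =ᶠ[nhds x] fun _ => (0 : ℝ) :=
      Filter.eventually_of_mem (Iio_mem_nhds hx) fun w hw => dyadicBump_eq_zero (Or.inl (le_of_lt hw))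
    exact contDiffAt_const.congr_of_eventuallyEq this
  · have h0 : 0 < x := by push Not at hx; linarith
    refine ContDiffAt.div ?_ (Real.contDiffAt_sqrt h0.ne') (Real.sqrt_pos.2 h0).ne'
    exact (contDiff_cutoff.sub (contDiff_cutoff.comp (contDiff_const.mul contDiff_id))).contDiffAt

/-- The exponential sum `∑ A(n/N) (n/N)^{-it}`. -/
noncomputable def smoothSum (A : ℝ → ℝ) (N : ℕ) (t : ℝ) : ℂ :=
  ∑ n ∈ Finset.Icc 1 (2 * N), (A (n / N) : ℂ) * Complex.exp (-(t * Real.log (n / N) : ℝ) * Complex.I)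

lemma cutoff_div_two_pow (I : ℕ) {x : ℝ} (hx : 1 ≤ x) : cutoff (x / 2 ^ I) =
    ∑ i ∈ Finset.range (I + 1), (cutoff (x / 2 ^ i) - cutoff (2 * (x / 2 ^ i))) := by
  induction I with
  | zero => simp [cutoff_of_two_le (by linarith : 2 ≤ 2 * x)]
  | succ I ih =>
    rw [Finset.sum_range_succ, ← ih, show 2 * (x / 2 ^ (I + 1)) = x / 2 ^ I by rw [pow_succ]; field_simp]
    ring

lemma exists_norm_zeta_le_sum_smoothSum : ∃ C : ℝ, 0 < C ∧ ∀ T t : ℝ, ∀ I : ℕ, 2 ≤ T → T < t →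
    t ≤ 2 * T → T ≤ 2 ^ I → (2 : ℝ) ^ I ≤ 2 * T →
    ‖riemannZeta (1 / 2 + t * Complex.I)‖ ≤ C + ∑ i ∈ Finset.range (I + 1),
      ‖smoothSum dyadicBump (2 ^ i) t‖ / √(2 ^ i) := by
  obtain ⟨C, hC, h⟩ := exists_zeta_sub_smooth_sum_le
  refine ⟨C, hC, fun T t I hT h1 h2 h3 h4 => ?_⟩
  have hm := h T t (2 ^ I) hT h1 h2 (by push_cast; exact h3) (by push_cast; exact h4)
  have hterm : ∀ i ∈ Finset.range (I + 1), ∑ n ∈ Finset.Icc (1 : ℕ) (2 * 2 ^ I),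
      (((cutoff (n / 2 ^ i) - cutoff (2 * (n / 2 ^ i))) / √n : ℝ) : ℂ) *
        ((n : ℝ) : ℂ) ^ (-(t * Complex.I)) = ((1 / √(2 ^ i) : ℝ) : ℂ) *
        (((2 : ℝ) ^ i : ℝ) : ℂ) ^ (-(t * Complex.I)) * smoothSum dyadicBump (2 ^ i) t := by
    intro i hi
    have hiI : i ≤ I := by simpa [Nat.lt_succ_iff] using hi
    have hp : (0 : ℝ) < 2 ^ i := by positivity
    rw [smoothSum, Finset.mul_sum]
    symm
    have hle : 2 ^ i ≤ 2 ^ I := Nat.pow_le_pow_right (by norm_num) hiI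
    refine (Finset.sum_congr rfl fun n hn => ?_).trans (Finset.sum_subset (f := fun n : ℕ =>
      (((cutoff (n / 2 ^ i) - cutoff (2 * (n / 2 ^ i))) / √n : ℝ) : ℂ) *
        ((n : ℝ) : ℂ) ^ (-(t * Complex.I))) (fun n hn => ?_) (fun n hn hn' => ?_))
    · have hn0 : (0 : ℝ) < n := by exact_mod_cast (Finset.mem_Icc.1 hn).1
      have e1 : ((n : ℝ) : ℂ) ^ (-(t * Complex.I)) = (((2 : ℝ) ^ i : ℝ) : ℂ) ^ (-(t * Complex.I)) *
          Complex.exp (-(t * Real.log (n / 2 ^ i) : ℝ) * Complex.I) := by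
        conv_lhs => rw [show (n : ℝ) = 2 ^ i * (n / 2 ^ i) by field_simp]
        rw [Complex.ofReal_mul, Complex.mul_cpow_ofReal_nonneg hp.le (by positivity)]
        congr 1
        rw [Complex.cpow_def_of_ne_zero (by norm_cast; positivity), ← Complex.ofReal_log (by positivity)]
        congr 1; push_cast; ring
      rw [e1, dyadicBump]
      push_cast
      have e2 : √(n / 2 ^ i : ℝ) = √n / √(2 ^ i) := Real.sqrt_div hn0.le _
      rw [e2]
      have : (√(2 ^ i : ℝ) : ℂ) ≠ 0 := by exact_mod_cast (Real.sqrt_pos.2 hp).ne'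
      have : (√(n : ℝ) : ℂ) ≠ 0 := by exact_mod_cast (Real.sqrt_pos.2 hn0).ne'
      push_cast
      field_simp
    · simp only [Finset.mem_Icc] at hn ⊢; omega
    · simp only [Finset.mem_Icc] at hn hn'
      have h5 : ((2 * 2 ^ i : ℕ) : ℝ) ≤ n := by exact_mod_cast (by omega : 2 * 2 ^ i ≤ n)
      push_cast at h5
      have h6 : 2 ≤ (n : ℝ) / 2 ^ i := by rw [le_div_iff₀ hp]; linarith
      simp only [cutoff_of_two_le h6, cutoff_of_two_le (by linarith : 2 ≤ 2 * ((n : ℝ) / 2 ^ i))]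
      simp
  have hsum : ∑ n ∈ Finset.Icc (1 : ℕ) (2 * 2 ^ I), ((cutoff (n / (2 ^ I : ℕ)) / √n : ℝ) : ℂ) *
      ((n : ℝ) : ℂ) ^ (-(t * Complex.I)) = ∑ i ∈ Finset.range (I + 1), ((1 / √(2 ^ i) : ℝ) : ℂ) *
        (((2 : ℝ) ^ i : ℝ) : ℂ) ^ (-(t * Complex.I)) * smoothSum dyadicBump (2 ^ i) t := by
    rw [← Finset.sum_congr rfl hterm, Finset.sum_comm]
    refine Finset.sum_congr rfl fun n hn => ?_
    have hn0 : (1 : ℝ) ≤ n := by exact_mod_cast (Finset.mem_Icc.1 hn).1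
    push_cast
    rw [cutoff_div_two_pow I hn0, ← Finset.sum_mul]
    push_cast
    rw [Finset.sum_div]
  rw [hsum] at hm
  have h7 := norm_le_norm_add_norm_sub' (riemannZeta (1 / 2 + t * Complex.I))
    (∑ i ∈ Finset.range (I + 1), ((1 / √(2 ^ i) : ℝ) : ℂ) *
        (((2 : ℝ) ^ i : ℝ) : ℂ) ^ (-(t * Complex.I)) * smoothSum dyadicBump (2 ^ i) t)
  refine h7.trans ?_
  rw [add_comm]
  refine add_le_add hm ((norm_sum_le _ _).trans (Finset.sum_le_sum fun i _ => le_of_eq ?_))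
  rw [norm_mul, norm_mul, norm_cpow_neg_mul_I (by positivity), Complex.norm_real, Real.norm_eq_abs,
    abs_of_nonneg (by positivity)]
  ring

/-- First derivative test for `∫ (y / r) E`, where `E` has logarithmic derivative `i p / r` and `p` is
monotone and bounded away from zero. -/
lemma norm_integral_le_of_phase {c d μ S S' : ℝ} (hcd : c ≤ d) (hμ : 0 < μ) {y y' E : ℝ → ℂ}
    {p p' r : ℝ → ℝ} (hy : ∀ z ∈ Set.Icc c d, HasDerivAt y (y' z) z)
    (hp : ∀ z ∈ Set.Icc c d, HasDerivAt p (p' z) z)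
    (hE : ∀ z ∈ Set.Icc c d, HasDerivAt E (Complex.I * (p z / r z : ℝ) * E z) z)
    (hr : ∀ z ∈ Set.Icc c d, r z ≠ 0)
    (hyc : ContinuousOn y' (Set.Icc c d)) (hpc : ContinuousOn p' (Set.Icc c d))
    (hrc : ContinuousOn r (Set.Icc c d)) (hE1 : ∀ z, ‖E z‖ = 1)
    (hp' : ∀ z ∈ Set.Icc c d, 0 ≤ p' z) (hS : ∀ z ∈ Set.Icc c d, ‖y z‖ ≤ S)
    (hS' : ∀ z ∈ Set.Icc c d, ‖y' z‖ ≤ S')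
    (hsign : (∀ z ∈ Set.Icc c d, μ ≤ p z) ∨ ∀ z ∈ Set.Icc c d, p z ≤ -μ) :
    ‖∫ z in c..d, y z / r z * E z‖ ≤ 3 * S / μ + (d - c) * S' / μ := by
  have hp0 : ∀ z ∈ Set.Icc c d, μ ≤ |p z| := by
    intro z hz
    rcases hsign with h | h
    · exact (h z hz).trans (le_abs_self _)
    · exact (by linarith [h z hz] : μ ≤ -p z).trans (neg_le_abs _)
  have hpne : ∀ z ∈ Set.Icc c d, p z ≠ 0 := fun z hz => abs_pos.1 (hμ.trans_le (hp0 z hz))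
  have hycont : ContinuousOn y (Set.Icc c d) := fun z hz => (hy z hz).continuousAt.continuousWithinAt
  have hpcont : ContinuousOn p (Set.Icc c d) := fun z hz => (hp z hz).continuousAt.continuousWithinAt
  have hEcont : ContinuousOn E (Set.Icc c d) := fun z hz => (hE z hz).continuousAt.continuousWithinAt
  have hS0 : 0 ≤ S := (norm_nonneg _).trans (hS c (Set.left_mem_Icc.2 hcd))
  have hS0' : 0 ≤ S' := (norm_nonneg _).trans (hS' c (Set.left_mem_Icc.2 hcd))
  have hpinv : ∀ z ∈ Set.Icc c d, HasDerivAt (fun z => (p z)⁻¹) (-p' z / p z ^ 2) z :=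
    fun z hz => (hp z hz).inv (hpne z hz)
  set B : ℝ → ℂ := fun z => (y' z * ((p z)⁻¹ : ℝ) + y z * (-p' z / p z ^ 2 : ℝ)) * E z with hB
  set F : ℝ → ℂ := fun z => y z / r z * E z with hF
  have hBc : ContinuousOn B (Set.Icc c d) := by
    refine ((hyc.mul ?_).add (hycont.mul ?_)).mul hEcont
    · exact Complex.continuous_ofReal.comp_continuousOn (hpcont.inv₀ hpne)
    · exact Complex.continuous_ofReal.comp_continuousOn
        (hpc.neg.div (hpcont.pow 2) fun z hz => pow_ne_zero 2 (hpne z hz))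
  have hFc : ContinuousOn F (Set.Icc c d) := by
    refine (hycont.div (Complex.continuous_ofReal.comp_continuousOn hrc) ?_).mul hEcont
    intro z hz; simpa using hr z hz
  have hu : Set.uIcc c d = Set.Icc c d := Set.uIcc_of_le hcd
  have hBi : IntervalIntegrable B volume c d := ContinuousOn.intervalIntegrable (by rwa [hu])
  have hFi : IntervalIntegrable F volume c d := ContinuousOn.intervalIntegrable (by rwa [hu])
  have hder : ∀ z ∈ Set.uIcc c d, HasDerivAt (fun z => y z * ((p z)⁻¹ : ℝ) * E z)
      (B z + Complex.I * F z) z := by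
    rw [hu]
    intro z hz
    have h := ((hy z hz).mul (hpinv z hz).ofReal_comp).mul (hE z hz)
    refine h.congr_deriv ?_
    have h1 : (p z : ℂ) ≠ 0 := by exact_mod_cast hpne z hz
    have h2 : (r z : ℂ) ≠ 0 := by exact_mod_cast hr z hz
    simp only [hB, hF, Pi.mul_apply]; push_cast; field_simp
  have hinteg := intervalIntegral.integral_eq_sub_of_hasDerivAt hder (hBi.add (hFi.const_mul _))
  rw [intervalIntegral.integral_add hBi (hFi.const_mul _), intervalIntegral.integral_const_mul] at hinteg
  have hFeq : Complex.I * ∫ z in c..d, F z = y d * ((p d)⁻¹ : ℝ) * E d - y c * ((p c)⁻¹ : ℝ) * E c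
      - ∫ z in c..d, B z := by rw [← hinteg]; ring
  have hend : ∀ z ∈ Set.Icc c d, ‖y z * ((p z)⁻¹ : ℝ) * E z‖ ≤ S / μ := by
    intro z hz
    rw [norm_mul, norm_mul, hE1, mul_one, Complex.norm_real, Real.norm_eq_abs, abs_inv, ← div_eq_mul_inv]
    exact div_le_div₀ hS0 (hS z hz) hμ (hp0 z hz)
  have hgi : IntervalIntegrable (fun z => S' / μ + S * (p' z / p z ^ 2)) volume c d := by
    refine ContinuousOn.intervalIntegrable ?_
    rw [hu]
    exact continuousOn_const.add (continuousOn_const.mul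
        (hpc.div (hpcont.pow 2) fun z hz => pow_ne_zero 2 (hpne z hz)))
  have hBn : ‖∫ z in c..d, B z‖ ≤ ∫ z in c..d, (S' / μ + S * (p' z / p z ^ 2)) := by
    refine intervalIntegral.norm_integral_le_of_norm_le hcd ?_ hgi
    filter_upwards with z hz
    have hz' : z ∈ Set.Icc c d := ⟨hz.1.le, hz.2⟩
    simp only [hB]
    rw [norm_mul, hE1, mul_one]
    refine (norm_add_le _ _).trans (add_le_add ?_ ?_)
    · rw [norm_mul, Complex.norm_real, Real.norm_eq_abs, abs_inv, ← div_eq_mul_inv]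
      exact div_le_div₀ hS0' (hS' z hz') hμ (hp0 z hz')
    · rw [norm_mul, Complex.norm_real, Real.norm_eq_abs, neg_div, abs_neg,
        abs_of_nonneg (div_nonneg (hp' z hz') (sq_nonneg _))]
      exact mul_le_mul_of_nonneg_right (hS z hz') (div_nonneg (hp' z hz') (sq_nonneg _))
  have hgint : ∫ z in c..d, (S' / μ + S * (p' z / p z ^ 2)) =
      (d * (S' / μ) - S * (p d)⁻¹) - (c * (S' / μ) - S * (p c)⁻¹) := by
    refine intervalIntegral.integral_eq_sub_of_hasDerivAt
      (f := fun z => z * (S' / μ) - S * (p z)⁻¹) (fun z hz => ?_) hgi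
    rw [hu] at hz
    refine (((hasDerivAt_id z).mul_const _).sub ((hpinv z hz).const_mul S)).congr_deriv ?_
    ring
  have hfin : S * ((p c)⁻¹ - (p d)⁻¹) ≤ S / μ := by
    rw [div_eq_mul_inv]
    refine mul_le_mul_of_nonneg_left ?_ hS0
    have hc := Set.left_mem_Icc.2 hcd
    have hd := Set.right_mem_Icc.2 hcd
    rcases hsign with h | h
    · have h1 : (p c)⁻¹ ≤ μ⁻¹ := inv_anti₀ hμ (h c hc)
      have h2 : 0 ≤ (p d)⁻¹ := inv_nonneg.2 (hμ.le.trans (h d hd))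
      linarith
    · have h1 : (-p d)⁻¹ ≤ μ⁻¹ := inv_anti₀ hμ (by linarith [h d hd])
      have h2 : 0 ≤ (-p c)⁻¹ := inv_nonneg.2 (by linarith [h c hc])
      rw [inv_neg] at h1 h2
      linarith
  have hnorm : ‖∫ z in c..d, F z‖ = ‖Complex.I * ∫ z in c..d, F z‖ := by
    rw [norm_mul, Complex.norm_I, one_mul]
  rw [hnorm, hFeq]
  refine (norm_sub_le _ _).trans ((add_le_add ((norm_sub_le _ _).trans (add_le_add
    (hend d (Set.right_mem_Icc.2 hcd)) (hend c (Set.left_mem_Icc.2 hcd)))) (hBn.trans hgint.le)).trans ?_)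
  have : 3 * S / μ + (d - c) * S' / μ = S / μ + S / μ + (S / μ + (d - c) * (S' / μ)) := by ring
  rw [this]
  linarith

/-- The function `log (1 + 1 / z)`. -/
noncomputable def logGap (z : ℝ) : ℝ := Real.log (1 + 1 / z)

lemma hasDerivAt_logGap {z : ℝ} (hz : 0 < z) : HasDerivAt logGap (-1 / (z * (z + 1))) z := by
  have h : HasDerivAt (fun z : ℝ => 1 + 1 / z) (-(z ^ 2)⁻¹) z := by
    simpa [one_div] using (hasDerivAt_inv hz.ne').const_add (1 : ℝ)
  refine (h.log (by positivity)).congr_deriv ?_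
  field_simp

/-- The oscillating factor `exp (i s log (1 + 1 / z))`. -/
noncomputable def osc (s z : ℝ) : ℂ := Complex.exp ((s * logGap z : ℝ) * Complex.I)

lemma norm_osc (s z : ℝ) : ‖osc s z‖ = 1 := Complex.norm_exp_ofReal_mul_I _

lemma hasDerivAt_osc (s : ℝ) {z : ℝ} (hz : 0 < z) :
    HasDerivAt (osc s) (Complex.I * (-s / (z * (z + 1)) : ℝ) * osc s z) z := by
  have h := ((((hasDerivAt_logGap hz).const_mul s).ofReal_comp).mul_const Complex.I).cexp
  refine h.congr_deriv ?_
  simp only [osc]; push_cast; ring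

lemma conj_osc (s z : ℝ) : conj (osc s z) = osc (-s) z := by
  rw [osc, osc, ← Complex.exp_conj, map_mul, Complex.conj_ofReal, Complex.conj_I]
  congr 1; push_cast; ring

/-- A `C¹` amplitude of size `κ` living on the scale `Z`. -/
structure IsAmplitude (Z κ : ℝ) (a : ℝ → ℂ) : Prop where
  contDiff : ContDiff ℝ 1 a
  eq_zero : ∀ z, z ∉ Set.Icc (Z / 2) (2 * Z) → a z = 0
  norm_le : ∀ z, ‖a z‖ ≤ κ
  norm_deriv_le : ∀ z, ‖deriv a z‖ ≤ κ / Z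

lemma IsAmplitude.hasDerivAt {Z κ : ℝ} {a : ℝ → ℂ} (h : IsAmplitude Z κ a) (z : ℝ) :
    HasDerivAt a (deriv a z) z :=
  (h.contDiff.differentiable (by simp) z).hasDerivAt

/-- The integral of an amplitude against a single oscillating factor is small. -/
lemma IsAmplitude.norm_integral_osc_le {Z κ T s : ℝ} (hZ : 1 / 2 ≤ Z) (hκ : 0 ≤ κ) (hT : 0 < T)
    (hs : T ≤ s) {a : ℝ → ℂ} (ha : IsAmplitude Z κ a) :
    ‖∫ z, a z * osc s z‖ ≤ 60 * κ * Z ^ 2 / T := by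
  have hZ0 : 0 < Z := by linarith
  have hset : ∫ z, a z * osc s z = ∫ z in (Z / 2)..(2 * Z),
      (a z * (z * (z + 1) : ℝ)) / ((z * (z + 1) : ℝ) : ℂ) * osc s z := by
    rw [intervalIntegral.integral_of_le (by linarith), ← integral_Icc_eq_integral_Ioc,
      ← setIntegral_eq_integral_of_forall_compl_eq_zero (s := Set.Icc (Z / 2) (2 * Z))
        (fun z hz => by rw [ha.eq_zero z hz, zero_mul])]
    refine setIntegral_congr_fun measurableSet_Icc fun z hz => ?_
    have hz0 : 0 < z := by linarith [hz.1]
    have : ((z * (z + 1) : ℝ) : ℂ) ≠ 0 := by exact_mod_cast (by positivity : z * (z + 1) ≠ 0)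
    rw [mul_div_cancel_right₀ _ this]
  rw [hset]
  have key := norm_integral_le_of_phase (c := Z / 2) (d := 2 * Z) (μ := T) (S := 8 * κ * Z ^ 2)
    (S' := 16 * κ * Z) (by linarith) hT
    (y := fun z => a z * ((z * (z + 1) : ℝ) : ℂ))
    (y' := fun z => deriv a z * ((z * (z + 1) : ℝ) : ℂ) + a z * ((1 * (z + 1) + z * 1 : ℝ) : ℂ))
    (E := osc s) (p := fun _ => -s) (p' := fun _ => 0) (r := fun z => z * (z + 1))
    (fun z hz => (ha.hasDerivAt z).mul
      ((hasDerivAt_id z).mul ((hasDerivAt_id z).add_const 1)).ofReal_comp)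
    (fun z _ => hasDerivAt_const z _)
    (fun z hz => hasDerivAt_osc s (by linarith [hz.1]))
    (fun z hz => by have : 0 < z := by linarith [hz.1]
                    positivity)
    (by
      have h1 := ha.contDiff.continuous
      have h2 := ha.contDiff.continuous_deriv le_rfl
      fun_prop)
    continuousOn_const (by fun_prop) (norm_osc s) (fun _ _ => le_rfl)
    (fun z hz => by
      have hz0 : 0 < z := by linarith [hz.1]
      rw [norm_mul, Complex.norm_real, Real.norm_eq_abs, abs_of_pos (by positivity)]
      have : z * (z + 1) ≤ 8 * Z ^ 2 := by nlinarith [hz.2]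
      calc _ ≤ κ * (8 * Z ^ 2) := by gcongr; exact ha.norm_le z
        _ = _ := by ring)
    (fun z hz => by
      have hz0 : 0 < z := by linarith [hz.1]
      refine (norm_add_le _ _).trans ?_
      rw [norm_mul, norm_mul, Complex.norm_real, Real.norm_eq_abs, abs_of_pos (by positivity),
        Complex.norm_real, Real.norm_eq_abs, abs_of_pos (by positivity)]
      have : z * (z + 1) ≤ 8 * Z ^ 2 := by nlinarith [hz.2]
      have : 1 * (z + 1) + z * 1 ≤ 8 * Z := by linarith [hz.2]
      calc _ ≤ κ / Z * (8 * Z ^ 2) + κ * (8 * Z) := by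
            gcongr
            exacts [ha.norm_deriv_le z, ha.norm_le z]
        _ = _ := by field_simp; ring)
    (Or.inr fun z _ => by linarith)
  refine key.trans ?_
  rw [← add_div]
  gcongr
  nlinarith [mul_nonneg hκ (sq_nonneg Z)]

/-- The correlation of two oscillating amplitudes at an integer shift. -/
noncomputable def corr (a b : ℝ → ℂ) (s t : ℝ) (l : ℤ) : ℂ :=
  ∫ z, a z * osc s z * conj (b (z + l) * osc t (z + l))

lemma corr_swap (a b : ℝ → ℂ) (s t : ℝ) (l : ℤ) : ‖corr a b s t l‖ = ‖corr b a t s (-l)‖ := by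
  rw [← RCLike.norm_conj (corr b a t s (-l))]
  unfold corr
  rw [← integral_conj, ← integral_add_right_eq_self _ (-(l : ℝ))]
  congr 2
  funext z
  simp only [map_mul, RingHomCompTriple.comp_apply, RingHom.id_apply]
  push_cast
  rw [neg_add_cancel_right]
  ring

lemma corr_eq_zero {Z κ κ' : ℝ} {a b : ℝ → ℂ} (ha : IsAmplitude Z κ a)
    (hb : IsAmplitude Z κ' b) (s t : ℝ) {l : ℤ} (hl : 2 * Z < |(l : ℝ)|) : corr a b s t l = 0 := by
  unfold corr
  rw [← integral_zero ℝ ℂ]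
  congr 1
  funext z
  by_cases h1 : z ∈ Set.Icc (Z / 2) (2 * Z)
  · by_cases h2 : z + l ∈ Set.Icc (Z / 2) (2 * Z)
    · exfalso
      rcases abs_cases (l : ℝ) with h | h <;> linarith [h1.1, h1.2, h2.1, h2.2]
    · rw [hb.eq_zero _ h2]; simp
  · rw [ha.eq_zero _ h1]; simp

lemma corr_eq_integral {Z κ κ' : ℝ} {a b : ℝ → ℂ} (ha : IsAmplitude Z κ a)
    (hb : IsAmplitude Z κ' b) (s t : ℝ) (l : ℤ) {α β : ℝ} (hα : α = max (Z / 2) (Z / 2 - l))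
    (hβ : β = min (2 * Z) (2 * Z - l)) (h : α ≤ β) :
    corr a b s t l = ∫ z in α..β, a z * osc s z * conj (b (z + l) * osc t (z + l)) := by
  unfold corr
  rw [intervalIntegral.integral_of_le h, ← integral_Icc_eq_integral_Ioc]
  refine (setIntegral_eq_integral_of_forall_compl_eq_zero fun z hz => ?_).symm
  by_cases h1 : z ∈ Set.Icc (Z / 2) (2 * Z)
  · by_cases h2 : z + l ∈ Set.Icc (Z / 2) (2 * Z)
    · refine absurd ⟨?_, ?_⟩ hz
      · rw [hα]; exact max_le h1.1 (by linarith [h2.1])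
      · rw [hβ]; exact le_min h1.2 (by linarith [h2.2])
    · rw [hb.eq_zero _ h2]; simp
  · rw [ha.eq_zero _ h1]; simp

lemma corr_eq_zero_of_lt {Z κ κ' : ℝ} {a b : ℝ → ℂ} (ha : IsAmplitude Z κ a)
    (hb : IsAmplitude Z κ' b) (s t : ℝ) (l : ℤ)
    (h : min (2 * Z) (2 * Z - l) < max (Z / 2) (Z / 2 - l)) :
    corr a b s t l = 0 := by
  unfold corr
  rw [← integral_zero ℝ ℂ]
  congr 1
  funext z
  by_cases h1 : z ∈ Set.Icc (Z / 2) (2 * Z)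
  · by_cases h2 : z + l ∈ Set.Icc (Z / 2) (2 * Z)
    · exfalso
      have := max_le h1.1 (by linarith [h2.1] : Z / 2 - l ≤ z)
      have := le_min h1.2 (by linarith [h2.2] : z ≤ 2 * Z - l)
      linarith
    · rw [hb.eq_zero _ h2]; simp
  · rw [ha.eq_zero _ h1]; simp

/-- The numerator of the derivative of the phase `s log (1 + 1/z) - t log (1 + 1/(z+l))`. -/
noncomputable def phaseNum (s t l z : ℝ) : ℝ := (t - s) * (z + 1) - s * l * (2 + (l + 1) / z)

lemma norm_integral_corr_le {Z κ s t μ c d : ℝ} (hZ : 1 / 2 ≤ Z) (hs : 0 ≤ s) (hst : s ≤ t)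
    (hμ : 0 < μ) {a b : ℝ → ℂ} (ha : IsAmplitude Z κ a) (hb : IsAmplitude Z κ b) (l : ℤ) (hcd : c ≤ d)
    (hc : Z / 2 ≤ c) (hc' : Z / 2 ≤ c + l) (hd : d ≤ 2 * Z) (hd' : d + l ≤ 2 * Z)
    (hsign : (∀ z ∈ Set.Icc c d, μ ≤ phaseNum s t l z) ∨ ∀ z ∈ Set.Icc c d, phaseNum s t l z ≤ -μ) :
    ‖∫ z in c..d, a z * osc s z * conj (b (z + l) * osc t (z + l))‖ ≤ 240 * κ ^ 2 * Z ^ 3 / μ := by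
  have hZ0 : 0 < Z := by linarith
  have hκ : 0 ≤ κ := (norm_nonneg _).trans (ha.norm_le 0)
  set r : ℝ → ℝ := fun z => (z + 1) * (z + l) * (z + l + 1) with hr
  set r' : ℝ → ℝ := fun z => (1 * (z + l) + (z + 1) * 1) * (z + l + 1) + (z + 1) * (z + l) * 1
  set y : ℝ → ℂ := fun z => a z * conj (b (z + l)) * r z with hy
  set y' : ℝ → ℂ := fun z => (deriv a z * conj (b (z + l)) + a z * conj (deriv b (z + l))) * r z
    + a z * conj (b (z + l)) * r' z with hy'
  set E : ℝ → ℂ := fun z => osc s z * conj (osc t (z + l))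
  have hpos : ∀ z ∈ Set.Icc c d, 0 < z ∧ 0 < z + l ∧ z ≤ 2 * Z ∧ z + l ≤ 2 * Z := fun z hz =>
    ⟨by linarith [hz.1], by linarith [hz.1], by linarith [hz.2], by linarith [hz.2]⟩
  have hrpos : ∀ z ∈ Set.Icc c d, 0 < r z := fun z hz => by
    obtain ⟨h1, h2, -, -⟩ := hpos z hz
    simp only [hr]; positivity
  have hr1 : ∀ z ∈ Set.Icc c d, r z ≤ 32 * Z ^ 3 := fun z hz => by
    obtain ⟨h1, h2, h3, h4⟩ := hpos z hz
    calc r z ≤ (4 * Z) * (2 * Z) * (4 * Z) := by simp only [hr]; gcongr <;> linarith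
      _ = _ := by ring
  have hr2 : ∀ z ∈ Set.Icc c d, 0 ≤ r' z ∧ r' z ≤ 32 * Z ^ 2 := fun z hz => by
    obtain ⟨h1, h2, h3, h4⟩ := hpos z hz
    refine ⟨by simp only [r']; positivity, ?_⟩
    calc r' z ≤ (1 * (2 * Z) + (4 * Z) * 1) * (4 * Z) + (4 * Z) * (2 * Z) * 1 := by
          simp only [r']; gcongr <;> linarith
      _ = _ := by ring
  have hbd : ∀ z, HasDerivAt (fun z => conj (b (z + l))) (conj (deriv b (z + l))) z := fun z =>
    ((hb.hasDerivAt (z + l)).comp_add_const z (l : ℝ)).star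
  have hrd : ∀ z, HasDerivAt r (r' z) z := fun z =>
    (((hasDerivAt_id z).add_const 1).mul ((hasDerivAt_id z).add_const (l : ℝ))).mul
      (((hasDerivAt_id z).add_const (l : ℝ)).add_const 1)
  have hEd : ∀ z ∈ Set.Icc c d, HasDerivAt E (Complex.I * (phaseNum s t l z / r z : ℝ) * E z) z := by
    intro z hz
    obtain ⟨h1, h2, -, -⟩ := hpos z hz
    have hconj : (fun z => conj (osc t (z + l))) = fun z => osc (-t) (z + l) := by
      funext z; exact conj_osc _ _
    have h := (hasDerivAt_osc s h1).mul ((hasDerivAt_osc (-t) h2).comp_add_const z (l : ℝ))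
    have hEe : E = osc s * fun z => osc (-t) (z + l) := by
      funext z; simp only [E, Pi.mul_apply, conj_osc]
    rw [hEe]
    refine h.congr_deriv ?_
    have e : phaseNum s t l z / r z = -s / (z * (z + 1)) + -(-t) / ((z + l) * (z + l + 1)) := by
      simp only [phaseNum, hr]; field_simp; ring
    rw [e]; simp only [Pi.mul_apply]; push_cast; ring
  have hpd : ∀ z ∈ Set.Icc c d, HasDerivAt (phaseNum s t l) ((t - s) + s * (l * (l + 1)) / z ^ 2) z := by
    intro z hz
    obtain ⟨h1, -, -, -⟩ := hpos z hz
    have h := (((hasDerivAt_id z).add_const 1).const_mul (t - s)).sub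
      ((((hasDerivAt_inv h1.ne').const_mul ((l : ℝ) + 1)).const_add 2).const_mul (s * l))
    refine (h.congr_deriv ?_)
    field_simp; ring
  have hll : 0 ≤ (l : ℝ) * (l + 1) := by
    rcases le_or_gt 0 l with h | h
    · have : (0 : ℝ) ≤ l := by exact_mod_cast h
      positivity
    · have : (l : ℝ) ≤ -1 := by exact_mod_cast (by omega : l ≤ -1)
      nlinarith
  have hac := ha.contDiff.continuous
  have hbc := hb.contDiff.continuous
  have hac' := ha.contDiff.continuous_deriv le_rfl
  have hbc' := hb.contDiff.continuous_deriv le_rfl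
  have key := norm_integral_le_of_phase (c := c) (d := d) (μ := μ) (S := 32 * κ ^ 2 * Z ^ 3)
    (S' := 96 * κ ^ 2 * Z ^ 2) hcd hμ (y := y) (y' := y') (E := E) (p := phaseNum s t l)
    (p' := fun z => (t - s) + s * (l * (l + 1)) / z ^ 2) (r := r)
    (fun z hz => ((ha.hasDerivAt z).mul (hbd z)).mul (hrd z).ofReal_comp)
    hpd hEd (fun z hz => (hrpos z hz).ne')
    (by
      have : Continuous (fun x : ℂ => conj x) := Complex.continuous_conj
      simp only [hy', r', hr]; fun_prop)
    (by
      refine continuousOn_const.add (continuousOn_const.div (by fun_prop) fun z hz => ?_)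
      have := (hpos z hz).1
      positivity)
    (by simp only [hr]; fun_prop)
    (fun z => by simp only [E]; rw [norm_mul, RCLike.norm_conj, norm_osc, norm_osc, one_mul])
    (fun z hz => add_nonneg (by linarith) (div_nonneg (mul_nonneg hs hll) (sq_nonneg _)))
    (fun z hz => by
      simp only [hy]
      rw [norm_mul, norm_mul, RCLike.norm_conj, Complex.norm_real, Real.norm_eq_abs,
        abs_of_pos (hrpos z hz)]
      calc _ ≤ κ * κ * (32 * Z ^ 3) := by
            gcongr
            exacts [(hrpos z hz).le, ha.norm_le z, hb.norm_le _, hr1 z hz]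
        _ = _ := by ring)
    (fun z hz => by
      simp only [hy']
      refine (norm_add_le _ _).trans ?_
      rw [norm_mul, norm_mul, norm_mul, RCLike.norm_conj, Complex.norm_real, Real.norm_eq_abs,
        abs_of_pos (hrpos z hz), Complex.norm_real, Real.norm_eq_abs, abs_of_nonneg (hr2 z hz).1]
      have h1 : ‖deriv a z * conj (b (z + l)) + a z * conj (deriv b (z + l))‖ ≤
          κ / Z * κ + κ * (κ / Z) := by
        refine (norm_add_le _ _).trans ?_
        rw [norm_mul, norm_mul, RCLike.norm_conj, RCLike.norm_conj]
        gcongr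
        exacts [ha.norm_deriv_le z, hb.norm_le _, ha.norm_le z, hb.norm_deriv_le _]
      calc _ ≤ (κ / Z * κ + κ * (κ / Z)) * (32 * Z ^ 3) + κ * κ * (32 * Z ^ 2) := by
            gcongr
            exacts [(hrpos z hz).le, hr1 z hz, (hr2 z hz).1, ha.norm_le z, hb.norm_le _, (hr2 z hz).2]
        _ = _ := by field_simp; ring)
    hsign
  have hcongr : ∫ z in c..d, a z * osc s z * conj (b (z + l) * osc t (z + l)) =
      ∫ z in c..d, y z / r z * E z := by
    refine intervalIntegral.integral_congr fun z hz => ?_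
    rw [Set.uIcc_of_le hcd] at hz
    have : (r z : ℂ) ≠ 0 := by exact_mod_cast (hrpos z hz).ne'
    simp only [hy, E]
    rw [mul_div_cancel_right₀ _ this, map_mul]; ring
  rw [hcongr]
  refine key.trans ?_
  rw [← add_div]
  gcongr
  have : (d - c) * (96 * κ ^ 2 * Z ^ 2) ≤ (3 / 2 * Z) * (96 * κ ^ 2 * Z ^ 2) := by
    gcongr; linarith
  nlinarith

lemma norm_integrand_corr_le {Z κ : ℝ} {a b : ℝ → ℂ} (ha : IsAmplitude Z κ a)
    (hb : IsAmplitude Z κ b) (s t : ℝ) (l : ℤ) (z : ℝ) :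
    ‖a z * osc s z * conj (b (z + l) * osc t (z + l))‖ ≤ κ ^ 2 := by
  rw [norm_mul, norm_mul, RCLike.norm_conj, norm_mul, norm_osc, norm_osc, mul_one, mul_one, sq]
  exact mul_le_mul (ha.norm_le _) (hb.norm_le _) (norm_nonneg _) ((norm_nonneg _).trans (ha.norm_le z))

lemma norm_corr_le_trivial {Z κ : ℝ} (hZ : 0 < Z) {a b : ℝ → ℂ} (ha : IsAmplitude Z κ a)
    (hb : IsAmplitude Z κ b) (s t : ℝ) (l : ℤ) : ‖corr a b s t l‖ ≤ 2 * κ ^ 2 * Z := by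
  by_cases h : max (Z / 2) (Z / 2 - l) ≤ min (2 * Z) (2 * Z - l)
  · rw [corr_eq_integral ha hb s t l rfl rfl h]
    refine (intervalIntegral.norm_integral_le_of_norm_le_const
      (fun z _ => norm_integrand_corr_le ha hb s t l z)).trans ?_
    rw [abs_of_nonneg (sub_nonneg.2 h)]
    have h1 := le_max_left (Z / 2) (Z / 2 - l)
    have h2 := min_le_left (2 * Z) (2 * Z - l)
    nlinarith [sq_nonneg κ]
  · rw [corr_eq_zero_of_lt ha hb s t l (not_le.1 h), norm_zero]; positivity

/-- The first derivative bound on the full range. -/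
lemma norm_corr_le_of_sign {Z κ s t μ : ℝ} (hZ : 1 / 2 ≤ Z) (hs : 0 ≤ s) (hst : s ≤ t)
    (hμ : 0 < μ) {a b : ℝ → ℂ} (ha : IsAmplitude Z κ a) (hb : IsAmplitude Z κ b) (l : ℤ)
    (hsign : (∀ z, Z / 2 ≤ z → Z / 2 ≤ z + l → z ≤ 2 * Z → μ ≤ phaseNum s t l z) ∨
      ∀ z, Z / 2 ≤ z → Z / 2 ≤ z + l → z ≤ 2 * Z → phaseNum s t l z ≤ -μ) :
    ‖corr a b s t l‖ ≤ 240 * κ ^ 2 * Z ^ 3 / μ := by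
  by_cases h : max (Z / 2) (Z / 2 - l) ≤ min (2 * Z) (2 * Z - l)
  · rw [corr_eq_integral ha hb s t l rfl rfl h]
    have h1 := le_max_left (Z / 2) (Z / 2 - l)
    have h2 := min_le_left (2 * Z) (2 * Z - l)
    have h3 := le_max_right (Z / 2) (Z / 2 - l)
    have h4 := min_le_right (2 * Z) (2 * Z - l)
    refine norm_integral_corr_le hZ hs hst hμ ha hb l h h1 (by linarith) h2 (by linarith) ?_
    refine hsign.imp (fun H z hz => ?_) (fun H z hz => ?_) <;>
    exact H z (by linarith [hz.1]) (by linarith [hz.1]) (by linarith [hz.2])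
  · rw [corr_eq_zero_of_lt ha hb s t l (not_le.1 h), norm_zero]
    have : 0 < Z := by linarith
    positivity

lemma norm_corr_zero_le {Z κ s t : ℝ} (hZ : 1 / 2 ≤ Z) (hs : 0 ≤ s) (hst : s < t)
    {a b : ℝ → ℂ} (ha : IsAmplitude Z κ a) (hb : IsAmplitude Z κ b) :
    ‖corr a b s t 0‖ ≤ 480 * κ ^ 2 * Z ^ 2 / (t - s) := by
  have hZ0 : 0 < Z := by linarith
  have hΔ : 0 < t - s := by linarith
  refine (norm_corr_le_of_sign hZ hs hst.le (μ := (t - s) * (Z / 2)) (by positivity) ha hb 0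
    (Or.inl fun z hz _ _ => ?_)).trans (le_of_eq ?_)
  · simp only [phaseNum]; push_cast; nlinarith
  · field_simp; ring

lemma norm_corr_neg_le {Z κ s t T : ℝ} (hZ : 1 / 2 ≤ Z) (hT : 0 < T) (hs : T ≤ s) (hst : s ≤ t)
    {a b : ℝ → ℂ} (ha : IsAmplitude Z κ a) (hb : IsAmplitude Z κ b) {l : ℤ} (hl : l < 0) :
    ‖corr a b s t l‖ ≤ 240 * κ ^ 2 * Z ^ 3 / (T * |(l : ℝ)|) := by
  have hl1 : (l : ℝ) ≤ -1 := by exact_mod_cast (by omega : l ≤ -1)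
  rw [abs_of_neg (by linarith)]
  refine norm_corr_le_of_sign hZ (by linarith) hst (by nlinarith) ha hb l
    (Or.inl fun z hz hzl _ => ?_)
  have hz0 : 0 < z := by linarith
  have h1 : -1 ≤ (l + 1 : ℝ) / z := by rw [le_div_iff₀ hz0]; linarith
  have h2 : 0 ≤ (t - s) * (z + 1) := mul_nonneg (by linarith) (by linarith)
  have h3 : T * -(l : ℝ) ≤ s * -l := by nlinarith
  have h4 : s * -(l : ℝ) * 1 ≤ s * -l * (2 + (l + 1) / z) :=
    mul_le_mul_of_nonneg_left (by linarith) (by nlinarith)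
  simp only [phaseNum]; nlinarith

lemma norm_corr_pos_le {Z κ s t T : ℝ} (hZ : 1 / 2 ≤ Z) (hT : 0 < T) (hs : T ≤ s) (hst : s ≤ t)
    {a b : ℝ → ℂ} (ha : IsAmplitude Z κ a) (hb : IsAmplitude Z κ b) {l : ℤ} (hl : 0 < l)
    (hbig : (t - s) * (4 * Z + 1) ≤ T * l) :
    ‖corr a b s t l‖ ≤ 240 * κ ^ 2 * Z ^ 3 / (T * |(l : ℝ)|) := by
  have hl1 : (1 : ℝ) ≤ l := by exact_mod_cast (by omega : 1 ≤ l)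
  rw [abs_of_pos (by linarith)]
  refine norm_corr_le_of_sign hZ (by linarith) hst (by positivity) ha hb l
    (Or.inr fun z hz hzl hz2 => ?_)
  have hz0 : 0 < z := by linarith
  have h1 : 0 ≤ (l + 1 : ℝ) / z := by positivity
  have h2 : (t - s) * (z + 1) ≤ (t - s) * (4 * Z + 1) :=
    mul_le_mul_of_nonneg_left (by linarith) (by linarith)
  have h4 : s * (l : ℝ) * 2 ≤ s * l * (2 + (l + 1) / z) :=
    mul_le_mul_of_nonneg_left (by linarith) (by nlinarith)
  have h3 : T * (l : ℝ) ≤ s * l := by nlinarith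
  simp only [phaseNum]; nlinarith

/-- A point around which a function with slope at least `D` is linearly bounded away from zero. -/
lemma exists_pivot {p : ℝ → ℝ} {α β D : ℝ} (h : α ≤ β) (hc : ContinuousOn p (Set.Icc α β))
    (hp : ∀ x ∈ Set.Icc α β, ∀ y ∈ Set.Icc α β, x ≤ y → D * (y - x) ≤ p y - p x) :
    ∃ z₀ ∈ Set.Icc α β, (∀ z ∈ Set.Icc α β, z₀ < z → D * (z - z₀) ≤ p z) ∧
      ∀ z ∈ Set.Icc α β, z < z₀ → p z ≤ -(D * (z₀ - z)) := by
  have hα := Set.left_mem_Icc.2 h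
  have hβ := Set.right_mem_Icc.2 h
  by_cases h1 : 0 ≤ p α
  · exact ⟨α, hα, fun z hz hz' => by linarith [hp α hα z hz hz'.le],
      fun z hz hz' => absurd hz.1 (not_le.2 hz')⟩
  by_cases h2 : p β ≤ 0
  · exact ⟨β, hβ, fun z hz hz' => absurd hz.2 (not_le.2 hz'),
      fun z hz hz' => by linarith [hp z hz β hβ hz'.le]⟩
  obtain ⟨z₀, hz₀, h0⟩ := intermediate_value_Icc h hc ⟨(not_le.1 h1).le, (not_le.1 h2).le⟩
  exact ⟨z₀, hz₀, fun z hz hz' => by linarith [hp z₀ hz₀ z hz hz'.le],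
    fun z hz hz' => by linarith [hp z hz z₀ hz₀ hz'.le]⟩

lemma norm_corr_stationary_le {Z κ s t : ℝ} (hZ : 1 / 2 ≤ Z) (hs : 0 ≤ s) (hst : s < t)
    {a b : ℝ → ℂ} (ha : IsAmplitude Z κ a) (hb : IsAmplitude Z κ b) {l : ℤ} (hl : 0 < l) :
    ‖corr a b s t l‖ ≤ 482 * κ ^ 2 * (Z * √(Z / (t - s))) := by
  have hZ0 : 0 < Z := by linarith
  have hl1 : (1 : ℝ) ≤ l := by exact_mod_cast (by omega : 1 ≤ l)
  have hΔ : 0 < t - s := by linarith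
  by_cases h : max (Z / 2) (Z / 2 - l) ≤ min (2 * Z) (2 * Z - l)
  swap
  · rw [corr_eq_zero_of_lt ha hb s t l (not_le.1 h), norm_zero]
    positivity
  rw [corr_eq_integral ha hb s t l rfl rfl h]
  set α := max (Z / 2) (Z / 2 - l)
  set β := min (2 * Z) (2 * Z - l)
  have hα1 : Z / 2 ≤ α := le_max_left _ _
  have hα2 : Z / 2 - l ≤ α := le_max_right _ _
  have hβ1 : β ≤ 2 * Z := min_le_left _ _
  have hβ2 : β ≤ 2 * Z - l := min_le_right _ _
  have hpos : ∀ z ∈ Set.Icc α β, 0 < z := fun z hz => by linarith [hz.1]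
  obtain ⟨z₀, hz₀, hup, hdown⟩ := exists_pivot (p := phaseNum s t l) (D := t - s) h
    (by
      unfold phaseNum
      refine (by fun_prop : ContinuousOn (fun z : ℝ => (t - s) * (z + 1)) _).sub
        (continuousOn_const.mul (continuousOn_const.add (continuousOn_const.div continuousOn_id ?_)))
      exact fun z hz => (hpos z hz).ne')
    (fun x hx y hy hxy => by
      have hx0 := hpos x hx
      have hy0 := hpos y hy
      have : (l + 1 : ℝ) / y ≤ (l + 1) / x := by gcongr
      have h2 : 0 ≤ s * l * ((l + 1 : ℝ) / x - (l + 1) / y) :=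
        mul_nonneg (by positivity) (by linarith)
      simp only [phaseNum]; nlinarith)
  set w : ℝ := √(Z / (t - s)) * Z with hw
  have hw0 : 0 < w := by positivity
  have hμ : 0 < (t - s) * w := by positivity
  set f : ℝ → ℂ := fun z => a z * osc s z * conj (b (z + l) * osc t (z + l)) with hf
  set c := max α (z₀ - w)
  set d := min β (z₀ + w)
  have hαc : α ≤ c := le_max_left _ _
  have hdβ : d ≤ β := min_le_left _ _
  have hcz : c ≤ z₀ := max_le hz₀.1 (by linarith)
  have hzd : z₀ ≤ d := le_min hz₀.2 (by linarith)
  have hcw : z₀ - w ≤ c := le_max_right _ _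
  have hdw : d ≤ z₀ + w := min_le_right _ _
  have hosc : ∀ (u : ℝ) (z : ℝ), 0 < z → ContinuousAt (osc u) z := fun u z hz =>
    (hasDerivAt_osc u hz).continuousAt
  have hfc : ContinuousOn f (Set.Icc α β) := by
    intro z hz
    have hz0 := hpos z hz
    refine ContinuousAt.continuousWithinAt ?_
    refine (ha.contDiff.continuous.continuousAt.mul (hosc s z hz0)).mul
      (Complex.continuous_conj.continuousAt.comp ?_)
    have hsh : ContinuousAt (fun z : ℝ => z + l) z := by fun_prop
    exact (ContinuousAt.comp (g := b) hb.contDiff.continuous.continuousAt hsh).mul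
      (ContinuousAt.comp (g := osc t) (hosc t _ (by linarith)) hsh)
  have hfi : ∀ x y, α ≤ x → x ≤ y → y ≤ β → IntervalIntegrable f volume x y := by
    intro x y h1 h2 h3
    refine ContinuousOn.intervalIntegrable (hfc.mono ?_)
    rw [Set.uIcc_of_le h2]; exact Set.Icc_subset_Icc h1 h3
  have e1 : ∫ z in α..β, f z = (∫ z in α..c, f z) + (∫ z in c..d, f z) + ∫ z in d..β, f z := by
    rw [intervalIntegral.integral_add_adjacent_intervals (hfi _ _ le_rfl hαc (by linarith))
      (hfi _ _ hαc (by linarith) hdβ), intervalIntegral.integral_add_adjacent_intervals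
      (hfi _ _ le_rfl (by linarith) hdβ) (hfi _ _ (by linarith) hdβ le_rfl)]
  have hB : 240 * κ ^ 2 * Z ^ 3 / ((t - s) * w) = 240 * κ ^ 2 * w := by
    have : w ^ 2 * (t - s) = Z ^ 3 := by
      rw [hw, mul_pow, Real.sq_sqrt (by positivity)]; field_simp
    rw [div_eq_iff hμ.ne', ← this]; ring
  have b1 : ‖∫ z in α..c, f z‖ ≤ 240 * κ ^ 2 * w := by
    by_cases hc : c = α
    · rw [hc, intervalIntegral.integral_same, norm_zero]; positivity
    have hc' : c = z₀ - w := by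
      rcases max_choice α (z₀ - w) with h | h
      · exact absurd h hc
      · exact h
    rw [← hB]
    refine norm_integral_corr_le hZ hs hst.le hμ ha hb l hαc hα1 (by linarith) (by linarith)
      (by linarith) (Or.inr fun z hz => ?_)
    have := hdown z ⟨hz.1, by linarith [hz.2]⟩ (by linarith [hz.2])
    have h3 : (t - s) * w ≤ (t - s) * (z₀ - z) := by gcongr; linarith [hz.2]
    linarith
  have b3 : ‖∫ z in d..β, f z‖ ≤ 240 * κ ^ 2 * w := by
    by_cases hc : d = β
    · rw [hc, intervalIntegral.integral_same, norm_zero]; positivity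
    have hc' : d = z₀ + w := by
      rcases min_choice β (z₀ + w) with h | h
      · exact absurd h hc
      · exact h
    rw [← hB]
    refine norm_integral_corr_le hZ hs hst.le hμ ha hb l hdβ (by linarith) (by linarith) (by linarith)
      (by linarith) (Or.inl fun z hz => ?_)
    have := hup z ⟨by linarith [hz.1], by linarith [hz.2]⟩ (by linarith [hz.1])
    have h3 : (t - s) * w ≤ (t - s) * (z - z₀) := by gcongr; linarith [hz.1]
    linarith
  have b2 : ‖∫ z in c..d, f z‖ ≤ κ ^ 2 * (2 * w) := by
    refine (intervalIntegral.norm_integral_le_of_norm_le_const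
      (fun z _ => norm_integrand_corr_le ha hb s t l z)).trans ?_
    rw [abs_of_nonneg (by linarith)]
    gcongr; linarith
  rw [e1]
  refine (norm_add₃_le).trans ((add_le_add (add_le_add b1 b2) b3).trans (le_of_eq ?_))
  rw [hw]; ring

/-- All off-diagonal correlations at a glance. -/
lemma norm_corr_le_of_le {Z κ s t T : ℝ} (hZ : 1 / 2 ≤ Z) (hT : 0 < T) (hs : T ≤ s) (hst : s ≤ t)
    {a b : ℝ → ℂ} (ha : IsAmplitude Z κ a) (hb : IsAmplitude Z κ b) {l : ℤ} (hl : l ≠ 0) :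
    ‖corr a b s t l‖ ≤ 482 * κ ^ 2 * (Z ^ 3 / (T * |(l : ℝ)|) +
      if T * |(l : ℝ)| ≤ 6 * Z * |t - s| then Z * √(Z / |t - s|) else 0) := by
  have hZ0 : 0 < Z := by linarith
  have hl0 : 0 < |(l : ℝ)| := abs_pos.2 (by exact_mod_cast hl)
  have h1 : 240 * κ ^ 2 * Z ^ 3 / (T * |(l : ℝ)|) ≤ 482 * κ ^ 2 * (Z ^ 3 / (T * |(l : ℝ)|)) := by
    rw [mul_div_assoc]
    have : 0 ≤ κ ^ 2 * (Z ^ 3 / (T * |(l : ℝ)|)) := by positivity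
    nlinarith
  have h2 : 0 ≤ if T * |(l : ℝ)| ≤ 6 * Z * |t - s| then Z * √(Z / |t - s|) else 0 := by
    split_ifs <;> positivity
  have h3 : 240 * κ ^ 2 * Z ^ 3 / (T * |(l : ℝ)|) ≤ 482 * κ ^ 2 * (Z ^ 3 / (T * |(l : ℝ)|) +
      if T * |(l : ℝ)| ≤ 6 * Z * |t - s| then Z * √(Z / |t - s|) else 0) := by
    have : 0 ≤ κ ^ 2 * (if T * |(l : ℝ)| ≤ 6 * Z * |t - s| then Z * √(Z / |t - s|) else 0) := by
      positivity
    linarith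
  rcases lt_or_gt_of_ne hl with h | h
  · exact (norm_corr_neg_le hZ hT hs hst ha hb h).trans h3
  · by_cases hbig : (t - s) * (4 * Z + 1) ≤ T * l
    · exact (norm_corr_pos_le hZ hT hs hst ha hb h hbig).trans h3
    · have hlp : (0 : ℝ) < l := by exact_mod_cast h
      push Not at hbig
      have hts : s < t := by
        by_contra hn
        have : t - s = 0 := by linarith
        rw [this, zero_mul] at hbig
        have : 0 < T * (l : ℝ) := by positivity
        linarith
      have hta : |t - s| = t - s := abs_of_pos (by linarith)
      rw [if_pos (by rw [abs_of_pos hlp, hta]; nlinarith), hta]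
      refine (norm_corr_stationary_le hZ (by linarith) hts ha hb h).trans ?_
      have : 0 ≤ κ ^ 2 * (Z ^ 3 / (T * |(l : ℝ)|)) := by positivity
      linarith

lemma norm_corr_le {Z κ s t T : ℝ} (hZ : 1 / 2 ≤ Z) (hT : 0 < T) (hs : T ≤ s) (ht : T ≤ t)
    {a b : ℝ → ℂ} (ha : IsAmplitude Z κ a) (hb : IsAmplitude Z κ b) {l : ℤ} (hl : l ≠ 0) :
    ‖corr a b s t l‖ ≤ 482 * κ ^ 2 * (Z ^ 3 / (T * |(l : ℝ)|) +
      if T * |(l : ℝ)| ≤ 6 * Z * |t - s| then Z * √(Z / |t - s|) else 0) := by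
  rcases le_total s t with h | h
  · exact norm_corr_le_of_le hZ hT hs h ha hb hl
  · rw [corr_swap]
    have := norm_corr_le_of_le hZ hT ht h hb ha (neg_ne_zero.2 hl)
    rw [abs_sub_comm t s]
    simpa using this

lemma norm_corr_diag_le {Z κ s t : ℝ} (hZ : 1 / 2 ≤ Z) (hs : 0 ≤ s) (ht : 0 ≤ t) {a b : ℝ → ℂ}
    (ha : IsAmplitude Z κ a) (hb : IsAmplitude Z κ b) :
    ‖corr a b s t 0‖ ≤ 480 * κ ^ 2 * (if s = t then Z else Z ^ 2 / |t - s|) := by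
  have hZ0 : 0 < Z := by linarith
  split_ifs with h
  · refine (norm_corr_le_trivial hZ0 ha hb s t 0).trans ?_
    nlinarith [mul_nonneg (sq_nonneg κ) hZ0.le]
  · rw [← mul_div_assoc]
    rcases lt_or_gt_of_ne h with h | h
    · rw [abs_of_pos (by linarith)]; exact norm_corr_zero_le hZ hs h ha hb
    · rw [corr_swap, abs_of_neg (by linarith), neg_sub]
      simpa using norm_corr_zero_le hZ ht h hb ha

lemma sum_Icc_neg_self (F : ℤ → ℝ) (m : ℕ) : ∑ l ∈ Finset.Icc (-m : ℤ) m, F l =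
    F 0 + ∑ n ∈ Finset.Icc 1 m, (F n + F (-n)) := by
  induction m with
  | zero => simp
  | succ m ih =>
    have h : Finset.Icc (-(m + 1 : ℕ) : ℤ) (m + 1 : ℕ) =
        insert ((m + 1 : ℕ) : ℤ) (insert (-(m + 1 : ℕ) : ℤ) (Finset.Icc (-m : ℤ) m)) := by
      ext x; simp only [Finset.mem_Icc, Finset.mem_insert]; push_cast; omega
    rw [h, Finset.sum_insert (by simp only [Finset.mem_Icc, Finset.mem_insert]; push_cast; omega),
      Finset.sum_insert (by simp only [Finset.mem_Icc]; push_cast; omega), ih,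
      Finset.sum_Icc_succ_top (by omega)]
    ring

lemma sum_inv_Icc_le (m : ℕ) {x : ℝ} (hx : 1 ≤ x) (hm : (m : ℝ) ≤ x) :
    ∑ n ∈ Finset.Icc 1 m, 1 / (n : ℝ) ≤ 1 + Real.log x := by
  have h1 : ∑ n ∈ Finset.Icc 1 m, 1 / (n : ℝ) = (harmonic m : ℝ) := by
    rw [harmonic_eq_sum_Icc]; push_cast; simp
  rw [h1]
  rcases Nat.eq_zero_or_pos m with h | h
  · subst h; simp; linarith [Real.log_nonneg hx]
  · have hm0 : (0 : ℝ) < m := by exact_mod_cast h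
    exact (harmonic_le_one_add_log m).trans (by gcongr)

lemma sum_abs_inv_Icc_le (m : ℕ) {x : ℝ} (hx : 1 ≤ x) (hm : (m : ℝ) ≤ x) :
    ∑ l ∈ Finset.Icc (-m : ℤ) m, 1 / |(l : ℝ)| ≤ 2 * (1 + Real.log x) := by
  rw [sum_Icc_neg_self (fun l => 1 / |(l : ℝ)|)]
  have := sum_inv_Icc_le m hx hm
  simp only [Int.cast_zero, abs_zero, div_zero, zero_add, Int.cast_neg, abs_neg, Int.cast_natCast,
    Nat.abs_cast, ← two_mul, ← Finset.mul_sum]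
  linarith

lemma sum_indicator_Icc_le (m : ℕ) {x : ℝ} (hx : 0 ≤ x) :
    ∑ n ∈ Finset.Icc 1 m, (if (n : ℝ) ≤ x then (1 : ℝ) else 0) ≤ x := by
  rw [Finset.sum_ite, Finset.sum_const_zero, add_zero, Finset.sum_const, nsmul_eq_mul, mul_one]
  have hsub : (Finset.Icc 1 m).filter (fun n : ℕ => (n : ℝ) ≤ x) ⊆ Finset.Icc 1 ⌊x⌋₊ := by
    intro n hn
    simp only [Finset.mem_filter, Finset.mem_Icc] at hn ⊢
    exact ⟨hn.1.1, Nat.le_floor hn.2⟩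
  have := Finset.card_le_card hsub
  rw [Nat.card_Icc, Nat.add_sub_cancel] at this
  exact (Nat.cast_le.2 this).trans (Nat.floor_le hx)

lemma sum_norm_corr_le {Z κ s t T : ℝ} (hZ : 1 / 2 ≤ Z) (hT : 0 < T) (hs : T ≤ s) (ht : T ≤ t)
    {a b : ℝ → ℂ} (ha : IsAmplitude Z κ a) (hb : IsAmplitude Z κ b) :
    ∑ l ∈ Finset.Icc (-(⌊2 * Z⌋₊ : ℤ)) ⌊2 * Z⌋₊, ‖corr a b s t l‖ ≤
      482 * κ ^ 2 * ((if s = t then Z else Z ^ 2 / |t - s|) + 2 * (1 + Real.log (2 * Z)) * (Z ^ 3 / T)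
        + 12 * (Z ^ 2 * √(Z * |t - s|) / T)) := by
  have hZ0 : 0 < Z := by linarith
  set m := ⌊2 * Z⌋₊
  have hm : (m : ℝ) ≤ 2 * Z := Nat.floor_le (by linarith)
  set Δ := |t - s|
  have hΔ : 0 ≤ Δ := abs_nonneg _
  have hx : 0 ≤ 6 * Z * Δ / T := by positivity
  have hterm : ∀ l : ℤ, l ≠ 0 → ‖corr a b s t l‖ ≤ 482 * κ ^ 2 * (Z ^ 3 / T * (1 / |(l : ℝ)|) +
      (Z * √(Z / Δ)) * if |(l : ℝ)| ≤ 6 * Z * Δ / T then 1 else 0) := by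
    intro l hl
    have h := norm_corr_le hZ hT hs ht ha hb hl
    rw [show |t - s| = Δ from rfl] at h
    refine h.trans (le_of_eq ?_)
    have hiff : T * |(l : ℝ)| ≤ 6 * Z * Δ ↔ |(l : ℝ)| ≤ 6 * Z * Δ / T := by
      rw [le_div_iff₀ hT, mul_comm]
    simp only [hiff, mul_ite, mul_one, mul_zero]
    congr 2
    rw [mul_one_div, div_div]
  rw [sum_Icc_neg_self (fun l => ‖corr a b s t l‖)]
  have hsum : ∑ n ∈ Finset.Icc 1 m, (‖corr a b s t (n : ℤ)‖ + ‖corr a b s t (-(n : ℤ))‖) ≤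
      482 * κ ^ 2 * (2 * (Z ^ 3 / T * (1 + Real.log (2 * Z)) + (Z * √(Z / Δ)) * (6 * Z * Δ / T))) := by
    calc _ ≤ ∑ n ∈ Finset.Icc 1 m, 482 * κ ^ 2 * (2 * (Z ^ 3 / T * (1 / (n : ℝ)) +
            (Z * √(Z / Δ)) * if (n : ℝ) ≤ 6 * Z * Δ / T then 1 else 0)) := by
          refine Finset.sum_le_sum fun n hn => ?_
          have hn1 := (Finset.mem_Icc.1 hn).1
          have h1 := hterm (n : ℤ) (by omega)
          have h2 := hterm (-(n : ℤ)) (by omega)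
          simp only [Int.cast_neg, abs_neg, Int.cast_natCast, Nat.abs_cast] at h1 h2
          linarith
      _ = 482 * κ ^ 2 * (2 * (Z ^ 3 / T * ∑ n ∈ Finset.Icc 1 m, (1 / (n : ℝ)) + (Z * √(Z / Δ)) *
            ∑ n ∈ Finset.Icc 1 m, if (n : ℝ) ≤ 6 * Z * Δ / T then 1 else 0)) := by
          rw [← Finset.mul_sum, ← Finset.mul_sum, Finset.sum_add_distrib, ← Finset.mul_sum,
            ← Finset.mul_sum]
      _ ≤ _ := by
          gcongr
          exacts [sum_inv_Icc_le m (by linarith) hm, sum_indicator_Icc_le m hx]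
  have hsq : √(Z / Δ) * Δ = √(Z * Δ) := by
    rcases hΔ.eq_or_lt with h | h
    · rw [← h]; simp
    · rw [show Z * Δ = Z / Δ * Δ ^ 2 by field_simp, Real.sqrt_mul (by positivity), Real.sqrt_sq hΔ]
  have hd := norm_corr_diag_le hZ (hT.le.trans hs) (hT.le.trans ht) ha hb
  have hd0 : 0 ≤ κ ^ 2 * (if s = t then Z else Z ^ 2 / Δ) := by positivity
  have e : (Z * √(Z / Δ)) * (6 * Z * Δ / T) = 6 * (Z ^ 2 * √(Z * Δ) / T) := by
    rw [← hsq]; ring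
  rw [e] at hsum
  refine (add_le_add hd hsum).trans ?_
  nlinarith

/-- Summed correlations for frequencies on an arithmetic progression. -/
lemma sum_sum_corr_le {Z κ T G T₀ X₀ Lg : ℝ} (hZ : 1 / 2 ≤ Z) (hT : 0 < T) (hG : 0 < G)
    (hGT : G ≤ T₀) (hX : T ≤ X₀) (hL1 : 1 + Real.log (2 * Z) ≤ Lg) (hL2 : 1 + Real.log (T₀ / G) ≤ Lg)
    (𝒥 : Finset ℕ) (hJ : ∀ j ∈ 𝒥, G * j ≤ T₀) (a : ℕ → ℝ → ℂ) (ha : ∀ j ∈ 𝒥, IsAmplitude Z κ (a j)) :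
    ∑ j ∈ 𝒥, ∑ k ∈ 𝒥, ∑ l ∈ Finset.Icc (-(⌊2 * Z⌋₊ : ℤ)) ⌊2 * Z⌋₊,
      ‖corr (a j) (a k) (X₀ + G * j) (X₀ + G * k) l‖ ≤
      482 * κ ^ 2 * (𝒥.card * Z + 2 * Lg * 𝒥.card * (Z ^ 2 / G) + 2 * Lg * 𝒥.card ^ 2 * (Z ^ 3 / T)
        + 12 * 𝒥.card ^ 2 * (Z ^ 2 * √(Z * T₀) / T)) := by
  have hZ0 : 0 < Z := by linarith
  have hx1 : 1 ≤ T₀ / G := by rwa [le_div_iff₀ hG, one_mul]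
  set D : ℝ := 2 * Lg * (Z ^ 3 / T) + 12 * (Z ^ 2 * √(Z * T₀) / T) with hD
  have hinner : ∀ j ∈ 𝒥, ∀ k ∈ 𝒥, ∑ l ∈ Finset.Icc (-(⌊2 * Z⌋₊ : ℤ)) ⌊2 * Z⌋₊,
      ‖corr (a j) (a k) (X₀ + G * j) (X₀ + G * k) l‖ ≤ 482 * κ ^ 2 * ((if j = k then Z else 0) +
        Z ^ 2 / G * (1 / |(((k : ℤ) - (j : ℤ) : ℤ) : ℝ)|) + D) := by
    intro j hj k hk
    have hj0 : 0 ≤ G * j := by positivity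
    have hk0 : 0 ≤ G * k := by positivity
    refine (sum_norm_corr_le hZ hT (by linarith) (by linarith) (ha j hj) (ha k hk)).trans ?_
    have hdiff : X₀ + G * k - (X₀ + G * j) = G * (k - j) := by ring
    have hle : |X₀ + G * k - (X₀ + G * j)| ≤ T₀ := by
      rw [abs_le]; constructor <;> linarith [hJ j hj, hJ k hk]
    have h1 : (if X₀ + G * j = X₀ + G * k then Z else Z ^ 2 / |X₀ + G * k - (X₀ + G * j)|) ≤
        (if j = k then Z else 0) + Z ^ 2 / G * (1 / |(((k : ℤ) - (j : ℤ) : ℤ) : ℝ)|) := by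
      by_cases hjk : j = k
      · subst hjk; simp
      · have hne : X₀ + G * j ≠ X₀ + G * k := by
          intro h
          have : (j : ℝ) = k := by
            have : G * (j : ℝ) = G * k := by linarith
            exact mul_left_cancel₀ hG.ne' this
          exact hjk (by exact_mod_cast this)
        rw [if_neg hne, if_neg hjk, zero_add, hdiff, abs_mul, abs_of_pos hG]
        push_cast
        rw [div_mul_div_comm, mul_one]
    have h2 : 2 * (1 + Real.log (2 * Z)) * (Z ^ 3 / T) + 12 * (Z ^ 2 *
        √(Z * |X₀ + G * k - (X₀ + G * j)|) / T) ≤ D := by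
      rw [hD]; gcongr
    rw [add_assoc]
    gcongr
  have hrow : ∀ j ∈ 𝒥, ∑ k ∈ 𝒥, (1 / |(((k : ℤ) - (j : ℤ) : ℤ) : ℝ)|) ≤ 2 * Lg := by
    intro j hj
    have himg : ∑ k ∈ 𝒥, (1 / |(((k : ℤ) - (j : ℤ) : ℤ) : ℝ)|) =
        ∑ l ∈ 𝒥.image (fun k : ℕ => (k : ℤ) - (j : ℤ)), 1 / |(l : ℝ)| := by
      rw [Finset.sum_image]
      intro x _ y _ hxy
      simpa using hxy
    rw [himg]
    refine le_trans (Finset.sum_le_sum_of_subset_of_nonneg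
      (t := Finset.Icc (-(⌊T₀ / G⌋₊ : ℤ)) ⌊T₀ / G⌋₊) ?_ (fun l _ _ => by positivity)) ?_
    · intro l hl
      obtain ⟨k, hk, rfl⟩ := Finset.mem_image.1 hl
      have h1 : k ≤ ⌊T₀ / G⌋₊ := Nat.le_floor (by rw [le_div_iff₀ hG]; linarith [hJ k hk])
      have h2 : j ≤ ⌊T₀ / G⌋₊ := Nat.le_floor (by rw [le_div_iff₀ hG]; linarith [hJ j hj])
      rw [Finset.mem_Icc]; omega
    · refine (sum_abs_inv_Icc_le _ hx1 (Nat.floor_le (by positivity))).trans ?_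
      linarith
  calc _ ≤ ∑ j ∈ 𝒥, ∑ k ∈ 𝒥, 482 * κ ^ 2 * ((if j = k then Z else 0) +
        Z ^ 2 / G * (1 / |(((k : ℤ) - (j : ℤ) : ℤ) : ℝ)|) + D) :=
        Finset.sum_le_sum fun j hj => Finset.sum_le_sum fun k hk => hinner j hj k hk
    _ ≤ ∑ j ∈ 𝒥, 482 * κ ^ 2 * (Z + Z ^ 2 / G * (2 * Lg) + 𝒥.card * D) := by
        refine Finset.sum_le_sum fun j hj => ?_
        rw [← Finset.mul_sum, Finset.sum_add_distrib, Finset.sum_add_distrib, ← Finset.mul_sum,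
          Finset.sum_const, nsmul_eq_mul, Finset.sum_ite_eq, if_pos hj]
        have := hrow j hj
        gcongr
    _ = _ := by rw [Finset.sum_const, nsmul_eq_mul, hD]; ring

lemma summable_fourier_of_contDiff {u : ℝ → ℂ} (hu : ContDiff ℝ ∞ u) (hs : HasCompactSupport u) :
    Summable fun n : ℤ => 𝓕 u n := by
  have h := (𝓕 (hs.toSchwartzMap hu)).isBigO_cocompact_rpow (-2)
  rw [SchwartzMap.fourier_coe] at h
  exact summable_of_isBigO (Real.summable_abs_int_rpow one_lt_two)
    (h.comp_tendsto Int.tendsto_coe_cofinite)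

lemma tsum_eq_tsum_fourier_of_contDiff {u : ℝ → ℂ} (hu : ContDiff ℝ ∞ u) (hs : HasCompactSupport u) :
    ∑' n : ℤ, u n = ∑' n : ℤ, 𝓕 u n := by
  have h := SchwartzMap.tsum_eq_tsum_fourier (hs.toSchwartzMap hu) 0
  rw [SchwartzMap.fourier_coe, show ⇑(hs.toSchwartzMap hu) = u from rfl] at h
  simpa using h

lemma fourier_comp_div (u : ℝ → ℂ) {h : ℝ} (hh : 0 < h) (ξ : ℝ) :
    𝓕 (fun x => u (x / h)) ξ = h * 𝓕 u (h * ξ) := by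
  rw [Real.fourier_real_eq, Real.fourier_real_eq]
  have e : ∀ v : ℝ, 𝐞 (-(v * ξ)) • u (v / h) =
      (fun x => 𝐞 (-(x * (h * ξ))) • u x) (v / h) := by
    intro v
    simp only
    congr 3
    field_simp
  simp_rw [e]
  rw [Measure.integral_comp_div (fun x => 𝐞 (-(x * (h * ξ))) • u x), abs_of_pos hh]
  simp

lemma tsum_comp_div_eq {u : ℝ → ℂ} (hu : ContDiff ℝ ∞ u) (hs : HasCompactSupport u) {h : ℕ}
    (hh : 0 < h) : Summable (fun k : ℤ => 𝓕 u (h * k)) ∧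
      ∑' n : ℤ, u (n / h) = h * ∑' k : ℤ, 𝓕 u (h * k) := by
  have h0 : (0 : ℝ) < h := by exact_mod_cast hh
  have h1 : ContDiff ℝ ∞ (fun x : ℝ => u (x / h)) := hu.comp (contDiff_id.div_const _)
  have h2 : HasCompactSupport (fun x : ℝ => u (x / h)) := by
    have := hs.comp_homeomorph (Homeomorph.mulRight₀ ((h : ℝ)⁻¹) (inv_ne_zero h0.ne'))
    simpa [Function.comp_def, div_eq_mul_inv] using this
  refine ⟨?_, ?_⟩
  · have := summable_fourier_of_contDiff h1 h2
    simp_rw [fourier_comp_div u h0] at this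
    exact (summable_mul_left_iff (by exact_mod_cast h0.ne')).1 this
  · rw [tsum_eq_tsum_fourier_of_contDiff h1 h2, ← tsum_mul_left]
    refine tsum_congr fun k => ?_
    rw [fourier_comp_div u h0]; simp

lemma sum_gcd_le (H : ℕ) (hH : 1 ≤ H) : ∑ h ∈ Finset.Icc 1 H, ∑ k ∈ Finset.Icc 1 H,
    (Nat.gcd h k : ℝ) ≤ H ^ 2 * (1 + Real.log H) := by
  have hcard : ∀ d, 1 ≤ d → (((Finset.Icc 1 H).filter (d ∣ ·)).card : ℝ) ≤ H / d := by
    intro d hd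
    have : ((Finset.Icc 1 H).filter (d ∣ ·)).card = H / d := by
      rw [← Nat.Ioc_filter_dvd_card_eq_div]; rfl
    rw [this]; exact Nat.cast_div_le
  have hg : ∀ h ∈ Finset.Icc 1 H, ∀ k ∈ Finset.Icc 1 H, (Nat.gcd h k : ℝ) ≤
      ∑ d ∈ Finset.Icc 1 H, (d : ℝ) * ((if d ∣ h then 1 else 0) * if d ∣ k then 1 else 0) := by
    intro h hh k hk
    rw [Finset.mem_Icc] at hh hk
    have hmem : Nat.gcd h k ∈ Finset.Icc 1 H := Finset.mem_Icc.2
      ⟨Nat.gcd_pos_of_pos_left _ hh.1, (Nat.le_of_dvd hh.1 (Nat.gcd_dvd_left h k)).trans hh.2⟩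
    have := Finset.single_le_sum (f := fun d : ℕ => (d : ℝ) * ((if d ∣ h then 1 else 0) *
      if d ∣ k then 1 else 0)) (fun d _ => by positivity) hmem
    simpa [Nat.gcd_dvd_left, Nat.gcd_dvd_right] using this
  calc _ ≤ ∑ h ∈ Finset.Icc 1 H, ∑ k ∈ Finset.Icc 1 H, ∑ d ∈ Finset.Icc 1 H,
        (d : ℝ) * ((if d ∣ h then 1 else 0) * if d ∣ k then 1 else 0) :=
        Finset.sum_le_sum fun h hh => Finset.sum_le_sum fun k hk => hg h hh k hk
    _ = ∑ d ∈ Finset.Icc 1 H, (d : ℝ) * ((∑ h ∈ Finset.Icc 1 H, if d ∣ h then 1 else 0) *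
          ∑ k ∈ Finset.Icc 1 H, if d ∣ k then 1 else 0) := by
        simp_rw [Finset.sum_mul_sum, Finset.mul_sum]
        rw [Finset.sum_comm' (t' := Finset.Icc 1 H) (s' := fun _ => Finset.Icc 1 H) (by tauto)]
        rw [Finset.sum_comm]
        conv_lhs =>
          enter [2, x]
          rw [Finset.sum_comm]
        rw [Finset.sum_comm]
    _ ≤ ∑ d ∈ Finset.Icc 1 H, (H : ℝ) ^ 2 * (1 / d) := by
        refine Finset.sum_le_sum fun d hd => ?_
        have hd1 := (Finset.mem_Icc.1 hd).1
        have hd0 : (0 : ℝ) < d := by exact_mod_cast hd1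
        have hc := hcard d hd1
        rw [Finset.sum_boole]
        calc _ ≤ (d : ℝ) * (H / d * (H / d)) := by gcongr
          _ = _ := by field_simp
    _ ≤ _ := by
        rw [← Finset.mul_sum]
        gcongr
        have : ∑ n ∈ Finset.Icc 1 H, 1 / (n : ℝ) = (harmonic H : ℝ) := by
          rw [harmonic_eq_sum_Icc]; push_cast; simp
        rw [this]; exact harmonic_le_one_add_log H

lemma sum_inv_one_add_sq_le {c : ℝ} (hc : 0 < c) (n : ℕ) :
    ∑ i ∈ Finset.Icc 1 n, 1 / (1 + (i * c) ^ 2) ≤ 2 / c := by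
  have hstep : ∀ i : ℕ, 1 / (1 + (((i + 1 : ℕ) : ℝ) * c) ^ 2) * c ≤
      Real.arctan ((i + 1 : ℕ) * c) - Real.arctan (i * c) := by
    intro i
    have hlt : (i : ℝ) * c < ((i + 1 : ℕ) : ℝ) * c := by push_cast; nlinarith
    obtain ⟨x, hx, he⟩ := exists_deriv_eq_slope Real.arctan hlt
      Real.continuous_arctan.continuousOn Real.differentiable_arctan.differentiableOn
    have hd : (((i + 1 : ℕ) : ℝ) * c - i * c) = c := by push_cast; ring
    rw [Real.deriv_arctan, hd, eq_div_iff hc.ne'] at he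
    rw [← he]
    beta_reduce
    have hx0 : 0 ≤ x := le_trans (by positivity) hx.1.le
    have := hx.2.le
    gcongr
  have htel : ∀ n : ℕ, (∑ i ∈ Finset.Icc 1 n, 1 / (1 + ((i : ℝ) * c) ^ 2)) * c ≤
      Real.arctan (n * c) := by
    intro n
    induction n with
    | zero => simp
    | succ n ih =>
      rw [Finset.sum_Icc_succ_top (by omega), add_mul]
      linarith [hstep n]
  rw [le_div_iff₀ hc]
  exact (htel n).trans ((Real.arctan_lt_pi_div_two _).le.trans (by linarith [Real.pi_le_four]))

lemma sum_dvd_weight_le {M : ℝ} (hM : 0 < M) {ℓ : ℕ} (hℓ : 0 < ℓ) (n : ℕ) :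
    ∑ m ∈ (Finset.Icc 1 n).filter (ℓ ∣ ·), 1 / (1 + ((m : ℝ) / M) ^ 2) ≤ 2 * M / ℓ := by
  have hℓ0 : (0 : ℝ) < ℓ := by exact_mod_cast hℓ
  have hsub : (Finset.Icc 1 n).filter (ℓ ∣ ·) ⊆ (Finset.Icc 1 n).image (· * ℓ) := by
    intro m hm
    obtain ⟨h1, i, rfl⟩ := Finset.mem_filter.1 hm
    rw [Finset.mem_Icc] at h1
    refine Finset.mem_image.2 ⟨i, Finset.mem_Icc.2 ⟨?_, ?_⟩, mul_comm _ _⟩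
    · exact Nat.pos_of_ne_zero fun h => by simp [h] at h1
    · nlinarith
  calc _ ≤ ∑ m ∈ (Finset.Icc 1 n).image (· * ℓ), 1 / (1 + ((m : ℝ) / M) ^ 2) :=
        Finset.sum_le_sum_of_subset_of_nonneg hsub fun _ _ _ => by positivity
    _ = ∑ i ∈ Finset.Icc 1 n, 1 / (1 + ((i : ℝ) * (ℓ / M)) ^ 2) := by
        rw [Finset.sum_image fun x _ y _ h => Nat.eq_of_mul_eq_mul_right hℓ h]
        refine Finset.sum_congr rfl fun i _ => ?_
        push_cast; rw [mul_div_assoc]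
    _ ≤ 2 / (ℓ / M) := sum_inv_one_add_sq_le (by positivity) n
    _ = _ := by field_simp

lemma sum_divisor_weight_le {M : ℝ} (hM : 0 < M) {H : ℕ} (hH : 1 ≤ H) (n : ℕ) :
    ∑ m ∈ Finset.Icc 1 n, (∑ h ∈ Finset.Icc 1 H, if h ∣ m then (h : ℝ) else 0) ^ 2 /
      (1 + ((m : ℝ) / M) ^ 2) ≤ 2 * M * (H ^ 2 * (1 + Real.log H)) := by
  calc _ = ∑ h ∈ Finset.Icc 1 H, ∑ k ∈ Finset.Icc 1 H, (h : ℝ) * k *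
        ∑ m ∈ (Finset.Icc 1 n).filter (Nat.lcm h k ∣ ·), 1 / (1 + ((m : ℝ) / M) ^ 2) := by
        simp_rw [sq (∑ h ∈ Finset.Icc 1 H, _), Finset.sum_mul_sum, Finset.sum_div]
        rw [Finset.sum_comm]
        refine Finset.sum_congr rfl fun h _ => ?_
        rw [Finset.sum_comm]
        refine Finset.sum_congr rfl fun k _ => ?_
        rw [Finset.mul_sum, Finset.sum_filter]
        refine Finset.sum_congr rfl fun m _ => ?_
        simp only [Nat.lcm_dvd_iff]
        by_cases h1 : h ∣ m <;> by_cases h2 : k ∣ m <;> simp [h1, h2, div_eq_mul_inv]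
    _ ≤ ∑ h ∈ Finset.Icc 1 H, ∑ k ∈ Finset.Icc 1 H, 2 * M * (Nat.gcd h k : ℝ) := by
        refine Finset.sum_le_sum fun h hh => Finset.sum_le_sum fun k hk => ?_
        have hh0 := (Finset.mem_Icc.1 hh).1
        have hk0 := (Finset.mem_Icc.1 hk).1
        have hl : 0 < Nat.lcm h k := Nat.lcm_pos hh0 hk0
        have hl0 : (0 : ℝ) < Nat.lcm h k := by exact_mod_cast hl
        have e : (h : ℝ) * k = Nat.gcd h k * Nat.lcm h k := by
          exact_mod_cast (Nat.gcd_mul_lcm h k).symm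
        calc _ ≤ (h : ℝ) * k * (2 * M / Nat.lcm h k) := by
              gcongr; exact sum_dvd_weight_le hM hl n
          _ = _ := by rw [e]; field_simp
    _ = 2 * M * ∑ h ∈ Finset.Icc 1 H, ∑ k ∈ Finset.Icc 1 H, (Nat.gcd h k : ℝ) := by
        simp_rw [Finset.mul_sum]
    _ ≤ _ := by gcongr; exact sum_gcd_le H hH

lemma sum_sum_mul_le {M Q : ℝ} (hM : 0 < M) {H : ℕ} (hH : 1 ≤ H) {a : ℕ → ℝ} (ha : ∀ n, 0 ≤ a n)
    (hQ : ∀ n, ∑ m ∈ Finset.Icc 1 n, a m ^ 2 * (1 + ((m : ℝ) / M) ^ 2) ≤ Q) (K : ℕ) :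
    ∑ h ∈ Finset.Icc 1 H, ∑ k ∈ Finset.Icc 1 K, (h : ℝ) * a (h * k) ≤
      √(2 * M * (H ^ 2 * (1 + Real.log H)) * Q) := by
  set σ : ℕ → ℝ := fun m => ∑ h ∈ Finset.Icc 1 H, if h ∣ m then (h : ℝ) else 0 with hσ
  have h1 : ∑ h ∈ Finset.Icc 1 H, ∑ k ∈ Finset.Icc 1 K, (h : ℝ) * a (h * k) ≤
      ∑ m ∈ Finset.Icc 1 (H * K), σ m * a m := by
    simp only [hσ, Finset.sum_mul]
    conv_rhs => rw [Finset.sum_comm]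
    refine Finset.sum_le_sum fun h hh => ?_
    rw [Finset.mem_Icc] at hh
    have e : ∑ k ∈ Finset.Icc 1 K, (h : ℝ) * a (h * k) =
        ∑ m ∈ (Finset.Icc 1 K).image (h * ·), (h : ℝ) * a m := by
      rw [Finset.sum_image fun x _ y _ hxy => Nat.eq_of_mul_eq_mul_left hh.1 hxy]
    rw [e]
    simp only [ite_mul, zero_mul]
    rw [← Finset.sum_filter]
    refine Finset.sum_le_sum_of_subset_of_nonneg ?_ fun m _ _ => mul_nonneg (by positivity) (ha m)
    intro m hm
    obtain ⟨k, hk, rfl⟩ := Finset.mem_image.1 hm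
    rw [Finset.mem_Icc] at hk
    refine Finset.mem_filter.2 ⟨Finset.mem_Icc.2 ⟨Nat.mul_pos hh.1 hk.1, Nat.mul_le_mul hh.2 hk.2⟩,
      Dvd.intro _ rfl⟩
  refine h1.trans (Real.le_sqrt_of_sq_le ?_)
  have hcs := Finset.sum_mul_sq_le_sq_mul_sq (Finset.Icc 1 (H * K))
    (fun m => σ m / √(1 + ((m : ℝ) / M) ^ 2)) (fun m => a m * √(1 + ((m : ℝ) / M) ^ 2))
  have hw : ∀ m : ℕ, 0 < 1 + ((m : ℝ) / M) ^ 2 := fun m => by positivity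
  have e2 : ∀ m : ℕ, (σ m / √(1 + ((m : ℝ) / M) ^ 2)) ^ 2 = σ m ^ 2 / (1 + ((m : ℝ) / M) ^ 2) := by
    intro m; rw [div_pow, Real.sq_sqrt (hw m).le]
  have e3 : ∀ m : ℕ, (a m * √(1 + ((m : ℝ) / M) ^ 2)) ^ 2 = a m ^ 2 * (1 + ((m : ℝ) / M) ^ 2) := by
    intro m; rw [mul_pow, Real.sq_sqrt (hw m).le]
  have e1 : ∀ m : ℕ, σ m / √(1 + ((m : ℝ) / M) ^ 2) * (a m * √(1 + ((m : ℝ) / M) ^ 2)) = σ m * a m := by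
    intro m
    have := (Real.sqrt_pos.2 (hw m)).ne'
    field_simp
  simp only [e1, e2, e3] at hcs
  refine hcs.trans ?_
  have h2 := sum_divisor_weight_le hM hH (H * K)
  have h3 := hQ (H * K)
  refine mul_le_mul ?_ ?_ (Finset.sum_nonneg fun m _ => mul_nonneg (sq_nonneg _) (hw m).le)
    (by have := Real.log_natCast_nonneg H; positivity)
  · exact h2
  · exact h3

lemma norm_tsum_int_sub_zero_le {f : ℤ → ℂ} (hf : Summable f) {B : ℝ}
    (hB : ∀ K : ℕ, ∑ k ∈ Finset.Icc 1 K, (‖f k‖ + ‖f (-k)‖) ≤ B) : ‖∑' k, f k - f 0‖ ≤ B := by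
  have h1 := (HasSum.nat_add_neg hf.hasSum).tendsto_sum_nat
  have h2 := (h1.comp (Filter.tendsto_add_atTop_nat 1)).sub_const (f 0 + f 0)
  rw [show ∑' k, f k + f 0 - (f 0 + f 0) = ∑' k, f k - f 0 by ring] at h2
  refine le_of_tendsto h2.norm (Filter.Eventually.of_forall fun K => ?_)
  have e : ∑ i ∈ Finset.range (K + 1), (f i + f (-i)) - (f 0 + f 0) =
      ∑ k ∈ Finset.Icc 1 K, (f k + f (-k)) := by
    rw [Finset.sum_range_eq_add_Ico _ (by omega)]
    simp only [Nat.cast_zero, neg_zero, add_sub_cancel_left]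
    rfl
  simp only [Function.comp_apply]
  rw [e]
  exact (norm_sum_le _ _).trans ((Finset.sum_le_sum fun k _ => norm_add_le _ _).trans (hB K))

/-- Averages of a smooth function over rationals with denominators up to `H`. -/
lemma norm_sum_tsum_div_le {u : ℝ → ℂ} (hu : ContDiff ℝ ∞ u) (hs : HasCompactSupport u) {M Q Lg : ℝ}
    (hM : 0 < M) {H : ℕ} (hH : 1 ≤ H) (hL : 1 + Real.log H ≤ Lg)
    (hQ : ∀ s : Finset ℤ, ∑ m ∈ s, ‖𝓕 u m‖ ^ 2 * (1 + ((m : ℝ) / M) ^ 2) ≤ Q) :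
    ‖∑ h ∈ Finset.Icc 1 H, ∑' n : ℤ, u (n / h)‖ ≤ H ^ 2 * ‖∫ x, u x‖ + 2 * H * √(M * Lg * Q) := by
  have hL1 : 1 ≤ 1 + Real.log H := by have := Real.log_natCast_nonneg H; linarith
  have hQ0 : 0 ≤ Q := by simpa using hQ ∅
  set a : ℕ → ℝ := fun n => ‖𝓕 u (n : ℝ)‖ + ‖𝓕 u (-(n : ℝ))‖ with ha
  have haQ : ∀ n, ∑ m ∈ Finset.Icc 1 n, a m ^ 2 * (1 + ((m : ℝ) / M) ^ 2) ≤ 2 * Q := by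
    intro n
    have h := hQ (Finset.Icc (-n : ℤ) n)
    have hsum : ∑ m ∈ Finset.Icc 1 n, (‖𝓕 u (m : ℝ)‖ ^ 2 * (1 + ((m : ℝ) / M) ^ 2) +
        ‖𝓕 u (-(m : ℝ))‖ ^ 2 * (1 + ((m : ℝ) / M) ^ 2)) ≤ Q := by
      rw [sum_Icc_neg_self (fun m : ℤ => ‖𝓕 u m‖ ^ 2 * (1 + ((m : ℝ) / M) ^ 2))] at h
      have h0 : 0 ≤ ‖𝓕 u ((0 : ℤ) : ℝ)‖ ^ 2 * (1 + (((0 : ℤ) : ℝ) / M) ^ 2) := by positivity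
      refine le_trans (le_of_eq ?_) (le_trans (le_add_of_nonneg_left h0) h)
      refine Finset.sum_congr rfl fun m _ => ?_
      push_cast
      rw [neg_div, neg_sq]
    calc _ ≤ ∑ m ∈ Finset.Icc 1 n, 2 * (‖𝓕 u (m : ℝ)‖ ^ 2 * (1 + ((m : ℝ) / M) ^ 2) +
        ‖𝓕 u (-(m : ℝ))‖ ^ 2 * (1 + ((m : ℝ) / M) ^ 2)) := by
          refine Finset.sum_le_sum fun m _ => ?_
          rw [← add_mul, ← mul_assoc]
          gcongr
          simp only [ha]
          nlinarith [sq_nonneg (‖𝓕 u (m : ℝ)‖ - ‖𝓕 u (-(m : ℝ))‖)]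
      _ ≤ _ := by rw [← Finset.mul_sum]; linarith
  have hfin := fun K => sum_sum_mul_le hM hH (fun n => by positivity : ∀ n, 0 ≤ a n) haQ K
  have h0 : 𝓕 u 0 = ∫ x, u x := by rw [Real.fourier_real_eq]; simp
  set B : ℝ := √(2 * M * (H ^ 2 * (1 + Real.log H)) * (2 * Q)) with hB
  have hBle : B ≤ 2 * H * √(M * Lg * Q) := by
    rw [hB]
    refine Real.sqrt_le_iff.2 ⟨by positivity, ?_⟩
    rw [mul_pow, Real.sq_sqrt (by have : 0 ≤ Lg := by linarith
                                  positivity)]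
    have : H ^ 2 * (1 + Real.log H) * (M * Q) ≤ H ^ 2 * Lg * (M * Q) := by gcongr
    nlinarith
  have hsumm : ∀ h ∈ Finset.Icc 1 H, Summable fun k : ℤ => (h : ℂ) * 𝓕 u (h * k) := fun h hh =>
    (tsum_comp_div_eq hu hs (Finset.mem_Icc.1 hh).1).1.mul_left _
  have e : ∑ h ∈ Finset.Icc 1 H, ∑' n : ℤ, u (n / h) =
      ∑' k : ℤ, ∑ h ∈ Finset.Icc 1 H, (h : ℂ) * 𝓕 u (h * k) := by
    rw [Summable.tsum_finsetSum hsumm]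
    refine Finset.sum_congr rfl fun h hh => ?_
    rw [(tsum_comp_div_eq hu hs (Finset.mem_Icc.1 hh).1).2, tsum_mul_left]
  have hmain := norm_tsum_int_sub_zero_le (summable_sum hsumm) (B := B) (fun K => by
    refine le_trans ?_ (hfin K)
    rw [Finset.sum_comm]
    refine Finset.sum_le_sum fun k _ => ?_
    refine (add_le_add (norm_sum_le _ _) (norm_sum_le _ _)).trans (le_of_eq ?_)
    rw [← Finset.sum_add_distrib]
    refine Finset.sum_congr rfl fun h _ => ?_
    simp only [ha, norm_mul, Complex.norm_natCast]
    push_cast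
    rw [mul_neg, mul_add])
  rw [e]
  have h00 : ‖∑ h ∈ Finset.Icc 1 H, (h : ℂ) * 𝓕 u (h * ((0 : ℤ) : ℝ))‖ ≤ H ^ 2 * ‖∫ x, u x‖ := by
    simp only [Int.cast_zero, mul_zero, h0]
    rw [← Finset.sum_mul, norm_mul]
    gcongr
    refine (norm_sum_le _ _).trans ?_
    calc _ ≤ ∑ h ∈ Finset.Icc 1 H, (H : ℝ) := by
          refine Finset.sum_le_sum fun h hh => ?_
          rw [Complex.norm_natCast]; exact_mod_cast (Finset.mem_Icc.1 hh).2
      _ = _ := by simp [sq]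
  have := norm_le_norm_add_norm_sub' (∑' k : ℤ, ∑ h ∈ Finset.Icc 1 H, (h : ℂ) * 𝓕 u (h * k))
    (∑ h ∈ Finset.Icc 1 H, (h : ℂ) * 𝓕 u (h * ((0 : ℤ) : ℝ)))
  linarith

/-- A Plancherel identity on the integers. -/
lemma sum_norm_fourier_sq_le {v : ℝ → ℂ} (hv : ContDiff ℝ ∞ v) (hs : HasCompactSupport v)
    {m : ℕ} (hm : ∀ l : ℤ, (m : ℤ) < |l| → ∫ z, v z * conj (v (z + l)) = 0) (s : Finset ℤ) :
    ∑ n ∈ s, ‖𝓕 v n‖ ^ 2 ≤ ∑ l ∈ Finset.Icc (-m : ℤ) m, ‖∫ z, v z * conj (v (z + l))‖ := by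
  set w : ℝ → ℂ := fun x => conj (v (-x)) with hw
  have hwd : ContDiff ℝ ∞ w := Complex.conjCLE.contDiff.comp (hv.comp contDiff_neg)
  have hws : HasCompactSupport w := by
    have h1 : HasCompactSupport (fun x => v (-x)) := hs.comp_homeomorph (Homeomorph.neg ℝ)
    exact h1.comp_left (g := fun z : ℂ => conj z) (by simp)
  set f := hs.toSchwartzMap hv with hf
  set g := hws.toSchwartzMap hwd with hg
  have hfour : ∀ ξ : ℝ, 𝓕 w ξ = conj (𝓕 v ξ) := by
    intro ξ
    rw [Real.fourier_real_eq, Real.fourier_real_eq, ← integral_conj,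
      ← integral_neg_eq_self]
    congr 1
    funext x
    simp only [hw, Circle.smul_def, smul_eq_mul, map_mul, neg_neg]
    congr 1
    rw [← Circle.coe_inv_eq_conj, ← AddChar.map_neg_eq_inv]
    congr 2
    ring
  set q := SchwartzMap.convolution (ContinuousLinearMap.mul ℂ ℂ) f g with hq
  have hqf : ∀ ξ : ℝ, 𝓕 q ξ = ((‖𝓕 v ξ‖ ^ 2 : ℝ) : ℂ) := by
    intro ξ
    rw [hq, SchwartzMap.fourier_convolution, SchwartzMap.pairing_apply_apply, SchwartzMap.fourier_coe,
      SchwartzMap.fourier_coe, show ⇑f = v from rfl, show ⇑g = w from rfl, hfour]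
    simp [Complex.mul_conj, Complex.normSq_eq_norm_sq]
  have hqa : ∀ x : ℝ, q x = ∫ z, v z * conj (v (z - x)) := by
    intro x
    rw [hq, SchwartzMap.convolution_apply]
    simp only [convolution, show ⇑f = v from rfl, show ⇑g = w from rfl, hw]
    simp
  have hP := SchwartzMap.tsum_eq_tsum_fourier q 0
  have hsm : Summable fun n : ℤ => ‖𝓕 v n‖ ^ 2 := by
    have h := (𝓕 q).isBigO_cocompact_rpow (-2)
    have h2 : Summable fun n : ℤ => 𝓕 q n := summable_of_isBigO (Real.summable_abs_int_rpow one_lt_two)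
      (h.comp_tendsto Int.tendsto_coe_cofinite)
    simp only [hqf] at h2
    exact Complex.summable_ofReal.1 h2
  have hP2 : ((∑' n : ℤ, ‖𝓕 v n‖ ^ 2 : ℝ) : ℂ) = ∑' n : ℤ, q n := by
    rw [Complex.ofReal_tsum]
    simp only [zero_add] at hP
    rw [hP]
    refine tsum_congr fun n => ?_
    rw [hqf]; simp
  have hfin : ∑' n : ℤ, q n = ∑ n ∈ Finset.Icc (-m : ℤ) m, q n := by
    refine tsum_eq_sum fun n hn => ?_
    rw [hqa]
    have := hm (-n) (by
      rw [abs_neg, lt_abs]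
      by_contra hcon
      push Not at hcon
      exact hn (Finset.mem_Icc.2 ⟨by omega, by omega⟩))
    simpa [← sub_eq_add_neg] using this
  calc _ ≤ ∑' n : ℤ, ‖𝓕 v n‖ ^ 2 := hsm.sum_le_tsum _ fun _ _ => by positivity
    _ ≤ ‖((∑' n : ℤ, ‖𝓕 v n‖ ^ 2 : ℝ) : ℂ)‖ := by
        rw [Complex.norm_real]; exact le_abs_self _
    _ ≤ ∑ n ∈ Finset.Icc (-m : ℤ) m, ‖q n‖ := by
        rw [hP2, hfin]; exact norm_sum_le _ _
    _ = _ := by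
        refine Finset.sum_nbij' (fun n => -n) (fun n => -n) ?_ ?_ (by simp) (by simp) ?_
        · intro n hn; rw [Finset.mem_Icc] at hn ⊢; omega
        · intro n hn; rw [Finset.mem_Icc] at hn ⊢; omega
        · intro n _
          rw [hqa]; simp [← sub_eq_add_neg]

/-- A smooth amplitude of size `κ` living on the scale `Z`. -/
structure IsSmoothAmplitude (Z κ : ℝ) (a : ℝ → ℂ) : Prop where
  contDiff : ContDiff ℝ ∞ a
  eq_zero : ∀ z, z ∉ Set.Icc (Z / 2) (2 * Z) → a z = 0
  norm_le : ∀ z, ‖a z‖ ≤ κ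
  norm_deriv_le : ∀ z, ‖deriv a z‖ ≤ κ / Z
  norm_deriv_deriv_le : ∀ z, ‖deriv (deriv a) z‖ ≤ κ / Z ^ 2

lemma IsSmoothAmplitude.isAmplitude {Z κ : ℝ} {a : ℝ → ℂ} (h : IsSmoothAmplitude Z κ a) :
    IsAmplitude Z κ a :=
  ⟨h.contDiff.of_le (by exact_mod_cast le_top), h.eq_zero, h.norm_le, h.norm_deriv_le⟩

lemma contDiffAt_logGap {z : ℝ} (hz : 0 < z) : ContDiffAt ℝ ∞ logGap z := by
  unfold logGap
  have h : ContDiffAt ℝ ∞ (fun z : ℝ => 1 + 1 / z) z :=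
    contDiffAt_const.add (contDiffAt_const.div contDiffAt_id hz.ne')
  exact h.log (by positivity)

lemma contDiffAt_osc (s : ℝ) {z : ℝ} (hz : 0 < z) : ContDiffAt ℝ ∞ (osc s) z := by
  unfold osc
  have h1 : ContDiffAt ℝ ∞ (fun z => ((s * logGap z : ℝ) : ℂ)) z :=
    Complex.ofRealCLM.contDiff.contDiffAt.comp z (contDiffAt_const.mul (contDiffAt_logGap hz))
  exact (h1.mul contDiffAt_const).cexp

/-- A function vanishing to the left of a positive point is smooth if it is smooth at positive
points. -/
lemma contDiff_of_pos {E : Type*} [NormedAddCommGroup E] [NormedSpace ℝ E] {f : ℝ → E} {c : ℝ}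
    (hc : 0 < c) (h0 : ∀ z < c, f z = 0) (hf : ∀ z, 0 < z → ContDiffAt ℝ ∞ f z) : ContDiff ℝ ∞ f := by
  rw [contDiff_iff_contDiffAt]
  intro z
  rcases lt_or_ge z c with h | h
  · have : f =ᶠ[nhds z] fun _ => (0 : E) := by
      filter_upwards [Iio_mem_nhds h] with y hy using h0 y hy
    exact contDiffAt_const.congr_of_eventuallyEq this
  · exact hf z (hc.trans_le h)

/-- The superposition of oscillating amplitudes. -/
noncomputable def oscSum (𝒥 : Finset ℕ) (τ : ℕ → ℝ) (a : ℕ → ℝ → ℂ) (z : ℝ) : ℂ :=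
  ∑ j ∈ 𝒥, a j z * osc (τ j) z

lemma contDiff_oscSum {Z : ℝ} (hZ : 0 < Z) {𝒥 : Finset ℕ} {τ : ℕ → ℝ} {a : ℕ → ℝ → ℂ}
    (ha : ∀ j ∈ 𝒥, ∀ z, 0 < z → ContDiffAt ℝ ∞ (a j) z)
    (h0 : ∀ j ∈ 𝒥, ∀ z, z ∉ Set.Icc (Z / 2) (2 * Z) → a j z = 0) : ContDiff ℝ ∞ (oscSum 𝒥 τ a) := by
  refine contDiff_of_pos (half_pos hZ) (fun z hz => ?_) (fun z hz => ?_)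
  · exact Finset.sum_eq_zero fun j hj => by
      rw [h0 j hj z fun h => absurd h.1 (not_le.2 hz), zero_mul]
  · exact ContDiffAt.sum fun j hj => (ha j hj z hz).mul (contDiffAt_osc _ hz)

lemma hasCompactSupport_oscSum {Z : ℝ} {𝒥 : Finset ℕ} {τ : ℕ → ℝ} {a : ℕ → ℝ → ℂ}
    (h0 : ∀ j ∈ 𝒥, ∀ z, z ∉ Set.Icc (Z / 2) (2 * Z) → a j z = 0) :
    HasCompactSupport (oscSum 𝒥 τ a) :=
  HasCompactSupport.intro (isCompact_Icc (a := Z / 2) (b := 2 * Z)) fun z hz =>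
    Finset.sum_eq_zero fun j hj => by rw [h0 j hj z hz, zero_mul]

lemma continuous_amplitude_osc {Z κ : ℝ} (hZ : 0 < Z) {a : ℝ → ℂ} (ha : IsAmplitude Z κ a) (s : ℝ) :
    Continuous fun z => a z * osc s z := by
  rw [continuous_iff_continuousAt]
  intro z
  rcases lt_or_ge z (Z / 2) with h | h
  · have : (fun z => a z * osc s z) =ᶠ[nhds z] fun _ => (0 : ℂ) := by
      filter_upwards [Iio_mem_nhds h] with y hy
      rw [ha.eq_zero y fun h => absurd h.1 (not_le.2 hy), zero_mul]
    exact continuousAt_const.congr this.symm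
  · exact ha.contDiff.continuous.continuousAt.mul (hasDerivAt_osc s (by linarith)).continuousAt

lemma integrable_corr {Z κ : ℝ} (hZ : 0 < Z) {a b : ℝ → ℂ} (ha : IsAmplitude Z κ a)
    (hb : IsAmplitude Z κ b) (s t : ℝ) (l : ℤ) :
    Integrable fun z => a z * osc s z * conj (b (z + l) * osc t (z + l)) := by
  refine Continuous.integrable_of_hasCompactSupport ?_ ?_
  · exact (continuous_amplitude_osc hZ ha s).mul (Complex.continuous_conj.comp
      ((continuous_amplitude_osc hZ hb t).comp (continuous_id.add_const (l : ℝ))))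
  · exact HasCompactSupport.intro (isCompact_Icc (a := Z / 2) (b := 2 * Z)) fun z hz => by
      rw [ha.eq_zero z hz, zero_mul, zero_mul]

lemma sum_norm_fourier_oscSum_le {Z κ : ℝ} (hZ : 0 < Z) {𝒥 : Finset ℕ} {τ : ℕ → ℝ} {a : ℕ → ℝ → ℂ}
    (ha : ∀ j ∈ 𝒥, IsAmplitude Z κ (a j)) (hv : ContDiff ℝ ∞ (oscSum 𝒥 τ a)) (s : Finset ℤ) :
    ∑ n ∈ s, ‖𝓕 (oscSum 𝒥 τ a) n‖ ^ 2 ≤ ∑ j ∈ 𝒥, ∑ k ∈ 𝒥,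
      ∑ l ∈ Finset.Icc (-(⌊2 * Z⌋₊ : ℤ)) ⌊2 * Z⌋₊, ‖corr (a j) (a k) (τ j) (τ k) l‖ := by
  have hexp : ∀ l : ℤ, ∫ z, oscSum 𝒥 τ a z * conj (oscSum 𝒥 τ a (z + l)) =
      ∑ j ∈ 𝒥, ∑ k ∈ 𝒥, corr (a j) (a k) (τ j) (τ k) l := by
    intro l
    unfold corr
    have : ∀ j ∈ 𝒥, ∑ k ∈ 𝒥, ∫ z, a j z * osc (τ j) z * conj (a k (z + l) * osc (τ k) (z + l)) =
        ∫ z, ∑ k ∈ 𝒥, a j z * osc (τ j) z * conj (a k (z + l) * osc (τ k) (z + l)) := fun j hj =>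
      (integral_finsetSum _ fun k hk => integrable_corr hZ (ha j hj) (ha k hk) _ _ _).symm
    rw [Finset.sum_congr rfl this, ← integral_finsetSum _ fun j hj => integrable_finsetSum _ fun k hk =>
      integrable_corr hZ (ha j hj) (ha k hk) _ _ _]
    congr 1
    funext z
    simp only [oscSum, map_sum, Finset.sum_mul_sum]
  refine (sum_norm_fourier_sq_le hv (hasCompactSupport_oscSum fun j hj => (ha j hj).eq_zero)
    (m := ⌊2 * Z⌋₊) (fun l hl => ?_) s).trans ?_
  · rw [hexp]
    refine Finset.sum_eq_zero fun j hj => Finset.sum_eq_zero fun k hk =>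
      corr_eq_zero (ha j hj) (ha k hk) _ _ ?_
    have h1 := Nat.lt_floor_add_one (2 * Z)
    have h2 : ((⌊2 * Z⌋₊ : ℝ) + 1) ≤ |(l : ℝ)| := by exact_mod_cast hl
    linarith
  · calc _ ≤ ∑ l ∈ Finset.Icc (-(⌊2 * Z⌋₊ : ℤ)) ⌊2 * Z⌋₊, ∑ j ∈ 𝒥, ∑ k ∈ 𝒥,
          ‖corr (a j) (a k) (τ j) (τ k) l‖ := by
          refine Finset.sum_le_sum fun l _ => ?_
          rw [hexp]
          exact (norm_sum_le _ _).trans (Finset.sum_le_sum fun j _ => norm_sum_le _ _)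
      _ = _ := by
          rw [Finset.sum_comm]
          exact Finset.sum_congr rfl fun j _ => Finset.sum_comm

/-- The amplitude of the derivative of `a · osc s`. -/
noncomputable def derivAmplitude (M s : ℝ) (a : ℝ → ℂ) (z : ℝ) : ℂ :=
  (deriv a z + a z * (Complex.I * (-s / (z * (z + 1)) : ℝ))) / M

lemma IsSmoothAmplitude.deriv_eq_zero {Z κ : ℝ} {a : ℝ → ℂ} (h : IsSmoothAmplitude Z κ a) {z : ℝ}
    (hz : z ∉ Set.Icc (Z / 2) (2 * Z)) : deriv a z = 0 := by
  have : a =ᶠ[nhds z] fun _ => (0 : ℂ) := by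
    filter_upwards [isClosed_Icc.isOpen_compl.mem_nhds hz] with y hy using h.eq_zero y hy
  rw [this.deriv_eq]; simp

lemma isAmplitude_derivAmplitude {Z κ T s : ℝ} (hZ : 1 / 2 ≤ Z) (hκ : 0 ≤ κ) (hT : 0 < T)
    (hZT : Z ≤ 2 * T) (hs0 : 0 ≤ s) (hs : s ≤ 3 * T) {a : ℝ → ℂ} (ha : IsSmoothAmplitude Z κ a) :
    (∀ z, 0 < z → ContDiffAt ℝ ∞ (derivAmplitude (T / Z ^ 2) s a) z) ∧
    IsAmplitude Z (62 * κ) (derivAmplitude (T / Z ^ 2) s a) := by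
  have hZ0 : 0 < Z := by linarith
  have hM : (0 : ℝ) < T / Z ^ 2 := by positivity
  have hd : ContDiff ℝ ∞ (deriv a) := (contDiff_infty_iff_deriv.1 ha.contDiff).2
  have hzero : ∀ z, z ∉ Set.Icc (Z / 2) (2 * Z) → derivAmplitude (T / Z ^ 2) s a z = 0 := by
    intro z hz
    rw [derivAmplitude, ha.eq_zero z hz, ha.deriv_eq_zero hz]; simp
  have hcd : ∀ z, 0 < z → ContDiffAt ℝ ∞ (derivAmplitude (T / Z ^ 2) s a) z := by
    intro z hz
    unfold derivAmplitude
    have h1 : ContDiffAt ℝ ∞ (fun z : ℝ => ((-s / (z * (z + 1)) : ℝ) : ℂ)) z :=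
      Complex.ofRealCLM.contDiff.contDiffAt.comp z
        (contDiffAt_const.div (by fun_prop) (by positivity))
    exact (hd.contDiffAt.add (ha.contDiff.contDiffAt.mul (contDiffAt_const.mul h1))).div_const _
  have hsm : ContDiff ℝ ∞ (derivAmplitude (T / Z ^ 2) s a) :=
    contDiff_of_pos (half_pos hZ0) (fun z hz => hzero z fun h => absurd h.1 (not_le.2 hz)) hcd
  refine ⟨hcd, hsm.of_le (by exact_mod_cast le_top), hzero, fun z => ?_, fun z => ?_⟩
  · by_cases hz : z ∈ Set.Icc (Z / 2) (2 * Z)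
    swap
    · rw [hzero z hz, norm_zero]; positivity
    have hz0 : 0 < z := by linarith [hz.1]
    have hb : |(-s / (z * (z + 1)))| ≤ 3 * T / (Z / 2) ^ 2 := by
      rw [abs_div, abs_neg, abs_of_nonneg hs0, abs_of_pos (by positivity)]
      gcongr
      nlinarith [hz.1]
    rw [derivAmplitude, norm_div, Complex.norm_real, Real.norm_eq_abs, abs_of_pos hM,
      div_le_iff₀ hM]
    calc _ ≤ κ / Z + κ * (3 * T / (Z / 2) ^ 2) := by
          refine (norm_add_le _ _).trans ?_
          rw [norm_mul, norm_mul, Complex.norm_I, one_mul, Complex.norm_real, Real.norm_eq_abs]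
          gcongr
          exacts [ha.norm_deriv_le z, ha.norm_le z]
      _ = κ * (Z + 12 * T) / Z ^ 2 := by field_simp; ring
      _ ≤ κ * (62 * T) / Z ^ 2 := by gcongr; linarith
      _ = _ := by ring
  · by_cases hz : z ∈ Set.Icc (Z / 2) (2 * Z)
    swap
    · have : derivAmplitude (T / Z ^ 2) s a =ᶠ[nhds z] fun _ => (0 : ℂ) := by
        filter_upwards [isClosed_Icc.isOpen_compl.mem_nhds hz] with y hy using hzero y hy
      rw [this.deriv_eq]; simp; positivity
    have hz0 : 0 < z := by linarith [hz.1]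
    have hb : |(-s / (z * (z + 1)))| ≤ 3 * T / (Z / 2) ^ 2 := by
      rw [abs_div, abs_neg, abs_of_nonneg hs0, abs_of_pos (by positivity)]
      gcongr
      nlinarith [hz.1]
    have hb' : |s * (2 * z + 1) / (z * (z + 1)) ^ 2| ≤ 3 * T * (2 / (Z / 2) ^ 3) := by
      rw [mul_div_assoc, abs_mul, abs_of_nonneg hs0, abs_of_pos (by positivity)]
      have h1 : (2 * z + 1) / (z * (z + 1)) ^ 2 ≤ 2 / (Z / 2) ^ 3 := by
        calc _ ≤ 2 / z ^ 3 := by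
              rw [div_le_div_iff₀ (by positivity) (by positivity)]
              have : 0 < z ^ 2 := by positivity
              have : 0 < z ^ 3 := by positivity
              nlinarith
          _ ≤ _ := by
              gcongr
              exact hz.1
      gcongr
    have hrat : HasDerivAt (fun z : ℝ => -s / (z * (z + 1))) (s * (2 * z + 1) / (z * (z + 1)) ^ 2) z := by
      have h := (hasDerivAt_const z (-s)).div ((hasDerivAt_id z).mul ((hasDerivAt_id z).add_const 1))
        (by simp only [id, Pi.mul_apply]; positivity)
      refine h.congr_deriv ?_
      simp only [id, Pi.mul_apply]; ring
    have hda : HasDerivAt a (deriv a z) z := ha.isAmplitude.hasDerivAt z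
    have hdda : HasDerivAt (deriv a) (deriv (deriv a) z) z :=
      (hd.differentiable (by simp) z).hasDerivAt
    have hder := (hdda.add (hda.mul (hrat.ofReal_comp.const_mul Complex.I))).div_const
      ((T / Z ^ 2 : ℝ) : ℂ)
    have hder' : HasDerivAt (derivAmplitude (T / Z ^ 2) s a) _ z := hder
    rw [hder'.deriv, norm_div, Complex.norm_real, Real.norm_eq_abs, abs_of_pos hM, div_le_iff₀ hM]
    calc _ ≤ κ / Z ^ 2 + (κ / Z * (3 * T / (Z / 2) ^ 2) + κ * (3 * T * (2 / (Z / 2) ^ 3))) := by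
          refine (norm_add_le _ _).trans (add_le_add (ha.norm_deriv_deriv_le z)
            ((norm_add_le _ _).trans ?_))
          rw [norm_mul, norm_mul, norm_mul, norm_mul, Complex.norm_I, one_mul, one_mul,
            Complex.norm_real, Real.norm_eq_abs, Complex.norm_real, Real.norm_eq_abs]
          gcongr
          exacts [ha.norm_deriv_le z, ha.norm_le z]
      _ = κ * (Z + 60 * T) / Z ^ 3 := by field_simp; ring
      _ ≤ κ * (62 * T) / Z ^ 3 := by gcongr; linarith
      _ = _ := by field_simp

lemma fourier_deriv_oscSum {Z κ T : ℝ} (hZ : 0 < Z) (hT : 0 < T) {𝒥 : Finset ℕ} {τ : ℕ → ℝ}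
    {a : ℝ → ℂ} (ha : IsSmoothAmplitude Z κ a) (ξ : ℝ) :
    ‖𝓕 (oscSum 𝒥 τ fun _ => a) ξ‖ * |ξ / (T / Z ^ 2)| ≤
      ‖𝓕 (oscSum 𝒥 τ fun j => derivAmplitude (T / Z ^ 2) (τ j) a) ξ‖ := by
  have hM : (0 : ℝ) < T / Z ^ 2 := by positivity
  set M := T / Z ^ 2
  have hU : ContDiff ℝ ∞ (oscSum 𝒥 τ fun _ => a) :=
    contDiff_oscSum hZ (fun j _ z _ => ha.contDiff.contDiffAt) fun j _ => ha.eq_zero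
  have hUs : HasCompactSupport (oscSum 𝒥 τ fun _ => a) :=
    hasCompactSupport_oscSum fun j _ => ha.eq_zero
  have hUd : ContDiff ℝ ∞ (deriv (oscSum 𝒥 τ fun _ => a)) := (contDiff_infty_iff_deriv.1 hU).2
  have hder : deriv (oscSum 𝒥 τ fun _ => a) =
      fun z => (M : ℂ) * oscSum 𝒥 τ (fun j => derivAmplitude M (τ j) a) z := by
    funext z
    have hMne : (M : ℂ) ≠ 0 := by exact_mod_cast hM.ne'
    rcases lt_or_ge z (Z / 2) with h | h
    · have : (oscSum 𝒥 τ fun _ => a) =ᶠ[nhds z] fun _ => (0 : ℂ) := by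
        filter_upwards [Iio_mem_nhds h] with y hy
        exact Finset.sum_eq_zero fun j _ => by
          beta_reduce
          rw [ha.eq_zero y fun h => absurd h.1 (not_le.2 hy), zero_mul]
      rw [this.deriv_eq, deriv_const, oscSum, Finset.sum_eq_zero, mul_zero]
      intro j _
      have hz : z ∉ Set.Icc (Z / 2) (2 * Z) := fun h' => absurd h'.1 (not_le.2 h)
      rw [derivAmplitude, ha.eq_zero z hz, ha.deriv_eq_zero hz]; simp
    · have hz0 : 0 < z := by linarith
      have h1 : HasDerivAt (oscSum 𝒥 τ fun _ => a) (∑ j ∈ 𝒥, (deriv a z * osc (τ j) z +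
          a z * (Complex.I * (-τ j / (z * (z + 1)) : ℝ) * osc (τ j) z))) z := by
        have := HasDerivAt.fun_sum (u := 𝒥) (x := z) fun j _ =>
          (ha.isAmplitude.hasDerivAt z).mul (hasDerivAt_osc (τ j) hz0)
        exact this
      rw [h1.deriv, oscSum, Finset.mul_sum]
      refine Finset.sum_congr rfl fun j _ => ?_
      rw [derivAmplitude]
      field_simp
  have hF := Real.fourier_deriv (hU.continuous.integrable_of_hasCompactSupport hUs)
    (hU.differentiable (by simp)) (hUd.continuous.integrable_of_hasCompactSupport hUs.deriv)
  have hF1 := congrFun hF ξ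
  rw [hder] at hF1
  have hc : 𝓕 (fun z => (M : ℂ) * oscSum 𝒥 τ (fun j => derivAmplitude M (τ j) a) z) ξ =
      M * 𝓕 (oscSum 𝒥 τ (fun j => derivAmplitude M (τ j) a)) ξ := by
    rw [Real.fourier_real_eq, Real.fourier_real_eq, ← integral_const_mul]
    congr 1; funext x
    simp only [Circle.smul_def, smul_eq_mul]; ring
  rw [hc] at hF1
  have hn := congrArg norm hF1
  rw [norm_mul, norm_smul, Complex.norm_real, Real.norm_eq_abs, abs_of_pos hM] at hn
  have h2 : ‖(2 * π * Complex.I * ξ : ℂ)‖ = 2 * π * |ξ| := by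
    simp [abs_of_pos Real.pi_pos]
  rw [h2] at hn
  rw [abs_div, abs_of_pos hM, mul_div_assoc', div_le_iff₀ hM, mul_comm _ M, hn]
  have : 0 ≤ |ξ| * ‖𝓕 (oscSum 𝒥 τ fun _ => a) ξ‖ := by positivity
  nlinarith [Real.pi_gt_three]

/-- Averages over rationals of an oscillating superposition. -/
lemma norm_sum_tsum_oscSum_le {Z κ T G T₀ X₀ Lg : ℝ} (hZ : 1 / 2 ≤ Z) (hκ : 0 ≤ κ) (hT : 0 < T)
    (hZT : Z ≤ 2 * T) (hG : 0 < G) (hGT : G ≤ T₀) (hX : T ≤ X₀) (hX3 : X₀ + T₀ ≤ 3 * T)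
    (hL1 : 1 + Real.log (2 * Z) ≤ Lg) (hL2 : 1 + Real.log (T₀ / G) ≤ Lg) {H : ℕ} (hH : 1 ≤ H)
    (hL3 : 1 + Real.log H ≤ Lg) (𝒥 : Finset ℕ) (hJ : ∀ j ∈ 𝒥, G * j ≤ T₀) {a : ℝ → ℂ}
    (ha : IsSmoothAmplitude Z κ a) :
    ‖∑ h ∈ Finset.Icc 1 H, ∑' n : ℤ, oscSum 𝒥 (fun j => X₀ + G * j) (fun _ => a) (n / h)‖ ≤
      H ^ 2 * (𝒥.card * (60 * κ * Z ^ 2 / T)) + 2 * H * √(T / Z ^ 2 * Lg * (2000000 * κ ^ 2 *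
      (𝒥.card * Z + 2 * Lg * 𝒥.card * (Z ^ 2 / G) + 2 * Lg * 𝒥.card ^ 2 * (Z ^ 3 / T)
        + 12 * 𝒥.card ^ 2 * (Z ^ 2 * √(Z * T₀) / T)))) := by
  have hZ0 : 0 < Z := by linarith
  have hM : (0 : ℝ) < T / Z ^ 2 := by positivity
  set τ : ℕ → ℝ := fun j => X₀ + G * j with hτ
  set E : ℝ := 𝒥.card * Z + 2 * Lg * 𝒥.card * (Z ^ 2 / G) + 2 * Lg * 𝒥.card ^ 2 * (Z ^ 3 / T)
        + 12 * 𝒥.card ^ 2 * (Z ^ 2 * √(Z * T₀) / T) with hE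
  have hLg : 0 ≤ Lg := by have := Real.log_natCast_nonneg H; linarith
  have hE0 : 0 ≤ E := by positivity
  have hτ1 : ∀ j ∈ 𝒥, T ≤ τ j ∧ τ j ≤ 3 * T := fun j hj => by
    have := hJ j hj
    have h0 : 0 ≤ G * j := by positivity
    simp only [hτ]; constructor <;> linarith
  have hU : ContDiff ℝ ∞ (oscSum 𝒥 τ fun _ => a) :=
    contDiff_oscSum hZ0 (fun j _ z _ => ha.contDiff.contDiffAt) fun j _ => ha.eq_zero
  have hb : ∀ j ∈ 𝒥, (∀ z, 0 < z → ContDiffAt ℝ ∞ (derivAmplitude (T / Z ^ 2) (τ j) a) z) ∧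
    IsAmplitude Z (62 * κ) (derivAmplitude (T / Z ^ 2) (τ j) a) := fun j hj =>
      isAmplitude_derivAmplitude hZ hκ hT hZT (hT.le.trans (hτ1 j hj).1) (hτ1 j hj).2 ha
  have hQ : ∀ s : Finset ℤ, ∑ m ∈ s, ‖𝓕 (oscSum 𝒥 τ fun _ => a) m‖ ^ 2 *
      (1 + ((m : ℝ) / (T / Z ^ 2)) ^ 2) ≤ 2000000 * κ ^ 2 * E := by
    intro s
    have h1 := (sum_norm_fourier_oscSum_le hZ0 (fun j _ => ha.isAmplitude) hU s).trans
      (sum_sum_corr_le hZ hT hG hGT hX hL1 hL2 𝒥 hJ (fun _ => a) fun j _ => ha.isAmplitude)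
    have h2 := (sum_norm_fourier_oscSum_le hZ0 (fun j hj => (hb j hj).2)
      (contDiff_oscSum hZ0 (fun j hj => (hb j hj).1) fun j hj => (hb j hj).2.eq_zero) s).trans
      (sum_sum_corr_le hZ hT hG hGT hX hL1 hL2 𝒥 hJ _ fun j hj => (hb j hj).2)
    calc _ ≤ ∑ m ∈ s, (‖𝓕 (oscSum 𝒥 τ fun _ => a) m‖ ^ 2 +
          ‖𝓕 (oscSum 𝒥 τ fun j => derivAmplitude (T / Z ^ 2) (τ j) a) m‖ ^ 2) := by
          refine Finset.sum_le_sum fun m _ => ?_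
          rw [mul_add, mul_one, ← sq_abs ((m : ℝ) / _), ← mul_pow]
          gcongr
          exact fourier_deriv_oscSum hZ0 hT ha _
      _ ≤ 482 * κ ^ 2 * E + 482 * (62 * κ) ^ 2 * E := by
          rw [Finset.sum_add_distrib]; exact add_le_add h1 h2
      _ ≤ _ := by nlinarith [mul_nonneg (sq_nonneg κ) hE0]
  have hinteg : ‖∫ x, oscSum 𝒥 τ (fun _ => a) x‖ ≤ 𝒥.card * (60 * κ * Z ^ 2 / T) := by
    unfold oscSum
    rw [integral_finsetSum]
    · refine (norm_sum_le _ _).trans ?_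
      rw [← nsmul_eq_mul]
      exact Finset.sum_le_card_nsmul _ _ _ fun j hj =>
        ha.isAmplitude.norm_integral_osc_le hZ hκ hT (hτ1 j hj).1
    · intro j _
      refine (continuous_amplitude_osc hZ0 ha.isAmplitude _).integrable_of_hasCompactSupport ?_
      exact HasCompactSupport.intro (isCompact_Icc (a := Z / 2) (b := 2 * Z)) fun z hz => by
        rw [ha.eq_zero z hz, zero_mul]
  refine (norm_sum_tsum_div_le hU (hasCompactSupport_oscSum fun j _ => ha.eq_zero) hM hH hL3 hQ).trans ?_
  gcongr

/-- Bounds for a function and its first two derivatives on the scale `Z`. -/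
structure ScaleBound (Z κ : ℝ) (f f' f'' : ℝ → ℝ) : Prop where
  hasDerivAt : ∀ z, 0 < z → HasDerivAt f (f' z) z
  hasDerivAt_deriv : ∀ z, 0 < z → HasDerivAt f' (f'' z) z
  abs_le : ∀ z ∈ Set.Icc (Z / 2) (2 * Z), |f z| ≤ κ
  abs_deriv_le : ∀ z ∈ Set.Icc (Z / 2) (2 * Z), |f' z| ≤ κ / Z
  abs_deriv_deriv_le : ∀ z ∈ Set.Icc (Z / 2) (2 * Z), |f'' z| ≤ κ / Z ^ 2

lemma ScaleBound.add {Z κ κ' : ℝ} {f f' f'' g g' g'' : ℝ → ℝ} (hf : ScaleBound Z κ f f' f'')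
    (hg : ScaleBound Z κ' g g' g'') :
    ScaleBound Z (κ + κ') (fun z => f z + g z) (fun z => f' z + g' z) (fun z => f'' z + g'' z) where
  hasDerivAt z hz := (hf.hasDerivAt z hz).add (hg.hasDerivAt z hz)
  hasDerivAt_deriv z hz := (hf.hasDerivAt_deriv z hz).add (hg.hasDerivAt_deriv z hz)
  abs_le z hz := (abs_add_le _ _).trans (add_le_add (hf.abs_le z hz) (hg.abs_le z hz))
  abs_deriv_le z hz := by
    rw [add_div]
    exact (abs_add_le _ _).trans (add_le_add (hf.abs_deriv_le z hz) (hg.abs_deriv_le z hz))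
  abs_deriv_deriv_le z hz := by
    rw [add_div]
    exact (abs_add_le _ _).trans (add_le_add (hf.abs_deriv_deriv_le z hz) (hg.abs_deriv_deriv_le z hz))

lemma ScaleBound.mul {Z κ κ' : ℝ} (hZ : 0 < Z) (hκ : 0 ≤ κ) (hκ' : 0 ≤ κ') {f f' f'' g g' g'' : ℝ → ℝ}
    (hf : ScaleBound Z κ f f' f'') (hg : ScaleBound Z κ' g g' g'') :
    ScaleBound Z (4 * κ * κ') (fun z => f z * g z) (fun z => f' z * g z + f z * g' z)
      (fun z => (f'' z * g z + f' z * g' z) + (f' z * g' z + f z * g'' z)) where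
  hasDerivAt z hz := (hf.hasDerivAt z hz).mul (hg.hasDerivAt z hz)
  hasDerivAt_deriv z hz := ((hf.hasDerivAt_deriv z hz).mul (hg.hasDerivAt z hz)).add
    ((hf.hasDerivAt z hz).mul (hg.hasDerivAt_deriv z hz))
  abs_le z hz := by
    rw [abs_mul]
    calc _ ≤ κ * κ' := mul_le_mul (hf.abs_le z hz) (hg.abs_le z hz) (abs_nonneg _) hκ
      _ ≤ _ := by nlinarith [mul_nonneg hκ hκ']
  abs_deriv_le z hz := by
    have := hf.abs_le z hz
    have := hg.abs_le z hz
    have := hf.abs_deriv_le z hz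
    have := hg.abs_deriv_le z hz
    calc _ ≤ |f' z| * |g z| + |f z| * |g' z| := by
          rw [← abs_mul, ← abs_mul]; exact abs_add_le _ _
      _ ≤ κ / Z * κ' + κ * (κ' / Z) := by gcongr
      _ = 2 * κ * κ' / Z := by ring
      _ ≤ _ := by
        gcongr
        linarith
  abs_deriv_deriv_le z hz := by
    have := hf.abs_le z hz
    have := hg.abs_le z hz
    have := hf.abs_deriv_le z hz
    have := hg.abs_deriv_le z hz
    have := hf.abs_deriv_deriv_le z hz
    have := hg.abs_deriv_deriv_le z hz
    calc _ ≤ (|f'' z| * |g z| + |f' z| * |g' z|) + (|f' z| * |g' z| + |f z| * |g'' z|) := by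
          simp only [← abs_mul]
          exact (abs_add_le _ _).trans (add_le_add (abs_add_le _ _) (abs_add_le _ _))
      _ ≤ (κ / Z ^ 2 * κ' + κ / Z * (κ' / Z)) + (κ / Z * (κ' / Z) + κ * (κ' / Z ^ 2)) := by gcongr
      _ = _ := by ring

lemma ScaleBound.isSmoothAmplitude {Z κ : ℝ} (hZ : 0 < Z) {f f' f'' : ℝ → ℝ}
    (hf : ScaleBound Z κ f f' f'') (hs : ∀ z, 0 < z → ContDiffAt ℝ ∞ f z)
    (h0 : ∀ z, z ∉ Set.Icc (Z / 2) (2 * Z) → f z = 0) :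
    IsSmoothAmplitude Z κ (fun z => (f z : ℂ)) := by
  have hκ : 0 ≤ κ := (abs_nonneg _).trans (hf.abs_le Z ⟨by linarith, by linarith⟩)
  set F : ℝ → ℂ := fun z => (f z : ℂ) with hF
  have hder : ∀ z, 0 < z → deriv F z = (f' z : ℂ) := fun z hz => (hf.hasDerivAt z hz).ofReal_comp.deriv
  have hder2 : ∀ z, 0 < z → deriv (deriv F) z = (f'' z : ℂ) := fun z hz => by
    have : deriv F =ᶠ[nhds z] fun z => (f' z : ℂ) := by
      filter_upwards [Ioi_mem_nhds hz] with y hy using hder y hy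
    rw [this.deriv_eq]
    exact (hf.hasDerivAt_deriv z hz).ofReal_comp.deriv
  have hz0 : ∀ z, z ∉ Set.Icc (Z / 2) (2 * Z) → F =ᶠ[nhds z] fun _ => (0 : ℂ) := fun z hz => by
    filter_upwards [isClosed_Icc.isOpen_compl.mem_nhds hz] with y hy
    simp [hF, h0 y hy]
  refine ⟨?_, fun z hz => (hz0 z hz).eq_of_nhds, fun z => ?_, fun z => ?_, fun z => ?_⟩
  · refine contDiff_of_pos (half_pos hZ) (fun z hz => ?_) fun z hz =>
      Complex.ofRealCLM.contDiff.contDiffAt.comp z (hs z hz)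
    simp [hF, h0 z fun h => absurd h.1 (not_le.2 hz)]
  all_goals by_cases hz : z ∈ Set.Icc (Z / 2) (2 * Z)
  · simpa [hF] using hf.abs_le z hz
  · rw [(hz0 z hz).eq_of_nhds]; simpa using hκ
  · rw [hder z (by linarith [hz.1])]; simpa using hf.abs_deriv_le z hz
  · rw [(hz0 z hz).deriv_eq]; simp; positivity
  · rw [hder2 z (by linarith [hz.1])]; simpa using hf.abs_deriv_deriv_le z hz
  · rw [(hz0 z hz).deriv.deriv_eq]; simp; positivity

/-- Gaussian weight in the logarithmic gap. -/
noncomputable def gapWeight (G z : ℝ) : ℝ := Real.exp (-((G * logGap z) ^ 2 / 4))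

lemma one_add_cubed_le_exp {y : ℝ} (hy : 0 ≤ y) : (1 + y) ^ 3 ≤ 27 * Real.exp y := by
  have h : 1 + y / 3 ≤ Real.exp (y / 3) := by linarith [Real.add_one_le_exp (y / 3)]
  have h2 : (1 + y / 3) ^ 3 ≤ Real.exp (y / 3) ^ 3 := by gcongr
  rw [← Real.exp_nat_mul] at h2
  have e : ((3 : ℕ) : ℝ) * (y / 3) = y := by push_cast; ring
  rw [e] at h2
  have h3 : (1 + y) ^ 3 ≤ (3 * (1 + y / 3)) ^ 3 := by gcongr; linarith
  rw [mul_pow] at h3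
  linarith

lemma gaussian_poly_le {x q : ℝ} (hx0 : 0 < x) (hx : 1 / (16 * x ^ 2) ≤ q) :
    (1 + x ^ 2) ^ 2 * Real.exp (-(x ^ 2 / 4)) ≤ 110592 * min 1 q := by
  have hy := one_add_cubed_le_exp (y := x ^ 2 / 4) (by positivity)
  have hx2 : 0 ≤ x ^ 2 := sq_nonneg x
  have hc : (1 + x ^ 2) ^ 2 * (1 + 16 * x ^ 2) ≤ 110592 * Real.exp (x ^ 2 / 4) := by
    calc _ ≤ (4 * (1 + x ^ 2 / 4)) ^ 2 * (64 * (1 + x ^ 2 / 4)) := by gcongr <;> linarith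
      _ = 1024 * (1 + x ^ 2 / 4) ^ 3 := by ring
      _ ≤ _ := by nlinarith [Real.exp_pos (x ^ 2 / 4)]
  have hmin : 1 / (1 + 16 * x ^ 2) ≤ min 1 q := by
    refine le_min ?_ ?_
    · rw [div_le_one (by positivity)]; linarith
    · refine le_trans ?_ hx
      have : 0 < x ^ 2 := by positivity
      gcongr; linarith
  rw [Real.exp_neg, ← div_eq_mul_inv, div_le_iff₀ (Real.exp_pos _)]
  calc (1 + x ^ 2) ^ 2 = (1 + x ^ 2) ^ 2 * (1 + 16 * x ^ 2) * (1 / (1 + 16 * x ^ 2)) := by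
        field_simp
    _ ≤ 110592 * Real.exp (x ^ 2 / 4) * min 1 q := by gcongr
    _ = _ := by ring

lemma inv_add_one_le_logGap {z : ℝ} (hz : 0 < z) : 1 / (z + 1) ≤ logGap z := by
  have h := Real.one_sub_inv_le_log_of_pos (show 0 < 1 + 1 / z by positivity)
  refine le_trans (le_of_eq ?_) h
  field_simp; ring

lemma contDiffAt_gapWeight (G : ℝ) {z : ℝ} (hz : 0 < z) : ContDiffAt ℝ ∞ (gapWeight G) z := by
  unfold gapWeight
  exact (((contDiffAt_const.mul (contDiffAt_logGap hz)).pow 2).div_const 4).neg.exp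

lemma scaleBound_gapWeight {G Z : ℝ} (hG : 0 < G) (hZ : 1 / 2 ≤ Z) :
    ∃ f' f'', ScaleBound Z (442368 * min 1 ((Z / G) ^ 2)) (gapWeight G) f' f'' := by
  have hZ0 : 0 < Z := by linarith
  set x : ℝ → ℝ := fun z => G * logGap z with hx
  set x₁ : ℝ → ℝ := fun z => G * (-1 / (z * (z + 1))) with hx1
  set x₂ : ℝ → ℝ := fun z => G * ((2 * z + 1) / (z * (z + 1)) ^ 2) with hx2
  have hdx : ∀ z, 0 < z → HasDerivAt x (x₁ z) z := fun z hz => (hasDerivAt_logGap hz).const_mul G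
  have hdx1 : ∀ z, 0 < z → HasDerivAt x₁ (x₂ z) z := fun z hz => by
    have h := ((hasDerivAt_const z (-1 : ℝ)).div ((hasDerivAt_id z).mul ((hasDerivAt_id z).add_const 1))
        (by simp only [id, Pi.mul_apply]; positivity)).const_mul G
    refine h.congr_deriv ?_
    simp only [id, Pi.mul_apply, hx2]; ring
  have hxpos : ∀ z, 0 < z → G / (z + 1) ≤ x z := fun z hz => by
    have := inv_add_one_le_logGap hz
    calc G / (z + 1) = G * (1 / (z + 1)) := by ring
      _ ≤ _ := by simp only [hx]; gcongr
  have hb1 : ∀ z, 0 < z → |x₁ z| ≤ x z / z := fun z hz => by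
    refine le_trans (le_of_eq ?_) (div_le_div_of_nonneg_right (hxpos z hz) hz.le)
    simp only [hx1]
    rw [abs_mul, abs_of_pos hG, abs_div, abs_neg, abs_one, abs_of_pos (by positivity)]
    field_simp
  have hb2 : ∀ z, 0 < z → |x₂ z| ≤ 2 * x z / z ^ 2 := fun z hz => by
    have : 2 * (G / (z + 1)) / z ^ 2 ≤ 2 * x z / z ^ 2 := by
      have := hxpos z hz
      gcongr
    refine le_trans ?_ this
    simp only [hx2]
    rw [abs_mul, abs_of_pos hG, abs_of_pos (by positivity)]
    have e : 2 * (G / (z + 1)) / z ^ 2 = G * ((2 * z + 2) / (z * (z + 1)) ^ 2) := by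
      field_simp
    rw [e]
    gcongr
    linarith
  set κ := min 1 ((Z / G) ^ 2) with hκ
  have hκ0 : 0 ≤ κ := le_min zero_le_one (by positivity)
  have hmain : ∀ z ∈ Set.Icc (Z / 2) (2 * Z), (1 + x z ^ 2) ^ 2 * gapWeight G z ≤ 110592 * κ := by
    intro z hz
    have hz0 : 0 < z := by linarith [hz.1]
    have h1 := hxpos z hz0
    have h2 : G / (4 * Z) ≤ x z := le_trans (by gcongr; linarith [hz.2]) h1
    have h3 : 0 < G / (4 * Z) := by positivity
    refine gaussian_poly_le (h3.trans_le h2) ?_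
    calc _ ≤ 1 / (16 * (G / (4 * Z)) ^ 2) := by gcongr
      _ = _ := by field_simp; ring
  have hWpos : ∀ z, 0 < gapWeight G z := fun z => Real.exp_pos _
  have hWd : ∀ z, 0 < z → HasDerivAt (gapWeight G) (-(x z * x₁ z / 2) * gapWeight G z) z := fun z hz => by
    have h := (((hdx z hz).pow 2).div_const 4).neg.exp
    refine h.congr_deriv ?_
    simp only [gapWeight, hx, Pi.pow_apply, Pi.neg_apply]; push_cast; ring
  refine ⟨fun z => -(x z * x₁ z / 2) * gapWeight G z, fun z => -((x₁ z * x₁ z + x z * x₂ z) / 2) *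
    gapWeight G z + -(x z * x₁ z / 2) * (-(x z * x₁ z / 2) * gapWeight G z), hWd, fun z hz => ?_,
    fun z hz => ?_, fun z hz => ?_, fun z hz => ?_⟩
  · exact ((((hdx z hz).mul (hdx1 z hz)).div_const 2).neg).mul (hWd z hz)
  all_goals
    have hz0 : 0 < z := by linarith [hz.1]
    have hm := hmain z hz
    have hW := hWpos z
    have hx0 : 0 ≤ x z := le_trans (by positivity) (hxpos z hz0)
  · rw [abs_of_pos hW]
    have : 1 * gapWeight G z ≤ (1 + x z ^ 2) ^ 2 * gapWeight G z := by
      gcongr; exact one_le_pow₀ (by nlinarith [sq_nonneg (x z)])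
    linarith
  · rw [abs_mul, abs_neg, abs_div, abs_mul, abs_of_pos hW, abs_of_nonneg hx0, abs_two]
    have h1 := hb1 z hz0
    calc _ ≤ x z * (x z / z) / 2 * gapWeight G z := by gcongr
      _ = (x z ^ 2 / 2 * gapWeight G z) / z := by ring
      _ ≤ ((1 + x z ^ 2) ^ 2 * gapWeight G z) / (Z / 2) := by
          have := hz.1
          gcongr
          nlinarith [sq_nonneg (x z), sq_nonneg (x z ^ 2)]
      _ ≤ (110592 * κ) / (Z / 2) := by gcongr
      _ = 221184 * κ / Z := by field_simp; ring
      _ ≤ _ := by gcongr; norm_num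
  · have h1 := hb1 z hz0
    have h2 := hb2 z hz0
    have hmul : |x z * x₁ z / 2| ≤ x z * (x z / z) / 2 := by
      rw [abs_div, abs_mul, abs_of_nonneg hx0, abs_two]; gcongr
    calc _ ≤ (|x₁ z| * |x₁ z| + x z * |x₂ z|) / 2 * gapWeight G z +
          |x z * x₁ z / 2| * (|x z * x₁ z / 2| * gapWeight G z) := by
          refine (abs_add_le _ _).trans ?_
          rw [abs_mul, abs_mul, abs_mul, abs_neg, abs_neg, abs_of_pos hW, abs_div _ (2 : ℝ), abs_two]
          gcongr
          refine (abs_add_le _ _).trans ?_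
          rw [abs_mul (x₁ z), abs_mul (x z), abs_of_nonneg hx0]
      _ ≤ (x z / z * (x z / z) + x z * (2 * x z / z ^ 2)) / 2 * gapWeight G z +
          x z * (x z / z) / 2 * (x z * (x z / z) / 2 * gapWeight G z) := by gcongr
      _ = ((3 * x z ^ 2 / 2 + x z ^ 4 / 4) * gapWeight G z) / z ^ 2 := by field_simp; ring
      _ ≤ ((1 + x z ^ 2) ^ 2 * gapWeight G z) / (Z / 2) ^ 2 := by
          have := hz.1
          gcongr
          nlinarith [sq_nonneg (x z), sq_nonneg (x z ^ 2)]
      _ ≤ (110592 * κ) / (Z / 2) ^ 2 := by gcongr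
      _ = _ := by field_simp; ring

/-- Smooth functions supported in `[1/2, 2]`. -/
structure IsBump (A : ℝ → ℝ) : Prop where
  contDiff : ContDiff ℝ ∞ A
  eq_zero : ∀ x, x ≤ 1 / 2 ∨ 2 ≤ x → A x = 0

lemma IsBump.hasCompactSupport {A : ℝ → ℝ} (hA : IsBump A) : HasCompactSupport A :=
  HasCompactSupport.intro (isCompact_Icc (a := (1 : ℝ) / 2) (b := 2)) fun x hx => by
    refine hA.eq_zero x ?_
    by_contra h
    push Not at h
    exact hx ⟨h.1.le, h.2.le⟩

lemma IsBump.deriv {A : ℝ → ℝ} (hA : IsBump A) : IsBump (deriv A) := by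
  have hd : ContDiff ℝ ∞ (_root_.deriv A) := (contDiff_infty_iff_deriv.1 hA.contDiff).2
  have hz : ∀ x ∈ Set.Ioi (2 : ℝ) ∪ Set.Iio (1 / 2), _root_.deriv A x = 0 := by
    intro x hx
    have : A =ᶠ[nhds x] fun _ => (0 : ℝ) := by
      rcases hx with hx | hx
      · filter_upwards [Ioi_mem_nhds hx] with y hy using hA.eq_zero y (Or.inr (le_of_lt hy))
      · filter_upwards [Iio_mem_nhds hx] with y hy using hA.eq_zero y (Or.inl (le_of_lt hy))
    rw [this.deriv_eq]; simp
  refine ⟨hd, fun x hx => ?_⟩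
  have hcl : closure (Set.Ioi (2 : ℝ) ∪ Set.Iio (1 / 2)) ⊆ {x | _root_.deriv A x = 0} :=
    (isClosed_eq hd.continuous continuous_const).closure_subset_iff.2 hz
  refine hcl ?_
  rw [closure_union, closure_Ioi, closure_Iio]
  exact hx.symm

lemma IsBump.mul_id {A : ℝ → ℝ} (hA : IsBump A) : IsBump fun x => x * A x :=
  ⟨contDiff_id.mul hA.contDiff, fun x hx => by rw [hA.eq_zero x hx, mul_zero]⟩

lemma IsBump.exists_scaleBound {A : ℝ → ℝ} (hA : IsBump A) :
    ∃ C, 0 < C ∧ ∀ Z c : ℝ, 0 < Z → ∃ f' f'', ScaleBound Z C (fun z => A ((z + c) / Z)) f' f'' := by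
  obtain ⟨C₀, h0⟩ := hA.hasCompactSupport.exists_bound_of_continuous hA.contDiff.continuous
  obtain ⟨C₁, h1⟩ := hA.deriv.hasCompactSupport.exists_bound_of_continuous hA.deriv.contDiff.continuous
  obtain ⟨C₂, h2⟩ := hA.deriv.deriv.hasCompactSupport.exists_bound_of_continuous
    hA.deriv.deriv.contDiff.continuous
  refine ⟨|C₀| + |C₁| + |C₂| + 1, by positivity, fun Z c hZ => ?_⟩
  have hlin : ∀ z : ℝ, HasDerivAt (fun z : ℝ => (z + c) / Z) (1 / Z) z := fun z =>
    ((hasDerivAt_id z).add_const c).div_const Z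
  have hd : ∀ {B : ℝ → ℝ}, IsBump B → ∀ z : ℝ, HasDerivAt (fun z => B ((z + c) / Z))
      (_root_.deriv B ((z + c) / Z) * (1 / Z)) z := fun {B} hB z =>
    ((hB.contDiff.differentiable (by simp) _).hasDerivAt).comp z (hlin z)
  refine ⟨_, _, fun z _ => hd hA z, fun z _ => (hd hA.deriv z).mul_const (1 / Z), fun z _ => ?_,
    fun z _ => ?_, fun z _ => ?_⟩
  · have := h0 ((z + c) / Z)
    rw [Real.norm_eq_abs] at this
    linarith [le_abs_self C₀, abs_nonneg C₁, abs_nonneg C₂]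
  · rw [abs_mul, abs_of_pos (by positivity : 0 < 1 / Z), mul_one_div]
    have := h1 ((z + c) / Z)
    rw [Real.norm_eq_abs] at this
    gcongr
    linarith [le_abs_self C₁, abs_nonneg C₀, abs_nonneg C₂]
  · rw [abs_mul, abs_mul, abs_of_pos (by positivity : 0 < 1 / Z), mul_one_div, mul_one_div, div_div, ← sq]
    have := h2 ((z + c) / Z)
    rw [Real.norm_eq_abs] at this
    gcongr
    linarith [le_abs_self C₂, abs_nonneg C₀, abs_nonneg C₁]

/-- The amplitude `η ∂F/∂η` of the off-diagonal terms. -/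
noncomputable def scaleAmplitude (A : ℝ → ℝ) (G Z z : ℝ) : ℝ :=
  ((z / Z * deriv A (z / Z)) * A ((z + 1) / Z) + A (z / Z) * ((z + 1) / Z * deriv A ((z + 1) / Z))) *
    gapWeight G z

lemma IsBump.exists_isSmoothAmplitude {A : ℝ → ℝ} (hA : IsBump A) : ∃ C, 0 < C ∧ ∀ G Z : ℝ, 0 < G →
    1 / 2 ≤ Z → IsSmoothAmplitude Z (C * min 1 ((Z / G) ^ 2)) (fun z => (scaleAmplitude A G Z z : ℂ)) := by
  have hA1 := hA.deriv.mul_id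
  obtain ⟨C₀, hC₀, h0⟩ := hA.exists_scaleBound
  obtain ⟨C₁, hC₁, h1⟩ := hA1.exists_scaleBound
  refine ⟨4 * (4 * C₁ * C₀ + 4 * C₀ * C₁) * 442368, by positivity, fun G Z hG hZ => ?_⟩
  have hZ0 : 0 < Z := by linarith
  obtain ⟨f', f'', hf⟩ := h0 Z 0 hZ0
  obtain ⟨g', g'', hg⟩ := h0 Z 1 hZ0
  obtain ⟨p', p'', hp⟩ := h1 Z 0 hZ0
  obtain ⟨q', q'', hq⟩ := h1 Z 1 hZ0
  obtain ⟨w', w'', hw⟩ := scaleBound_gapWeight hG hZ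
  simp only [add_zero] at hf hp
  have hmin : 0 ≤ min 1 ((Z / G) ^ 2) := le_min zero_le_one (by positivity)
  have key := ((hp.mul hZ0 hC₁.le hC₀.le hg).add (hf.mul hZ0 hC₀.le hC₁.le hq)).mul hZ0
    (by positivity) (by positivity) hw
  rw [show 4 * (4 * C₁ * C₀ + 4 * C₀ * C₁) * (442368 * min 1 ((Z / G) ^ 2)) =
    4 * (4 * C₁ * C₀ + 4 * C₀ * C₁) * 442368 * min 1 ((Z / G) ^ 2) by ring] at key
  refine key.isSmoothAmplitude hZ0 (fun z hz => ?_) (fun z hz => ?_)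
  · have hl0 : ContDiff ℝ ∞ (fun z : ℝ => z / Z) := contDiff_id.div_const Z
    have hl1 : ContDiff ℝ ∞ (fun z : ℝ => (z + 1) / Z) := (contDiff_id.add contDiff_const).div_const Z
    exact ((((hA1.contDiff.comp hl0).mul (hA.contDiff.comp hl1)).add
      ((hA.contDiff.comp hl0).mul (hA1.contDiff.comp hl1))).contDiffAt).mul (contDiffAt_gapWeight G hz)
  · have hz' : z / Z ≤ 1 / 2 ∨ 2 ≤ z / Z := by
      rw [div_le_iff₀ hZ0, le_div_iff₀ hZ0]
      by_contra h
      push Not at h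
      exact hz ⟨by linarith [h.1], h.2.le⟩
    rw [hA.eq_zero _ hz', hA.deriv.eq_zero _ hz']; simp

/-- The weight attached to a pair of frequencies with ratio `1 + 1 / z` at gap `η`. -/
noncomputable def pairWeight (A : ℝ → ℝ) (G : ℝ) (N : ℕ) (η z : ℝ) : ℝ :=
  A (η * z / N) * A (η * (z + 1) / N) * gapWeight G z

lemma IsBump.continuous_scaleAmplitude {A : ℝ → ℝ} (hA : IsBump A) (G : ℝ) (N : ℕ) (z : ℝ) :
    ContinuousOn (fun η : ℝ => 1 / η * scaleAmplitude A G (N / η) z) (Set.Ioi 0) := by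
  have h1 := hA.contDiff.continuous
  have h2 := hA.deriv.contDiff.continuous
  have h3 : ContinuousOn (fun η : ℝ => 1 / η * ((z * η / N * _root_.deriv A (z * η / N)) * A ((z + 1) * η / N) +
      A (z * η / N) * ((z + 1) * η / N * _root_.deriv A ((z + 1) * η / N))) * gapWeight G z) (Set.Ioi 0) := by
    refine ContinuousOn.mul (ContinuousOn.mul ?_ (Continuous.continuousOn (by fun_prop))) continuousOn_const
    exact continuousOn_const.div continuousOn_id fun x hx => (Set.mem_Ioi.1 hx).ne'
  refine h3.congr fun η hη => ?_
  simp only [scaleAmplitude, div_div_eq_mul_div]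
  ring

lemma IsBump.hasDerivAt_pairWeight {A : ℝ → ℝ} (hA : IsBump A) (G : ℝ) (N : ℕ) (z : ℝ) {η : ℝ}
    (hη : 0 < η) :
    HasDerivAt (fun η => pairWeight A G N η z) (1 / η * scaleAmplitude A G (N / η) z) η := by
  have hd : ∀ x, HasDerivAt A (_root_.deriv A x) x := fun x =>
    (hA.contDiff.differentiable (by simp) x).hasDerivAt
  have hl : ∀ w : ℝ, HasDerivAt (fun η : ℝ => η * w / N) (w / N) η := fun w => by
    simpa using ((hasDerivAt_id η).mul_const w).div_const (N : ℝ)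
  have h1 := (hd (η * z / N)).comp η (hl z)
  have h2 := (hd (η * (z + 1) / N)).comp η (hl (z + 1))
  have h3 := (h1.mul h2).mul_const (gapWeight G z)
  refine h3.congr_deriv ?_
  simp only [scaleAmplitude, div_div_eq_mul_div, mul_comm z, mul_comm (z + 1), Function.comp]
  field_simp

lemma IsBump.pairWeight_eq_integral {A : ℝ → ℝ} (hA : IsBump A) (G : ℝ) {N : ℕ} (hN : 1 ≤ N)
    {z h : ℝ} (hz : 0 ≤ z) (hh : 0 < h) (hhN : h ≤ 2 * N) :
    pairWeight A G N h z = -∫ η in h..(2 * N), 1 / η * scaleAmplitude A G (N / η) z := by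
  have hsub : Set.uIcc h (2 * (N : ℝ)) ⊆ Set.Ioi 0 := by
    rw [Set.uIcc_of_le hhN]; exact fun x hx => lt_of_lt_of_le hh hx.1
  rw [intervalIntegral.integral_eq_sub_of_hasDerivAt
    (fun η hη => hA.hasDerivAt_pairWeight G N z (hsub hη))
    ((hA.continuous_scaleAmplitude G N z).mono hsub).intervalIntegrable]
  have hN0 : (0 : ℝ) < N := by exact_mod_cast hN
  have : A (2 * N * (z + 1) / N) = 0 := hA.eq_zero _ (Or.inr (by rw [le_div_iff₀ hN0]; nlinarith))
  simp [pairWeight, this]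

lemma sum_integral_eq_sum_integral_sum {M : ℕ} {f : ℕ → ℝ → ℂ}
    (hf : ∀ h, ContinuousOn (f h) (Set.Ioi 0)) :
    ∑ h ∈ Finset.Icc 1 M, ∫ η in (h : ℝ)..M, f h η =
      ∑ k ∈ Finset.Ico 1 M, ∫ η in (k : ℝ)..(k + 1 : ℕ), ∑ h ∈ Finset.Icc 1 k, f h η := by
  have hinteg : ∀ h k : ℕ, 1 ≤ k → IntervalIntegrable (f h) volume (k : ℝ) (k + 1 : ℕ) := by
    intro h k hk
    refine ((hf h).mono ?_).intervalIntegrable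
    rw [Set.uIcc_of_le (by push_cast; linarith)]
    intro x hx
    have : (1 : ℝ) ≤ k := by exact_mod_cast hk
    exact lt_of_lt_of_le (by linarith) hx.1
  have h1 : ∀ h ∈ Finset.Icc 1 M, ∫ η in (h : ℝ)..M, f h η =
      ∑ k ∈ Finset.Ico h M, ∫ η in (k : ℝ)..(k + 1 : ℕ), f h η := by
    intro h hh
    rw [Finset.mem_Icc] at hh
    refine (intervalIntegral.sum_integral_adjacent_intervals_Ico (a := fun k : ℕ => (k : ℝ)) hh.2
      fun k hk => hinteg h k ?_).symm
    exact hh.1.trans hk.1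
  have h2 : ∀ k ∈ Finset.Ico 1 M, ∫ η in (k : ℝ)..(k + 1 : ℕ), ∑ h ∈ Finset.Icc 1 k, f h η =
      ∑ h ∈ Finset.Icc 1 k, ∫ η in (k : ℝ)..(k + 1 : ℕ), f h η := by
    intro k hk
    exact intervalIntegral.integral_finsetSum fun h _ => hinteg h k (Finset.mem_Ico.1 hk).1
  rw [Finset.sum_congr rfl h1, Finset.sum_congr rfl h2]
  refine Finset.sum_comm' fun h k => ?_
  simp only [Finset.mem_Icc, Finset.mem_Ico]
  omega

/-- The off-diagonal contribution, with gaps `h` and lower frequencies `n`. -/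
noncomputable def offDiagonal (A : ℝ → ℝ) (G : ℝ) (N : ℕ) (τ : ℝ) : ℂ :=
  ∑ h ∈ Finset.Icc 1 (2 * N), ∑ n ∈ Finset.Icc 1 (2 * N),
    (pairWeight A G N h (n / h) : ℂ) * osc τ (n / h)

lemma IsBump.sum_offDiagonal_eq {A : ℝ → ℝ} (hA : IsBump A) (G : ℝ) {N : ℕ} (hN : 1 ≤ N)
    (𝒥 : Finset ℕ) (τ : ℕ → ℝ) :
    ∑ j ∈ 𝒥, offDiagonal A G N (τ j) = -∑ k ∈ Finset.Ico 1 (2 * N), ∫ η in (k : ℝ)..(k + 1 : ℕ),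
      ∑ h ∈ Finset.Icc 1 k, (1 / η : ℂ) * ∑ n ∈ Finset.Icc 1 (2 * N),
        oscSum 𝒥 τ (fun _ z => (scaleAmplitude A G (N / η) z : ℂ)) (n / h) := by
  have hcont : ∀ z : ℝ, ContinuousOn
      (fun η : ℝ => ((1 / η * scaleAmplitude A G (N / η) z : ℝ) : ℂ)) (Set.Ioi 0) := fun z =>
    Complex.continuous_ofReal.comp_continuousOn (hA.continuous_scaleAmplitude G N z)
  set f : ℕ → ℝ → ℂ := fun h η => (1 / η : ℂ) * ∑ n ∈ Finset.Icc 1 (2 * N),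
        oscSum 𝒥 τ (fun _ z => (scaleAmplitude A G (N / η) z : ℂ)) (n / h) with hf
  have hfeq : ∀ h η, f h η = ∑ n ∈ Finset.Icc 1 (2 * N), ∑ j ∈ 𝒥,
      ((1 / η * scaleAmplitude A G (N / η) (n / h) : ℝ) : ℂ) * osc (τ j) (n / h) := by
    intro h η
    simp only [hf, oscSum, Finset.mul_sum]
    push_cast
    refine Finset.sum_congr rfl fun n _ => Finset.sum_congr rfl fun j _ => by ring
  have hfc : ∀ h, ContinuousOn (f h) (Set.Ioi 0) := by
    intro h
    refine ContinuousOn.congr ?_ fun η _ => hfeq h η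
    exact continuousOn_finsetSum _ fun n _ => continuousOn_finsetSum _ fun j _ =>
      (hcont _).mul continuousOn_const
  have key := sum_integral_eq_sum_integral_sum (M := 2 * N) hfc
  rw [← key, ← Finset.sum_neg_distrib]
  unfold offDiagonal
  rw [Finset.sum_comm]
  refine Finset.sum_congr rfl fun h hh => ?_
  rw [Finset.mem_Icc] at hh
  have hh0 : (0 : ℝ) < h := by exact_mod_cast hh.1
  have hhN : (h : ℝ) ≤ 2 * N := by exact_mod_cast hh.2
  have hsub : Set.uIcc (h : ℝ) ((2 * N : ℕ) : ℝ) ⊆ Set.Ioi 0 := by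
    rw [Set.uIcc_of_le (by exact_mod_cast hh.2)]; exact fun x hx => lt_of_lt_of_le hh0 hx.1
  have hii : ∀ (n j : ℕ), IntervalIntegrable (fun η : ℝ =>
      ((1 / η * scaleAmplitude A G (N / η) (n / h) : ℝ) : ℂ) * osc (τ j) (n / h)) volume
      (h : ℝ) ((2 * N : ℕ) : ℝ) := fun n j =>
    (((hcont _).mul continuousOn_const).mono hsub).intervalIntegrable
  have hi2 : ∀ n : ℕ, IntervalIntegrable (fun η : ℝ => ∑ j ∈ 𝒥,
      ((1 / η * scaleAmplitude A G (N / η) (n / h) : ℝ) : ℂ) * osc (τ j) (n / h)) volume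
      (h : ℝ) ((2 * N : ℕ) : ℝ) := fun n =>
    ((continuousOn_finsetSum _ fun j _ => (hcont _).mul continuousOn_const).mono
      hsub).intervalIntegrable
  rw [intervalIntegral.integral_congr (fun η _ => hfeq h η),
    intervalIntegral.integral_finsetSum fun n _ => hi2 n,
    ← Finset.sum_neg_distrib, Finset.sum_comm]
  refine Finset.sum_congr rfl fun n _ => ?_
  rw [intervalIntegral.integral_finsetSum fun j _ => hii n j, ← Finset.sum_neg_distrib]
  refine Finset.sum_congr rfl fun j _ => ?_
  rw [intervalIntegral.integral_mul_const, intervalIntegral.integral_ofReal,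
    hA.pairWeight_eq_integral G hN (by positivity) hh0 hhN]
  push_cast
  ring

lemma tsum_int_div_eq_sum {f : ℝ → ℂ} {M h : ℕ} (hh : 1 ≤ h)
    (hf : ∀ x : ℝ, x ≤ 0 ∨ M / h < x → f x = 0) :
    ∑' n : ℤ, f (n / h) = ∑ n ∈ Finset.Icc 1 M, f (n / h) := by
  have hh0 : (0 : ℝ) < h := by exact_mod_cast hh
  rw [tsum_eq_sum (s := (Finset.Icc 1 M).map ⟨fun n : ℕ => (n : ℤ), Nat.cast_injective⟩)]
  · simp
  · intro n hn
    apply hf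
    by_contra hcon
    push Not at hcon
    apply hn
    rw [div_le_div_iff_of_pos_right hh0] at hcon
    have h1 : 0 < n := by
      have := (div_pos_iff_of_pos_right hh0).1 hcon.1
      exact_mod_cast this
    have h2 : n ≤ M := by exact_mod_cast hcon.2
    simp only [Finset.mem_map, Finset.mem_Icc, Function.Embedding.coeFn_mk]
    exact ⟨n.toNat, by omega, by omega⟩

lemma min_one_sq_sq_le {u : ℝ} (hu : 0 ≤ u) : min 1 (u ^ 2) ^ 2 ≤ u ^ 3 ∧ min 1 (u ^ 2) ^ 2 ≤ u ^ 2 ∧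
    min 1 (u ^ 2) ^ 2 ≤ u ∧ min 1 (u ^ 2) ^ 2 ≤ u * √u := by
  have hs := Real.sqrt_nonneg u
  have hq := Real.sq_sqrt hu
  rcases le_total 1 u with h | h
  · have h1 : 1 ≤ √u := Real.one_le_sqrt.2 h
    rw [min_eq_left (by nlinarith)]
    refine ⟨?_, ?_, ?_, ?_⟩
    · have := one_le_pow₀ h (n := 3); linarith
    · nlinarith
    · linarith
    · nlinarith
  · have h1 : √u ≤ 1 := Real.sqrt_le_one.2 h
    have h2 : u ≤ √u := by nlinarith
    rw [min_eq_right (by nlinarith)]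
    have h4 : (u ^ 2) ^ 2 = u ^ 4 := by ring
    rw [h4]
    refine ⟨pow_le_pow_of_le_one hu h (by norm_num), pow_le_pow_of_le_one hu h (by norm_num),
      pow_le_of_le_one hu h (by norm_num), ?_⟩
    calc u ^ 4 ≤ u ^ 2 := pow_le_pow_of_le_one hu h (by norm_num)
      _ = u * u := sq u
      _ ≤ _ := by gcongr

/-- The square of the off-diagonal bound. -/
noncomputable def meanExcess (T G T₀ J : ℝ) : ℝ := J * T / G ^ 3 + J ^ 2 * √T₀ / (G * √G)

lemma meanExcess_nonneg {T G T₀ J : ℝ} (hT : 0 ≤ T) (hG : 0 ≤ G) (hJ : 0 ≤ J) :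
    0 ≤ meanExcess T G T₀ J := by
  unfold meanExcess; positivity

lemma sqrt_le_mul_sqrt_meanExcess {T G T₀ J Z C Lg : ℝ} (hT : 0 < T) (hG : 0 < G) (hGT : G ≤ T₀)
    (hJ : 0 ≤ J) (hZ : 0 < Z) (hC : 0 ≤ C) (hL : 1 ≤ Lg) :
    √(T / Z ^ 2 * Lg * (2000000 * (C * min 1 ((Z / G) ^ 2)) ^ 2 *
      (J * Z + 2 * Lg * J * (Z ^ 2 / G) + 2 * Lg * J ^ 2 * (Z ^ 3 / T)
        + 12 * J ^ 2 * (Z ^ 2 * √(Z * T₀) / T)))) ≤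
      6000 * C * Lg * Z * √(meanExcess T G T₀ J) := by
  obtain ⟨h3, h2, h1, hs⟩ := min_one_sq_sq_le (u := Z / G) (by positivity)
  set μ := min 1 ((Z / G) ^ 2)
  have hD := meanExcess_nonneg (T₀ := T₀) hT.le hG.le hJ
  have hT₀ : 0 < T₀ := hG.trans_le hGT
  refine Real.sqrt_le_iff.2 ⟨by positivity, ?_⟩
  rw [mul_pow _ (√_), Real.sq_sqrt hD]
  have e1 : μ ^ 2 * (T / Z) ≤ Z ^ 2 * (T / G ^ 3) := by
    calc _ ≤ (Z / G) ^ 3 * (T / Z) := by gcongr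
      _ = _ := by field_simp
  have e2 : μ ^ 2 * (T / G) ≤ Z ^ 2 * (T / G ^ 3) := by
    calc _ ≤ (Z / G) ^ 2 * (T / G) := by gcongr
      _ = _ := by field_simp
  have hGs : 0 < √G := Real.sqrt_pos.2 hG
  have e3 : μ ^ 2 * Z ≤ Z ^ 2 * (√T₀ / (G * √G)) := by
    calc _ ≤ (Z / G) * Z := by gcongr
      _ = Z ^ 2 * (√G / (G * √G)) := by field_simp
      _ ≤ _ := by gcongr
  have e4 : μ ^ 2 * √(Z * T₀) ≤ Z ^ 2 * (√T₀ / (G * √G)) := by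
    calc _ ≤ (Z / G * √(Z / G)) * √(Z * T₀) := by gcongr
      _ = _ := by
        rw [Real.sqrt_div hZ.le, Real.sqrt_mul hZ.le]
        have := Real.mul_self_sqrt hZ.le
        field_simp
        rw [Real.sq_sqrt hZ.le]
  calc _ = 2000000 * C ^ 2 * Lg * (J * (μ ^ 2 * (T / Z)) + 2 * Lg * J * (μ ^ 2 * (T / G)) +
        2 * Lg * J ^ 2 * (μ ^ 2 * Z) + 12 * J ^ 2 * (μ ^ 2 * √(Z * T₀))) := by field_simp
    _ ≤ 2000000 * C ^ 2 * Lg * (J * (Z ^ 2 * (T / G ^ 3)) + 2 * Lg * J * (Z ^ 2 * (T / G ^ 3)) +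
        2 * Lg * J ^ 2 * (Z ^ 2 * (√T₀ / (G * √G))) + 12 * J ^ 2 * (Z ^ 2 * (√T₀ / (G * √G)))) := by
        gcongr
    _ ≤ 2000000 * C ^ 2 * Lg * (Lg * J * (Z ^ 2 * (T / G ^ 3)) + 2 * Lg * J * (Z ^ 2 * (T / G ^ 3)) +
        2 * Lg * J ^ 2 * (Z ^ 2 * (√T₀ / (G * √G))) +
        12 * Lg * J ^ 2 * (Z ^ 2 * (√T₀ / (G * √G)))) := by
        have : J * 1 ≤ J * Lg := by gcongr
        have : J ^ 2 * 1 ≤ J ^ 2 * Lg := by gcongr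
        gcongr <;> nlinarith
    _ = 2000000 * C ^ 2 * Lg ^ 2 * Z ^ 2 *
        (3 * (J * T / G ^ 3) + 14 * (J ^ 2 * √T₀ / (G * √G))) := by ring
    _ ≤ 2000000 * C ^ 2 * Lg ^ 2 * Z ^ 2 * (18 * meanExcess T G T₀ J) := by
        unfold meanExcess
        have : 0 ≤ J * T / G ^ 3 := by positivity
        have : 0 ≤ J ^ 2 * √T₀ / (G * √G) := by positivity
        gcongr
        linarith
    _ = _ := by ring

lemma IsBump.exists_norm_sum_offDiagonal_le {A : ℝ → ℝ} (hA : IsBump A) : ∃ C, 0 < C ∧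
    ∀ (T G T₀ X₀ : ℝ) (N : ℕ) (𝒥 : Finset ℕ), 2 ≤ T → 1 ≤ N → (N : ℝ) ≤ 2 * T → 1 ≤ G → G ≤ T₀ →
      T₀ ≤ T → T ≤ X₀ → X₀ + T₀ ≤ 3 * T → (∀ j ∈ 𝒥, G * j ≤ T₀) →
      ‖∑ j ∈ 𝒥, offDiagonal A G N (X₀ + G * j)‖ ≤
        C * N * (3 + Real.log T) ^ 2 * (𝒥.card + √(meanExcess T G T₀ 𝒥.card)) := by
  obtain ⟨C, hC, hsm⟩ := hA.exists_isSmoothAmplitude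
  refine ⟨12000 * C, by positivity, ?_⟩
  intro T G T₀ X₀ N 𝒥 hT hN hNT hG hGT hTT hX hX3 hJ
  set Lg := 3 + Real.log T with hLg
  have hlogT : 0 ≤ Real.log T := Real.log_nonneg (by linarith)
  have hlog4 : Real.log (4 * T) ≤ 2 + Real.log T := by
    rw [Real.log_mul (by norm_num) (by linarith)]
    have : Real.log 4 ≤ 2 := by
      rw [show (4 : ℝ) = 2 ^ 2 by norm_num, Real.log_pow]
      have := Real.log_two_lt_d9
      push_cast
      linarith
    linarith
  set J : ℝ := (𝒥.card : ℝ) with hJdef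
  have hJ0 : 0 ≤ J := by positivity
  set D := meanExcess T G T₀ J with hD
  have hN0 : (0 : ℝ) < N := by exact_mod_cast hN
  have hT0 : 0 < T := by linarith
  have hG0 : 0 < G := by linarith
  have hL1 : 1 ≤ Lg := by linarith
  rw [hA.sum_offDiagonal_eq G hN 𝒥 (fun j => X₀ + G * j), norm_neg]
  have hpt : ∀ k ∈ Finset.Ico 1 (2 * N), ‖∫ η in (k : ℝ)..(k + 1 : ℕ),
      ∑ h ∈ Finset.Icc 1 k, (1 / η : ℂ) * ∑ n ∈ Finset.Icc 1 (2 * N),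
        oscSum 𝒥 (fun j => X₀ + G * j) (fun _ z => (scaleAmplitude A G (N / η) z : ℂ)) (n / h)‖ ≤
      12000 * C * N * Lg * (J + √D) * (1 / k) := by
    intro k hk
    rw [Finset.mem_Ico] at hk
    have hk1 : (1 : ℝ) ≤ k := by exact_mod_cast hk.1
    have hk0 : (0 : ℝ) < k := by linarith
    have hk2 : (k : ℝ) + 1 ≤ 2 * N := by exact_mod_cast hk.2
    refine (intervalIntegral.norm_integral_le_of_norm_le_const
      (C := 12000 * C * N * Lg * (J + √D) * (1 / k)) fun η hη => ?_).trans (by simp)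
    rw [Set.uIoc_of_le (by push_cast; linarith), Set.mem_Ioc] at hη
    push_cast at hη
    have hη0 : 0 < η := by linarith [hη.1]
    have hZ : 1 / 2 ≤ N / η := by rw [div_le_div_iff₀ (by norm_num) hη0]; linarith [hη.2]
    have hZk : N / η ≤ N / k := by gcongr; exact hη.1.le
    have hZN : (N : ℝ) / k ≤ N := div_le_self hN0.le hk1
    have ha := hsm G (N / η) hG0 hZ
    set a : ℝ → ℂ := fun z => (scaleAmplitude A G (N / η) z : ℂ) with hadef
    set Z := N / η with hZdef
    have hZ0 : 0 < Z := by linarith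
    rw [← Finset.mul_sum, norm_mul]
    have hts : ∀ h ∈ Finset.Icc 1 k, ∑ n ∈ Finset.Icc 1 (2 * N),
        oscSum 𝒥 (fun j => X₀ + G * j) (fun _ => a) (n / h) =
        ∑' n : ℤ, oscSum 𝒥 (fun j => X₀ + G * j) (fun _ => a) (n / h) := by
      intro h hh
      rw [Finset.mem_Icc] at hh
      have hh0 : (0 : ℝ) < h := by exact_mod_cast hh.1
      have hhk : (h : ℝ) ≤ k := by exact_mod_cast hh.2
      refine (tsum_int_div_eq_sum hh.1 fun x hx => ?_).symm
      unfold oscSum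
      refine Finset.sum_eq_zero fun j _ => ?_
      refine mul_eq_zero_of_left (ha.eq_zero x ?_) _
      intro hx'
      rcases hx with hx | hx
      · linarith [hx'.1]
      · have : 2 * Z ≤ (2 * N : ℕ) / h := by
          push_cast
          rw [hZdef, mul_div_assoc]
          gcongr
          linarith [hη.1]
        linarith [hx'.2]
    rw [Finset.sum_congr rfl hts]
    have hb := norm_sum_tsum_oscSum_le (Lg := Lg) hZ (by positivity) hT0 (by linarith) hG0 hGT hX hX3
      (by
        have : Real.log (2 * Z) ≤ Real.log (4 * T) := Real.log_le_log (by positivity) (by linarith)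
        linarith)
      (by
        have : Real.log (T₀ / G) ≤ Real.log T := Real.log_le_log (div_pos (by linarith) hG0)
          ((div_le_self (by linarith) hG).trans hTT)
        linarith)
      hk.1
      (by
        have : Real.log k ≤ Real.log (4 * T) := Real.log_le_log (by positivity) (by linarith)
        linarith) 𝒥 hJ ha
    have hs := sqrt_le_mul_sqrt_meanExcess hT0 hG0 hGT hJ0 hZ0 hC.le hL1
    have hinv : ‖(1 / η : ℂ)‖ ≤ 1 / k := by
      rw [norm_div, norm_one, Complex.norm_real, Real.norm_of_nonneg hη0.le]
      gcongr
      exact hη.1.le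
    have hsD : 0 ≤ √D := Real.sqrt_nonneg _
    have hfirst : (k : ℝ) ^ 2 * (J * (60 * (C * min 1 ((Z / G) ^ 2)) * Z ^ 2 / T)) ≤
        120 * C * N * J := by
      have hZ2 : Z ^ 2 / T ≤ 2 * N / k ^ 2 := by
        rw [div_le_div_iff₀ hT0 (by positivity)]
        have : Z * k ≤ N := by
          rw [hZdef, div_mul_eq_mul_div, div_le_iff₀ hη0]
          gcongr
          exact hη.1.le
        calc Z ^ 2 * k ^ 2 = (Z * k) ^ 2 := by ring
          _ ≤ (N : ℝ) ^ 2 := by gcongr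
          _ ≤ _ := by nlinarith
      calc _ = (k : ℝ) ^ 2 * (J * (60 * (C * min 1 ((Z / G) ^ 2)) * (Z ^ 2 / T))) := by ring
        _ ≤ (k : ℝ) ^ 2 * (J * (60 * (C * 1) * (2 * N / k ^ 2))) := by
          gcongr
          exact min_le_left _ _
        _ = _ := by field_simp; ring
    calc _ ≤ 1 / (k : ℝ) * (120 * C * N * J + 2 * k * (6000 * C * Lg * (N / k) * √D)) := by
          gcongr
          refine hb.trans ?_
          gcongr
          refine hs.trans ?_
          gcongr
      _ = (120 * J + 12000 * Lg * √D) * (C * N * (1 / k)) := by field_simp; ring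
      _ ≤ (12000 * Lg * (J + √D)) * (C * N * (1 / k)) := by
          gcongr
          nlinarith
      _ = _ := by ring
  refine (norm_sum_le _ _).trans ((Finset.sum_le_sum hpt).trans ?_)
  rw [← Finset.mul_sum]
  have hsum : ∑ k ∈ Finset.Ico 1 (2 * N), 1 / (k : ℝ) ≤ Lg := by
    refine (Finset.sum_le_sum_of_subset_of_nonneg (t := Finset.Icc 1 (2 * N)) ?_ ?_).trans
      ((sum_inv_Icc_le (2 * N) (x := 4 * T) (by linarith) (by push_cast; linarith)).trans (by linarith))
    · intro x; simp only [Finset.mem_Ico, Finset.mem_Icc]; omega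
    · intros; positivity
  have hsD : 0 ≤ √D := Real.sqrt_nonneg _
  calc _ ≤ 12000 * C * N * Lg * (J + √D) * Lg := by gcongr
    _ = _ := by ring

lemma integrable_gaussian_mul_cos_and_integral {G : ℝ} (hG : 0 < G) (τ ξ : ℝ) :
    Integrable (fun t : ℝ => Real.exp (-((t - τ) / G) ^ 2) * Real.cos (t * ξ)) ∧
    ∫ t : ℝ, Real.exp (-((t - τ) / G) ^ 2) * Real.cos (t * ξ) =
      G * √π * (Real.cos (τ * ξ) * Real.exp (-((G * ξ) ^ 2 / 4))) := by
  have hG' : (G : ℂ) ≠ 0 := by exact_mod_cast hG.ne'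
  set b : ℂ := ((-(G ^ 2)⁻¹ : ℝ) : ℂ) with hb
  have hbre : b.re < 0 := by rw [hb, Complex.ofReal_re]; simp; positivity
  set c : ℂ := 2 * τ / G ^ 2 + ξ * Complex.I with hc
  set d : ℂ := -(τ ^ 2 / G ^ 2) with hd
  have hpt : ∀ t : ℝ, Complex.exp (b * t ^ 2 + c * t + d) =
      Real.exp (-((t - τ) / G) ^ 2) * Complex.exp ((t * ξ : ℝ) * Complex.I) := by
    intro t
    rw [Complex.ofReal_exp, ← Complex.exp_add]
    congr 1
    rw [hb, hc, hd]
    push_cast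
    field_simp
    ring
  have hinteg := integrable_cexp_quadratic' hbre c d
  have hval := integral_cexp_quadratic hbre c d
  have hre : ∀ t : ℝ, (Complex.exp (b * t ^ 2 + c * t + d)).re =
      Real.exp (-((t - τ) / G) ^ 2) * Real.cos (t * ξ) := by
    intro t
    rw [hpt, Complex.re_ofReal_mul, Complex.exp_ofReal_mul_I_re]
  have h1 : ((π : ℂ) / -b) ^ (1 / 2 : ℂ) = ((G * √π : ℝ) : ℂ) := by
    rw [show (π : ℂ) / -b = ((π * G ^ 2 : ℝ) : ℂ) by rw [hb]; push_cast; field_simp,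
      show (1 / 2 : ℂ) = ((1 / 2 : ℝ) : ℂ) by push_cast; rfl,
      ← Complex.ofReal_cpow (by positivity), ← Real.sqrt_eq_rpow, Real.sqrt_mul (by positivity),
      Real.sqrt_sq hG.le, mul_comm]
  have h2 : Complex.exp (d - c ^ 2 / (4 * b)) =
      Real.exp (-((G * ξ) ^ 2 / 4)) * Complex.exp ((τ * ξ : ℝ) * Complex.I) := by
    rw [Complex.ofReal_exp, ← Complex.exp_add]
    congr 1
    rw [hb, hc, hd]
    push_cast
    field_simp
    ring_nf
    rw [Complex.I_sq]
    ring
  refine ⟨hinteg.re.congr (Filter.Eventually.of_forall hre), ?_⟩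
  rw [← integral_congr_ae (Filter.Eventually.of_forall hre)]
  have h3 := (integral_re hinteg : _ = _)
  refine h3.trans ?_
  rw [hval, h1, h2]
  change Complex.re _ = _
  rw [Complex.re_ofReal_mul, Complex.re_ofReal_mul, Complex.exp_ofReal_mul_I_re]
  ring

lemma norm_sq_sum_mul_exp (s : Finset ℕ) (a ℓ : ℕ → ℝ) (t : ℝ) :
    ‖∑ n ∈ s, (a n : ℂ) * Complex.exp (-(t * ℓ n : ℝ) * Complex.I)‖ ^ 2 =
      ∑ m ∈ s, ∑ n ∈ s, a m * a n * Real.cos (t * (ℓ m - ℓ n)) := by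
  have h1 : ∀ n, Complex.exp (-(t * ℓ n : ℝ) * Complex.I) =
      ⟨Real.cos (t * ℓ n), -Real.sin (t * ℓ n)⟩ := by
    intro n
    rw [← Complex.ofReal_neg]
    apply Complex.ext
    · rw [Complex.exp_ofReal_mul_I_re, Real.cos_neg]
    · rw [Complex.exp_ofReal_mul_I_im, Real.sin_neg]
  rw [Complex.sq_norm, Complex.normSq_apply, Complex.re_sum, Complex.im_sum, Finset.sum_mul_sum,
    Finset.sum_mul_sum, ← Finset.sum_add_distrib]
  refine Finset.sum_congr rfl fun m _ => ?_
  rw [← Finset.sum_add_distrib]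
  refine Finset.sum_congr rfl fun n _ => ?_
  rw [h1, h1, mul_sub, Real.cos_sub]
  simp only [Complex.re_ofReal_mul, Complex.im_ofReal_mul]
  ring

lemma sum_sum_eq_diagonal_add {M : ℕ} {g : ℕ → ℕ → ℝ} (hsymm : ∀ m n, g m n = g n m)
    (hg : ∀ m n, M < m → g m n = 0) :
    ∑ m ∈ Finset.Icc 1 M, ∑ n ∈ Finset.Icc 1 M, g m n = ∑ n ∈ Finset.Icc 1 M, g n n +
      2 * ∑ h ∈ Finset.Icc 1 M, ∑ n ∈ Finset.Icc 1 M, g (n + h) n := by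
  have hlow : ∑ m ∈ Finset.Icc 1 M, ∑ n ∈ Finset.Icc 1 M, (if n < m then g m n else 0) =
      ∑ h ∈ Finset.Icc 1 M, ∑ n ∈ Finset.Icc 1 M, g (n + h) n := by
    rw [Finset.sum_comm, Finset.sum_comm (s := Finset.Icc 1 M) (t := Finset.Icc 1 M)
      (f := fun h n => g (n + h) n)]
    refine Finset.sum_congr rfl fun n hn => ?_
    rw [← Finset.sum_filter]
    have h1 : ∑ h ∈ Finset.Icc 1 M, g (n + h) n = ∑ h ∈ Finset.Icc 1 (M - n), g (n + h) n := by
      refine (Finset.sum_subset (fun x hx => ?_) fun x _ hx => hg _ _ ?_).symm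
      · rw [Finset.mem_Icc] at *; omega
      · simp only [Finset.mem_Icc] at *; omega
    rw [h1]
    refine Finset.sum_nbij' (fun m => m - n) (fun h => n + h) ?_ ?_ ?_ ?_ ?_
    · intro m hm; simp only [Finset.mem_filter, Finset.mem_Icc] at *; omega
    · intro m hm; simp only [Finset.mem_filter, Finset.mem_Icc] at *; omega
    · intro m hm; simp only [Finset.mem_filter, Finset.mem_Icc] at *; omega
    · intro m hm; omega
    · intro m hm
      simp only [Finset.mem_filter, Finset.mem_Icc] at hm
      rw [Nat.add_sub_cancel' hm.2.le]
  have hupp : ∑ m ∈ Finset.Icc 1 M, ∑ n ∈ Finset.Icc 1 M, (if m < n then g m n else 0) =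
      ∑ m ∈ Finset.Icc 1 M, ∑ n ∈ Finset.Icc 1 M, (if n < m then g m n else 0) := by
    rw [Finset.sum_comm]
    refine Finset.sum_congr rfl fun m _ => Finset.sum_congr rfl fun n _ => ?_
    rw [hsymm]
  have hdia : ∑ m ∈ Finset.Icc 1 M, ∑ n ∈ Finset.Icc 1 M, (if m = n then g m n else 0) =
      ∑ n ∈ Finset.Icc 1 M, g n n := by
    refine Finset.sum_congr rfl fun m hm => ?_
    rw [Finset.sum_ite_eq, if_pos hm]
  have hsplit : ∀ m n, g m n = (if m = n then g m n else 0) + (if n < m then g m n else 0) +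
      (if m < n then g m n else 0) := by
    intro m n
    rcases lt_trichotomy m n with h | h | h
    · simp [h, h.ne, h.le]
    · simp [h]
    · simp [h, h.ne', h.le]
  rw [Finset.sum_congr rfl fun m _ => Finset.sum_congr rfl fun n _ => hsplit m n]
  simp only [Finset.sum_add_distrib]
  rw [hupp, hlow, hdia]
  ring

lemma IsBump.integral_gaussian_mul_smoothSum {A : ℝ → ℝ} (hA : IsBump A) {G : ℝ} (hG : 0 < G)
    {N : ℕ} (hN : 1 ≤ N) (τ : ℝ) :
    Integrable (fun t : ℝ => Real.exp (-((t - τ) / G) ^ 2) * ‖smoothSum A N t‖ ^ 2) ∧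
    ∫ t : ℝ, Real.exp (-((t - τ) / G) ^ 2) * ‖smoothSum A N t‖ ^ 2 =
      G * √π * (∑ n ∈ Finset.Icc 1 (2 * N), A (n / N) ^ 2 + 2 * (offDiagonal A G N τ).re) := by
  have hN0 : (0 : ℝ) < N := by exact_mod_cast hN
  set ℓ : ℕ → ℝ := fun n => Real.log (n / N) with hℓ
  set a : ℕ → ℝ := fun n => A (n / N) with ha
  have hpt : ∀ t, Real.exp (-((t - τ) / G) ^ 2) * ‖smoothSum A N t‖ ^ 2 =
      ∑ m ∈ Finset.Icc 1 (2 * N), ∑ n ∈ Finset.Icc 1 (2 * N), a m * a n *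
        (Real.exp (-((t - τ) / G) ^ 2) * Real.cos (t * (ℓ m - ℓ n))) := by
    intro t
    rw [smoothSum, norm_sq_sum_mul_exp (Finset.Icc 1 (2 * N)) a ℓ t, Finset.mul_sum]
    refine Finset.sum_congr rfl fun m _ => ?_
    rw [Finset.mul_sum]
    refine Finset.sum_congr rfl fun n _ => by ring
  have hi : ∀ m n, Integrable (fun t : ℝ => a m * a n *
        (Real.exp (-((t - τ) / G) ^ 2) * Real.cos (t * (ℓ m - ℓ n)))) := fun m n =>
    (integrable_gaussian_mul_cos_and_integral hG τ _).1.const_mul _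
  have hi2 : ∀ m, Integrable (fun t : ℝ => ∑ n ∈ Finset.Icc 1 (2 * N), a m * a n *
        (Real.exp (-((t - τ) / G) ^ 2) * Real.cos (t * (ℓ m - ℓ n)))) := fun m =>
    integrable_finsetSum _ fun n _ => hi m n
  simp only [hpt]
  refine ⟨integrable_finsetSum _ fun m _ => hi2 m, ?_⟩
  rw [integral_finsetSum _ fun m _ => hi2 m]
  set g : ℕ → ℕ → ℝ := fun m n => a m * a n * (Real.cos (τ * (ℓ m - ℓ n)) *
    Real.exp (-((G * (ℓ m - ℓ n)) ^ 2 / 4))) with hg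
  have hg1 : ∀ m n, ∫ t : ℝ, a m * a n *
        (Real.exp (-((t - τ) / G) ^ 2) * Real.cos (t * (ℓ m - ℓ n))) = G * √π * g m n := by
    intro m n
    rw [integral_const_mul, (integrable_gaussian_mul_cos_and_integral hG τ _).2]
    ring
  have hg2 : ∑ m ∈ Finset.Icc 1 (2 * N), ∫ t : ℝ, ∑ n ∈ Finset.Icc 1 (2 * N), a m * a n *
        (Real.exp (-((t - τ) / G) ^ 2) * Real.cos (t * (ℓ m - ℓ n))) =
      G * √π * ∑ m ∈ Finset.Icc 1 (2 * N), ∑ n ∈ Finset.Icc 1 (2 * N), g m n := by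
    rw [Finset.mul_sum]
    refine Finset.sum_congr rfl fun m _ => ?_
    rw [integral_finsetSum _ fun n _ => hi m n, Finset.mul_sum]
    exact Finset.sum_congr rfl fun n _ => hg1 m n
  rw [hg2, sum_sum_eq_diagonal_add (g := g)]
  · congr 2
    · refine Finset.sum_congr rfl fun n _ => ?_
      simp [hg, ha, sq]
    · unfold offDiagonal
      rw [Complex.re_sum]
      congr 1
      refine Finset.sum_congr rfl fun h hh => ?_
      rw [Complex.re_sum]
      refine Finset.sum_congr rfl fun n hn => ?_
      rw [Finset.mem_Icc] at hh hn
      have hh0 : (0 : ℝ) < h := by exact_mod_cast hh.1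
      have hn0 : (0 : ℝ) < n := by exact_mod_cast hn.1
      have hlog : ℓ (n + h) - ℓ n = logGap (n / h) := by
        simp only [hℓ, logGap]
        have hnh : (0 : ℝ) < (n + h : ℕ) := by push_cast; positivity
        rw [← Real.log_div (by positivity) (by positivity)]
        congr 1
        push_cast
        field_simp
      rw [Complex.re_ofReal_mul, osc, Complex.exp_ofReal_mul_I_re, hg]
      simp only [hlog, ha, pairWeight, gapWeight]
      rw [show (h : ℝ) * (n / h) / N = n / N by field_simp,
        show (h : ℝ) * (n / h + 1) / N = (n + h : ℕ) / N by push_cast; field_simp]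
      ring
  · intro m n
    simp only [hg]
    rw [show ℓ n - ℓ m = -(ℓ m - ℓ n) by ring, mul_neg, mul_neg, Real.cos_neg, neg_sq]
    ring
  · intro m n hm
    have : a m = 0 := hA.eq_zero _ (Or.inr (by
      rw [le_div_iff₀ hN0]; exact_mod_cast hm.le))
    simp [hg, this]

/-- The mean square of a smooth sum over a family of Gaussian windows of length `G`. -/
theorem IsBump.exists_sum_integral_le {A : ℝ → ℝ} (hA : IsBump A) : ∃ C, 0 < C ∧
    ∀ (T G T₀ X₀ : ℝ) (N : ℕ) (𝒥 : Finset ℕ), 2 ≤ T → 1 ≤ N → (N : ℝ) ≤ 2 * T → 1 ≤ G → G ≤ T₀ →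
      T₀ ≤ T → T ≤ X₀ → X₀ + T₀ ≤ 3 * T → (∀ j ∈ 𝒥, G * j ≤ T₀) →
      ∑ j ∈ 𝒥, ∫ t : ℝ, Real.exp (-((t - (X₀ + G * j)) / G) ^ 2) * ‖smoothSum A N t‖ ^ 2 ≤
        C * N * G * (3 + Real.log T) ^ 2 * (𝒥.card + √(meanExcess T G T₀ 𝒥.card)) := by
  obtain ⟨B, hB⟩ := hA.hasCompactSupport.exists_bound_of_continuous hA.contDiff.continuous
  obtain ⟨C, hC, hoff⟩ := hA.exists_norm_sum_offDiagonal_le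
  refine ⟨√π * (2 * B ^ 2 + 2 * C), by positivity, ?_⟩
  intro T G T₀ X₀ N 𝒥 hT hN hNT hG hGT hTT hX hX3 hJ
  have hb := hoff T G T₀ X₀ N 𝒥 hT hN hNT hG hGT hTT hX hX3 hJ
  have hG0 : 0 < G := by linarith
  have hL : 1 ≤ (3 + Real.log T) ^ 2 := by
    have := Real.log_nonneg (show (1 : ℝ) ≤ T by linarith)
    exact one_le_pow₀ (by linarith)
  set Λ := (3 + Real.log T) ^ 2
  set D := √(meanExcess T G T₀ 𝒥.card)
  have hD : 0 ≤ D := Real.sqrt_nonneg _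
  have hdiag : ∑ n ∈ Finset.Icc 1 (2 * N), A (n / N) ^ 2 ≤ 2 * N * B ^ 2 := by
    refine (Finset.sum_le_card_nsmul _ _ (B ^ 2) fun n _ => ?_).trans (by simp)
    have := hB ((n : ℝ) / N)
    rw [Real.norm_eq_abs] at this
    exact sq_le_sq.2 (this.trans (le_abs_self B))
  rw [Finset.sum_congr rfl fun (j : ℕ) _ => (hA.integral_gaussian_mul_smoothSum hG0 hN (X₀ + G * j)).2,
    ← Finset.mul_sum, Finset.sum_add_distrib, ← Finset.mul_sum, ← Complex.re_sum, Finset.sum_const,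
    nsmul_eq_mul]
  have hre := (Complex.re_le_norm _).trans hb
  calc _ ≤ G * √π * (𝒥.card * (2 * N * B ^ 2) + 2 * (C * N * Λ * (𝒥.card + D))) := by gcongr
    _ = G * √π * N * (2 * B ^ 2 * (𝒥.card * 1) + 2 * C * (Λ * (𝒥.card + D))) := by ring
    _ ≤ G * √π * N * (2 * B ^ 2 * ((𝒥.card + D) * Λ) + 2 * C * (Λ * (𝒥.card + D))) := by
        gcongr
        linarith
    _ = _ := by ring

/-- A Sobolev inequality on a unit interval. -/
lemma norm_sq_le_integral_of_hasDerivAt {S S' : ℝ → ℂ} (hS : ∀ t, HasDerivAt S (S' t) t)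
    (hS' : Continuous S') (t : ℝ) :
    ‖S t‖ ^ 2 ≤ ∫ u in Set.Ioc (t - 1 / 2) (t + 1 / 2), (2 * ‖S u‖ ^ 2 + ‖S' u‖ ^ 2) := by
  have hSc : Continuous S := continuous_iff_continuousAt.2 fun t => (hS t).continuousAt
  set g : ℝ → ℝ := fun u => ‖S u‖ ^ 2 + ‖S' u‖ ^ 2 with hg
  have hgc : Continuous g := by fun_prop
  have hle : t - 1 / 2 ≤ t + 1 / 2 := by linarith
  have hf : ∀ u, HasDerivAt (fun u => ‖S u‖ ^ 2) (2 * inner ℝ (S u) (S' u)) u := fun u => (hS u).norm_sq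
  have hic : Continuous fun u => 2 * inner ℝ (S u) (S' u) :=
    continuous_const.mul (hSc.inner hS')
  have hbound : ∀ u, ‖2 * inner ℝ (S u) (S' u)‖ ≤ g u := by
    intro u
    rw [norm_mul, Real.norm_two]
    have := norm_inner_le_norm (𝕜 := ℝ) (S u) (S' u)
    simp only [hg]
    nlinarith [sq_nonneg (‖S u‖ - ‖S' u‖)]
  have hgi : IntegrableOn g (Set.Ioc (t - 1 / 2) (t + 1 / 2)) := by
    rw [← intervalIntegrable_iff_integrableOn_Ioc_of_le hle]
    exact hgc.intervalIntegrable _ _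
  have hstep : ∀ u ∈ Set.Icc (t - 1 / 2) (t + 1 / 2),
      ‖S t‖ ^ 2 ≤ ‖S u‖ ^ 2 + ∫ v in Set.Ioc (t - 1 / 2) (t + 1 / 2), g v := by
    intro u hu
    have h1 := intervalIntegral.integral_eq_sub_of_hasDerivAt (a := u) (b := t) (fun v _ => hf v)
      (hic.intervalIntegrable _ _)
    have h2 := intervalIntegral.norm_integral_le_integral_norm_uIoc
      (f := fun v => 2 * inner ℝ (S v) (S' v)) (a := u) (b := t) (μ := volume)
    have hsub : Set.uIoc u t ⊆ Set.Ioc (t - 1 / 2) (t + 1 / 2) := by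
      rw [Set.uIoc]
      refine Set.Ioc_subset_Ioc (le_min hu.1 (by linarith)) (max_le hu.2 (by linarith))
    have h3 : ∫ v in Set.uIoc u t, ‖2 * inner ℝ (S v) (S' v)‖ ≤
        ∫ v in Set.Ioc (t - 1 / 2) (t + 1 / 2), g v := by
      refine (setIntegral_mono ?_ (hgi.mono_set hsub) hbound).trans ?_
      · have := (hic.intervalIntegrable u t (μ := volume)).norm
        exact intervalIntegrable_iff.1 this
      · exact setIntegral_mono_set hgi (Filter.Eventually.of_forall fun v => by
          simp only [hg]; positivity) (Filter.Eventually.of_forall hsub)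
    have h4 := (le_abs_self _).trans ((Real.norm_eq_abs _).symm.le.trans (h2.trans h3))
    rw [h1] at h4
    linarith
  have hn : Continuous fun u => ‖S u‖ ^ 2 := by fun_prop
  set K := ∫ v in Set.Ioc (t - 1 / 2) (t + 1 / 2), g v with hK
  have hav : ∫ _ in (t - 1 / 2)..(t + 1 / 2), ‖S t‖ ^ 2 ≤
      ∫ u in (t - 1 / 2)..(t + 1 / 2), (‖S u‖ ^ 2 + K) :=
    intervalIntegral.integral_mono_on hle (by simp) ((hn.add continuous_const).intervalIntegrable _ _)
      hstep
  rw [intervalIntegral.integral_add (hn.intervalIntegrable _ _) (by simp),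
    intervalIntegral.integral_const, intervalIntegral.integral_const] at hav
  have hs : t + 1 / 2 - (t - 1 / 2) = 1 := by ring
  rw [hs, one_smul, one_smul, intervalIntegral.integral_of_le hle, hK, ← integral_add] at hav
  · refine hav.trans (le_of_eq ?_)
    refine integral_congr_ae (Filter.Eventually.of_forall fun u => ?_)
    simp only [hg]; ring
  · exact (intervalIntegrable_iff_integrableOn_Ioc_of_le hle).1 (hn.intervalIntegrable _ _)
  · exact hgi

lemma IsBump.mul_log {A : ℝ → ℝ} (hA : IsBump A) : IsBump fun x => A x * Real.log x := by
  refine ⟨contDiff_iff_contDiffAt.2 fun x => ?_, fun x hx => by rw [hA.eq_zero x hx, zero_mul]⟩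
  rcases lt_or_ge x (1 / 2) with h | h
  · refine (contDiffAt_const (c := (0 : ℝ))).congr_of_eventuallyEq ?_
    filter_upwards [Iio_mem_nhds h] with y hy
    rw [hA.eq_zero y (Or.inl (le_of_lt hy)), zero_mul]
  · exact hA.contDiff.contDiffAt.mul (Real.contDiffAt_log.2 (by linarith))

lemma hasDerivAt_smoothSum (A : ℝ → ℝ) (N : ℕ) (t : ℝ) : HasDerivAt (smoothSum A N)
    (-Complex.I * smoothSum (fun x => A x * Real.log x) N t) t := by
  unfold smoothSum
  rw [Finset.mul_sum]
  refine HasDerivAt.fun_sum fun n _ => ?_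
  have h1 : HasDerivAt (fun t : ℝ => (-(t * Real.log (n / N) : ℝ) * Complex.I : ℂ))
      (-(Real.log (n / N)) * Complex.I) t := by
    have := ((hasDerivAt_id t).mul_const (Real.log (n / N))).ofReal_comp
    simpa using (this.neg).mul_const Complex.I
  refine (h1.cexp.const_mul (A (n / N) : ℂ)).congr_deriv ?_
  push_cast
  ring

lemma continuous_smoothSum (A : ℝ → ℝ) (N : ℕ) : Continuous (smoothSum A N) :=
  continuous_iff_continuousAt.2 fun t => (hasDerivAt_smoothSum A N t).continuousAt

/-- A sum over well-spaced points is controlled by Gaussian windows covering them. -/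
lemma sum_le_sum_integral_gaussian {Φ : ℝ → ℝ} (hΦ0 : ∀ t, 0 ≤ Φ t) (hΦc : Continuous Φ)
    {G X₀ : ℝ} (hG : 1 ≤ G) (hi : ∀ τ : ℝ, Integrable fun t => Real.exp (-((t - τ) / G) ^ 2) * Φ t)
    (P : Finset ℕ) (t : ℕ → ℝ) (hX : ∀ r ∈ P, X₀ ≤ t r)
    (hsp : ∀ r ∈ P, ∀ s ∈ P, r ≠ s → 1 ≤ |t r - t s|) :
    ∑ r ∈ P, ∫ u in Set.Ioc (t r - 1 / 2) (t r + 1 / 2), Φ u ≤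
      10 * ∑ j ∈ P.image (fun r => ⌊(t r - X₀) / G⌋₊),
        ∫ u : ℝ, Real.exp (-((u - (X₀ + G * j)) / G) ^ 2) * Φ u := by
  have hG0 : 0 < G := by linarith
  set q : ℕ → ℕ := fun r => ⌊(t r - X₀) / G⌋₊ with hq
  rw [← Finset.sum_fiberwise_of_maps_to (s := P) (t := P.image q) (g := q)
    fun r hr => Finset.mem_image_of_mem q hr, Finset.mul_sum]
  refine Finset.sum_le_sum fun j _ => ?_
  set W : ℝ → ℝ := fun u => Real.exp (-((u - (X₀ + G * j)) / G) ^ 2) * Φ u with hW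
  have hW0 : ∀ u, 0 ≤ W u := fun u => mul_nonneg (Real.exp_nonneg _) (hΦ0 u)
  have hWi : Integrable W := hi _
  have hpt : ∀ r ∈ P.filter (fun r => q r = j), ∫ u in Set.Ioc (t r - 1 / 2) (t r + 1 / 2), Φ u ≤
      10 * ∫ u in Set.Ioc (t r - 1 / 2) (t r + 1 / 2), W u := by
    intro r hr
    rw [Finset.mem_filter] at hr
    have hx := hX r hr.1
    have hfl1 : (j : ℝ) ≤ (t r - X₀) / G := by
      rw [← hr.2]; exact Nat.floor_le (div_nonneg (by linarith) hG0.le)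
    have hfl2 : (t r - X₀) / G < j + 1 := by rw [← hr.2]; exact Nat.lt_floor_add_one _
    rw [le_div_iff₀ hG0] at hfl1
    rw [div_lt_iff₀ hG0] at hfl2
    rw [← integral_const_mul]
    refine setIntegral_mono_on ?_ (hWi.integrableOn.const_mul 10) measurableSet_Ioc fun u hu => ?_
    · exact (intervalIntegrable_iff_integrableOn_Ioc_of_le (by linarith)).1
        (hΦc.intervalIntegrable _ _)
    · have hab : |(u - (X₀ + G * j)) / G| ≤ 3 / 2 := by
        rw [abs_div, abs_of_pos hG0, div_le_iff₀ hG0, abs_le]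
        constructor <;> nlinarith [hu.1, hu.2]
      have hsq : ((u - (X₀ + G * j)) / G) ^ 2 ≤ 9 / 4 := by
        rw [← sq_abs]
        nlinarith [abs_nonneg ((u - (X₀ + G * j)) / G)]
      have hexp : 1 / 10 ≤ Real.exp (-((u - (X₀ + G * j)) / G) ^ 2) := by
        refine le_trans ?_ (Real.exp_le_exp.2 (neg_le_neg hsq))
        rw [Real.exp_neg, one_div]
        refine inv_anti₀ (Real.exp_pos _) ?_
        have he := Real.exp_one_lt_d9
        have h4 : Real.exp (9 / 4) ^ 4 = Real.exp 1 ^ 9 := by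
          rw [← Real.exp_nat_mul, ← Real.exp_nat_mul]; norm_num
        refine le_of_pow_le_pow_left₀ (n := 4) (by norm_num) (by norm_num) ?_
        rw [h4]
        calc Real.exp 1 ^ 9 ≤ 2.7182818286 ^ 9 := by gcongr
          _ ≤ 10 ^ 4 := by norm_num
      simp only [hW]
      nlinarith [hΦ0 u]
  refine (Finset.sum_le_sum hpt).trans ?_
  rw [← Finset.mul_sum, ← integral_biUnion_finset _ (fun _ _ => measurableSet_Ioc) _
    fun _ _ => hWi.integrableOn]
  · exact mul_le_mul_of_nonneg_left (setIntegral_le_integral hWi (Filter.Eventually.of_forall hW0))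
      (by norm_num)
  · intro r hr s hs hrs
    have h1 := hsp r (Finset.mem_filter.1 hr).1 s (Finset.mem_filter.1 hs).1 hrs
    refine Set.disjoint_left.2 fun u hu hu' => ?_
    rw [Set.mem_Ioc] at hu hu'
    rcases le_abs.1 h1 with h | h <;> linarith [hu.1, hu.2, hu'.1, hu'.2]

lemma meanExcess_mono {T G T₀ J J' : ℝ} (hT : 0 ≤ T) (hG : 0 ≤ G) (hJ : 0 ≤ J) (h : J ≤ J') :
    meanExcess T G T₀ J ≤ meanExcess T G T₀ J' := by
  unfold meanExcess; gcongr

lemma IsBump.exists_sum_norm_sq_smoothSum_le {A : ℝ → ℝ} (hA : IsBump A) : ∃ C, 0 < C ∧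
    ∀ (T G T₀ X₀ : ℝ) (N : ℕ) (P : Finset ℕ) (t : ℕ → ℝ), 2 ≤ T → 1 ≤ N → (N : ℝ) ≤ 2 * T → 1 ≤ G →
      G ≤ T₀ → T₀ ≤ T → T ≤ X₀ → X₀ + T₀ ≤ 3 * T → (∀ r ∈ P, X₀ ≤ t r ∧ t r ≤ X₀ + T₀) →
      (∀ r ∈ P, ∀ s ∈ P, r ≠ s → 1 ≤ |t r - t s|) →
      ∑ r ∈ P, ‖smoothSum A N (t r)‖ ^ 2 ≤
        C * N * G * (3 + Real.log T) ^ 2 * (P.card + √(meanExcess T G T₀ P.card)) := by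
  obtain ⟨C₁, hC₁, h1⟩ := hA.exists_sum_integral_le
  obtain ⟨C₂, hC₂, h2⟩ := hA.mul_log.exists_sum_integral_le
  refine ⟨10 * (2 * C₁ + C₂), by positivity, ?_⟩
  intro T G T₀ X₀ N P t hT hN hNT hG hGT hTT hX hX3 ht hsp
  have hG0 : 0 < G := by linarith
  set B : ℝ → ℝ := fun x => A x * Real.log x with hB
  set q : ℕ → ℕ := fun r => ⌊(t r - X₀) / G⌋₊ with hq
  set 𝒥 := P.image q with h𝒥
  have hJ : ∀ j ∈ 𝒥, G * (j : ℝ) ≤ T₀ := by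
    intro j hj
    obtain ⟨r, hr, rfl⟩ := Finset.mem_image.1 hj
    have := Nat.floor_le (div_nonneg (sub_nonneg.2 (ht r hr).1) hG0.le)
    rw [le_div_iff₀ hG0] at this
    simp only [hq]
    linarith [(ht r hr).2]
  have hcard : (𝒥.card : ℝ) ≤ P.card := by exact_mod_cast Finset.card_image_le
  have hmono : (𝒥.card : ℝ) + √(meanExcess T G T₀ 𝒥.card) ≤
      P.card + √(meanExcess T G T₀ P.card) :=
    add_le_add hcard (Real.sqrt_le_sqrt (meanExcess_mono (by linarith) hG0.le (by positivity) hcard))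
  have hb1 := h1 T G T₀ X₀ N 𝒥 hT hN hNT hG hGT hTT hX hX3 hJ
  have hb2 := h2 T G T₀ X₀ N 𝒥 hT hN hNT hG hGT hTT hX hX3 hJ
  set Φ : ℝ → ℝ := fun u => 2 * ‖smoothSum A N u‖ ^ 2 + ‖smoothSum B N u‖ ^ 2 with hΦ
  have hcA := continuous_smoothSum A N
  have hcB := continuous_smoothSum B N
  have hiA := fun τ => (hA.integral_gaussian_mul_smoothSum hG0 hN τ).1
  have hiB := fun τ => (hA.mul_log.integral_gaussian_mul_smoothSum hG0 hN τ).1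
  have hdist : ∀ τ u : ℝ, Real.exp (-((u - τ) / G) ^ 2) * Φ u =
      2 * (Real.exp (-((u - τ) / G) ^ 2) * ‖smoothSum A N u‖ ^ 2) +
        Real.exp (-((u - τ) / G) ^ 2) * ‖smoothSum B N u‖ ^ 2 := by
    intro τ u; simp only [hΦ]; ring
  have hsob : ∀ r ∈ P, ‖smoothSum A N (t r)‖ ^ 2 ≤
      ∫ u in Set.Ioc (t r - 1 / 2) (t r + 1 / 2), Φ u := by
    intro r _
    refine (norm_sq_le_integral_of_hasDerivAt (hasDerivAt_smoothSum A N)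
      (continuous_const.mul hcB) (t r)).trans (le_of_eq ?_)
    refine integral_congr_ae (Filter.Eventually.of_forall fun u => ?_)
    simp [hΦ, hB]
  have hcov := sum_le_sum_integral_gaussian (Φ := Φ) (fun u => by simp only [hΦ]; positivity)
    (by fun_prop) hG (X₀ := X₀) (fun τ => by
      simp only [hdist]; exact ((hiA τ).const_mul 2).add (hiB τ)) P t (fun r hr => (ht r hr).1) hsp
  refine (Finset.sum_le_sum hsob).trans (hcov.trans ?_)
  have hinteg : ∀ j : ℕ, ∫ u : ℝ, Real.exp (-((u - (X₀ + G * j)) / G) ^ 2) * Φ u =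
      2 * (∫ u : ℝ, Real.exp (-((u - (X₀ + G * j)) / G) ^ 2) * ‖smoothSum A N u‖ ^ 2) +
        ∫ u : ℝ, Real.exp (-((u - (X₀ + G * j)) / G) ^ 2) * ‖smoothSum B N u‖ ^ 2 := by
    intro j
    simp only [hdist]
    rw [integral_add ((hiA _).const_mul 2) (hiB _), integral_const_mul]
  rw [Finset.sum_congr rfl fun j _ => hinteg j, Finset.sum_add_distrib, ← Finset.mul_sum]
  have hL : 0 ≤ (3 + Real.log T) ^ 2 := sq_nonneg _
  calc _ ≤ 10 * (2 * (C₁ * N * G * (3 + Real.log T) ^ 2 * (𝒥.card + √(meanExcess T G T₀ 𝒥.card))) +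
        C₂ * N * G * (3 + Real.log T) ^ 2 * (𝒥.card + √(meanExcess T G T₀ 𝒥.card))) := by gcongr
    _ = 10 * (2 * C₁ + C₂) * N * G * (3 + Real.log T) ^ 2 *
        (𝒥.card + √(meanExcess T G T₀ 𝒥.card)) := by ring
    _ ≤ _ := by gcongr

lemma isBump_dyadicBump : IsBump dyadicBump :=
  ⟨contDiff_dyadicBump, fun _ hx => dyadicBump_eq_zero hx⟩

/-- Large values of zeta at well-spaced points of a short interval. -/
theorem exists_sq_mul_card_large_values_le : ∃ C, 0 < C ∧
    ∀ (T G T₀ X₀ V : ℝ) (P : Finset ℕ) (t : ℕ → ℝ), 2 ≤ T → 1 ≤ G → G ≤ T₀ → T₀ ≤ T → T ≤ X₀ →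
      X₀ + T₀ ≤ 3 * T → C ≤ V → (∀ r ∈ P, X₀ ≤ t r ∧ t r ≤ X₀ + T₀) →
      (∀ r ∈ P, T < t r ∧ t r ≤ 2 * T ∧ V ≤ ‖riemannZeta (1 / 2 + (t r) * Complex.I)‖) →
      (∀ r ∈ P, ∀ s ∈ P, r ≠ s → 1 ≤ |t r - t s|) →
      V ^ 2 * P.card ≤
        C * G * (3 + Real.log T) ^ 4 * (P.card + √(meanExcess T G T₀ P.card)) := by
  obtain ⟨C₀, hC₀, hz⟩ := exists_norm_zeta_le_sum_smoothSum
  obtain ⟨C, hC, hs⟩ := isBump_dyadicBump.exists_sum_norm_sq_smoothSum_le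
  refine ⟨2 * C₀ + 16 * C, by positivity, ?_⟩
  intro T G T₀ X₀ V P t hT hG hGT hTT hX hX3 hV ht htz hsp
  have hlogT : 0 ≤ Real.log T := Real.log_nonneg (by linarith)
  set Lg := 3 + Real.log T with hLg
  have hG0 : 0 < G := by linarith
  obtain ⟨i₀, hi1, hi2⟩ := exists_nat_pow_near (show (1 : ℝ) ≤ T by linarith) (one_lt_two)
  set I := i₀ + 1 with hI
  have hI2 : (2 : ℝ) ^ I ≤ 2 * T := by rw [hI, pow_succ]; linarith
  have hIL : ((I + 1 : ℕ) : ℝ) ≤ 2 * Lg := by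
    have h1 : (i₀ : ℝ) * Real.log 2 ≤ Real.log T := by
      rw [← Real.log_pow]; exact Real.log_le_log (by positivity) hi1
    have h2 := Real.log_two_gt_d9
    have h3 : (0 : ℝ) ≤ i₀ := by positivity
    rw [hI]; push_cast
    nlinarith
  set S : ℕ → ℕ → ℝ := fun i r => ‖smoothSum dyadicBump (2 ^ i) (t r)‖ with hS
  have hpoint : ∀ r ∈ P, V ^ 2 ≤ 4 * (2 * Lg * ∑ i ∈ Finset.range (I + 1), S i r ^ 2 / 2 ^ i) := by
    intro r hr
    obtain ⟨h1, h2, h3⟩ := htz r hr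
    have h4 := hz T (t r) I hT h1 h2 hi2.le hI2
    have h5 : V / 2 ≤ ∑ i ∈ Finset.range (I + 1), S i r / √(2 ^ i) := by
      simp only [hS]; linarith
    have h6 := sq_sum_le_card_mul_sum_sq (s := Finset.range (I + 1)) (f := fun i => S i r / √(2 ^ i))
    rw [Finset.card_range] at h6
    have h7 : ∀ i ∈ Finset.range (I + 1), (S i r / √(2 ^ i)) ^ 2 = S i r ^ 2 / 2 ^ i := by
      intro i _; rw [div_pow, Real.sq_sqrt (by positivity)]
    rw [Finset.sum_congr rfl h7] at h6
    have h8 : (V / 2) ^ 2 ≤ (∑ i ∈ Finset.range (I + 1), S i r / √(2 ^ i)) ^ 2 :=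
      pow_le_pow_left₀ (by linarith) h5 2
    have h9 : ((I + 1 : ℕ) : ℝ) * ∑ i ∈ Finset.range (I + 1), S i r ^ 2 / 2 ^ i ≤
        2 * Lg * ∑ i ∈ Finset.range (I + 1), S i r ^ 2 / 2 ^ i := by
      gcongr
    linarith [h8.trans (h6.trans h9)]
  set D := √(meanExcess T G T₀ P.card) with hD
  have hD0 : 0 ≤ D := Real.sqrt_nonneg _
  have hsum : ∀ i ∈ Finset.range (I + 1), ∑ r ∈ P, S i r ^ 2 / 2 ^ i ≤
      C * G * Lg ^ 2 * (P.card + D) := by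
    intro i hi
    have hiI : i ≤ I := by rw [Finset.mem_range] at hi; omega
    have hN : ((2 ^ i : ℕ) : ℝ) ≤ 2 * T := by
      push_cast
      exact (pow_le_pow_right₀ (by norm_num) hiI).trans hI2
    have := hs T G T₀ X₀ (2 ^ i) P t hT Nat.one_le_two_pow hN hG hGT hTT hX hX3 ht hsp
    rw [← Finset.sum_div, div_le_iff₀ (by positivity)]
    refine this.trans (le_of_eq ?_)
    push_cast
    ring
  calc V ^ 2 * P.card = ∑ r ∈ P, V ^ 2 := by rw [Finset.sum_const, nsmul_eq_mul]; ring
    _ ≤ ∑ r ∈ P, 4 * (2 * Lg * ∑ i ∈ Finset.range (I + 1), S i r ^ 2 / 2 ^ i) :=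
        Finset.sum_le_sum hpoint
    _ = 8 * Lg * ∑ i ∈ Finset.range (I + 1), ∑ r ∈ P, S i r ^ 2 / 2 ^ i := by
        rw [← Finset.mul_sum, ← Finset.mul_sum, Finset.sum_comm]; ring
    _ ≤ 8 * Lg * ∑ i ∈ Finset.range (I + 1), C * G * Lg ^ 2 * (P.card + D) := by
        have := Finset.sum_le_sum hsum
        gcongr
    _ = 8 * Lg * (((I + 1 : ℕ) : ℝ) * (C * G * Lg ^ 2 * (P.card + D))) := by
        rw [Finset.sum_const, Finset.card_range, nsmul_eq_mul]
    _ ≤ 8 * Lg * (2 * Lg * (C * G * Lg ^ 2 * (P.card + D))) := by gcongr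
    _ = (16 * C) * G * Lg ^ 4 * (P.card + D) := by ring
    _ ≤ _ := by gcongr; linarith

lemma mul_le_of_sq_mul_le_meanExcess {V Λ G T T₀ R : ℝ} (hR : 0 ≤ R) (hV : 0 < V)
    (hG : 0 < G) (hT : 0 ≤ T) (h : V ^ 2 * R ≤ Λ * G * (R + √(meanExcess T G T₀ R)))
    (h1 : 4 * Λ * G ≤ V ^ 2) (h2 : 16 * Λ ^ 2 * √(T₀ * G) ≤ V ^ 4) :
    R * (V ^ 4 * G) ≤ 2 * Λ ^ 2 * T := by
  rcases hR.eq_or_lt with rfl | hR0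
  · rw [zero_mul]; positivity
  have hD := meanExcess_nonneg (T₀ := T₀) hT hG.le hR
  have h3 : 3 / 4 * V ^ 2 * R ≤ Λ * G * √(meanExcess T G T₀ R) := by nlinarith
  have h4 : (3 / 4 * V ^ 2 * R) ^ 2 ≤ (Λ * G * √(meanExcess T G T₀ R)) ^ 2 :=
    pow_le_pow_left₀ (by positivity) h3 2
  have h5 : (Λ * G * √(meanExcess T G T₀ R)) ^ 2 =
      Λ ^ 2 * (R * T / G) + R ^ 2 * (Λ ^ 2 * √(T₀ * G)) := by
    have hs : √G ≠ 0 := (Real.sqrt_pos.2 hG).ne'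
    have hss : √G ^ 2 = G := Real.sq_sqrt hG.le
    rw [mul_pow, Real.sq_sqrt hD, meanExcess, Real.sqrt_mul' _ hG.le]
    field_simp
    linear_combination -(Λ ^ 2 * G * R * √T₀) * hss
  rw [h5] at h4
  have h6 : R ^ 2 * (Λ ^ 2 * √(T₀ * G)) ≤ R ^ 2 * (V ^ 4 / 16) := by gcongr; linarith
  have h7 : R ^ 2 * V ^ 4 / 2 ≤ Λ ^ 2 * (R * T / G) := by
    have e : (3 / 4 * V ^ 2 * R) ^ 2 = R ^ 2 * V ^ 4 * (9 / 16) := by ring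
    have : 0 ≤ R ^ 2 * V ^ 4 := by positivity
    linarith
  have h8 : R * (R * (V ^ 4 * G)) ≤ R * (2 * Λ ^ 2 * T) := by
    have e : Λ ^ 2 * (R * T / G) = (Λ ^ 2 * R * T) / G := by ring
    rw [e, le_div_iff₀ hG] at h7
    linarith
  exact le_of_mul_le_mul_left h8 hR0

lemma sub_le_of_forall_succ_sub_ge {R : ℕ} {t : ℕ → ℝ} (h : ∀ r, 1 ≤ r → r < R → t (r + 1) - t r ≥ 1)
    {r s : ℕ} (hr : 1 ≤ r) (hrs : r ≤ s) (hs : s ≤ R) : (s : ℝ) - r ≤ t s - t r := by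
  induction s, hrs using Nat.le_induction with
  | base => simp
  | succ n hn ih =>
    have h1 := ih (by omega)
    have h2 := h n (by omega) (by omega)
    push_cast
    linarith

/-- Large values of zeta on a dyadic interval, with an auxiliary parameter `y`. -/
theorem exists_card_large_values_le : ∃ K, 0 < K ∧ ∀ (T V y : ℝ) (P : Finset ℕ) (t : ℕ → ℝ), 2 ≤ T →
      1 ≤ y → y ≤ V → V ^ 6 ≤ T → 16 * (K * (3 + Real.log T) ^ 4) ^ 2 ≤ y → K ≤ V →
      (∀ r ∈ P, T < t r ∧ t r ≤ 2 * T ∧ V ≤ ‖riemannZeta (1 / 2 + (t r) * Complex.I)‖) →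
      (∀ r ∈ P, ∀ s ∈ P, r ≠ s → 1 ≤ |t r - t s|) →
      (P.card : ℝ) ≤ T ^ 2 * y ^ 4 / V ^ 12 := by
  obtain ⟨K, hK, hloc⟩ := exists_sq_mul_card_large_values_le
  refine ⟨K, hK, ?_⟩
  intro T V y P t hT hy hyV hVT hΛy hKV htz hsp
  have hT0 : 0 < T := by linarith
  have hy0 : 0 < y := by linarith
  have hV1 : 1 ≤ V := hy.trans hyV
  have hV0 : 0 < V := by linarith
  have hlogT : 0 ≤ Real.log T := Real.log_nonneg (by linarith)
  set Λ := K * (3 + Real.log T) ^ 4 with hΛ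
  have hΛ0 : 0 < Λ := by positivity
  set G := V ^ 2 / y with hGdef
  set T₀ := V ^ 6 / y with hT₀def
  have hG0 : 0 < G := by positivity
  have hT₀0 : 0 < T₀ := by positivity
  have hG1 : 1 ≤ G := by rw [hGdef, le_div_iff₀ hy0]; nlinarith
  have hGT : G ≤ T₀ := by
    rw [hGdef, hT₀def]
    gcongr
    norm_num
  have hTT : T₀ ≤ T := (div_le_self (by positivity) hy).trans hVT
  set q : ℕ → ℕ := fun r => ⌊(t r - T) / T₀⌋₊ with hq
  set B := 2 * Λ ^ 2 * T / (V ^ 4 * G) with hB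
  have hfib : ∀ j : ℕ, (((P.filter fun r => q r = j).card : ℕ) : ℝ) ≤ B := by
    intro j
    set Q := P.filter fun r => q r = j with hQ
    have hB0 : 0 ≤ B := by positivity
    rcases Q.eq_empty_or_nonempty with he | ⟨r₀, hr₀⟩
    · rw [he]; simpa using hB0
    have hin : ∀ r ∈ Q, (T + T₀ * j) ≤ t r ∧ t r ≤ (T + T₀ * j) + T₀ := by
      intro r hr
      obtain ⟨hrP, hrj⟩ := Finset.mem_filter.1 hr
      have h0 := (htz r hrP).1
      have h1 : (j : ℝ) ≤ (t r - T) / T₀ := by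
        rw [← hrj]; exact Nat.floor_le (div_nonneg (by linarith) hT₀0.le)
      have h2 : (t r - T) / T₀ < j + 1 := by rw [← hrj]; exact Nat.lt_floor_add_one _
      rw [le_div_iff₀ hT₀0] at h1
      rw [div_lt_iff₀ hT₀0] at h2
      constructor <;> linarith
    have hX3 : (T + T₀ * j) + T₀ ≤ 3 * T := by
      have h1 := (hin r₀ hr₀).1
      have h2 := (htz r₀ (Finset.mem_filter.1 hr₀).1).2.1
      linarith
    have hmain := hloc T G T₀ (T + T₀ * j) V Q t hT hG1 hGT hTT
      (by have : 0 ≤ T₀ * (j : ℝ) := by positivity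
          linarith) hX3 hKV hin (fun r hr => htz r (Finset.mem_filter.1 hr).1)
      fun r hr s hs => hsp r (Finset.mem_filter.1 hr).1 s (Finset.mem_filter.1 hs).1
    rw [hB, le_div_iff₀ (by positivity)]
    refine mul_le_of_sq_mul_le_meanExcess (T₀ := T₀) (by positivity) hV0 hG0 hT0.le ?_ ?_ ?_
    · refine hmain.trans (le_of_eq ?_)
      rw [hΛ]; ring
    · have h4 : 4 * Λ ≤ y := by
        refine le_of_sq_le_sq ?_ hy0.le
        nlinarith
      rw [hGdef, mul_div_assoc', div_le_iff₀ hy0, mul_comm]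
      gcongr
    · have : T₀ * G = (V ^ 4 / y) ^ 2 := by rw [hT₀def, hGdef]; field_simp
      rw [this, Real.sqrt_sq (by positivity), mul_div_assoc', div_le_iff₀ hy0, mul_comm]
      gcongr
  have hmaps : ∀ r ∈ P, q r ∈ Finset.range (⌊T / T₀⌋₊ + 1) := by
    intro r hr
    rw [Finset.mem_range, Nat.lt_succ_iff]
    refine Nat.floor_le_floor ?_
    gcongr
    linarith [(htz r hr).2.1]
  rw [Finset.card_eq_sum_card_fiberwise hmaps]
  push_cast
  have hcnt : ((⌊T / T₀⌋₊ + 1 : ℕ) : ℝ) ≤ 2 * (T / T₀) := by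
    have h1 := Nat.floor_le (show 0 ≤ T / T₀ by positivity)
    have h2 : 1 ≤ T / T₀ := by rwa [le_div_iff₀ hT₀0, one_mul]
    push_cast
    linarith
  calc _ ≤ ∑ _j ∈ Finset.range (⌊T / T₀⌋₊ + 1), B := Finset.sum_le_sum fun j _ => hfib j
    _ = ((⌊T / T₀⌋₊ + 1 : ℕ) : ℝ) * B := by rw [Finset.sum_const, Finset.card_range, nsmul_eq_mul]
    _ ≤ 2 * (T / T₀) * B := by gcongr
    _ = (4 * Λ ^ 2) * (T ^ 2 * y ^ 2 / V ^ 12) := by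
        rw [hB, hT₀def, hGdef]; field_simp; ring
    _ ≤ y * (T ^ 2 * y ^ 2 / V ^ 12) := by
        gcongr
        nlinarith
    _ = T ^ 2 * y ^ 3 / V ^ 12 := by ring
    _ ≤ _ := by
        gcongr
        norm_num

lemma exists_forall_log_pow_le_rpow (K : ℝ) {δ : ℝ} (hδ : 0 < δ) :
    ∃ T₁, 2 ≤ T₁ ∧ ∀ T, T₁ ≤ T → 16 * (K * (3 + Real.log T) ^ 4) ^ 2 ≤ T ^ δ ∧ K ≤ T ^ δ := by
  set c := 3 + 16 / δ with hc
  have hev := (tendsto_rpow_atTop (half_pos hδ)).eventually_ge_atTop (max (16 * K ^ 2 * c ^ 8) K)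
  obtain ⟨T₁, hT₁⟩ := Filter.eventually_atTop.1 hev
  refine ⟨max 2 T₁, le_max_left _ _, fun T hT => ?_⟩
  have hT2 : 2 ≤ T := (le_max_left _ _).trans hT
  have hT0 : 0 ≤ T := by linarith
  have hbig := hT₁ T ((le_max_right _ _).trans hT)
  have h1 : 1 ≤ T ^ (δ / 2) := Real.one_le_rpow (by linarith) (by positivity)
  have h16 : 1 ≤ T ^ (δ / 16) := Real.one_le_rpow (by linarith) (by positivity)
  have hsq : T ^ δ = T ^ (δ / 2) * T ^ (δ / 2) := by
    rw [← Real.rpow_add (by linarith)]; ring_nf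
  have hlog : 3 + Real.log T ≤ c * T ^ (δ / 16) := by
    have := Real.log_le_rpow_div hT0 (show 0 < δ / 16 by positivity)
    have e : T ^ (δ / 16) / (δ / 16) = 16 / δ * T ^ (δ / 16) := by field_simp
    rw [e] at this
    rw [hc, add_mul]
    linarith
  have hlog0 : 0 ≤ 3 + Real.log T := by linarith [Real.log_nonneg (show (1 : ℝ) ≤ T by linarith)]
  have hpow : (3 + Real.log T) ^ 8 ≤ c ^ 8 * T ^ (δ / 2) := by
    refine (pow_le_pow_left₀ hlog0 hlog 8).trans (le_of_eq ?_)
    rw [mul_pow, ← Real.rpow_natCast (T ^ (δ / 16)), ← Real.rpow_mul hT0]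
    congr 2
    push_cast
    ring
  constructor
  · calc _ = 16 * K ^ 2 * (3 + Real.log T) ^ 8 := by ring
      _ ≤ 16 * K ^ 2 * (c ^ 8 * T ^ (δ / 2)) := by gcongr
      _ = (16 * K ^ 2 * c ^ 8) * T ^ (δ / 2) := by ring
      _ ≤ T ^ (δ / 2) * T ^ (δ / 2) := by
          gcongr
          exact (le_max_left _ _).trans hbig
      _ = _ := hsq.symm
  · have := (le_max_right _ _).trans hbig
    rw [hsq]
    nlinarith

theorem large_values_zeta (ε : ℝ) (hε : 0 < ε) :
    ∃ C : ℝ, 0 < C ∧ ∀ T V : ℝ, 2 ≤ T →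
      T ^ ((1:ℝ)/10 + ε) ≤ V → V ≤ T ^ ((1:ℝ)/6) →
      ∀ (R : ℕ) (t : ℕ → ℝ),
        (∀ r, 1 ≤ r → r ≤ R →
          T < t r ∧ t r ≤ 2 * T ∧ V ≤ ‖riemannZeta (1 / 2 + (t r) * Complex.I)‖) →
        (∀ r, 1 ≤ r → r < R → t (r + 1) - t r ≥ 1) →
        (R : ℝ) ≤ C * T ^ ((2:ℝ) + ε) * V ^ (-(12:ℝ)) := by
  obtain ⟨K, hK, hmain⟩ := exists_card_large_values_le
  obtain ⟨T₁, hT₁2, hT₁⟩ := exists_forall_log_pow_le_rpow K (δ := ε / 4) (by positivity)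
  refine ⟨T₁ + 1, by linarith, ?_⟩
  intro T V hT hTV hVT R t ht hsp
  have hT0 : 0 < T := by linarith
  have hyV : T ^ (ε / 4) ≤ V :=
    (Real.rpow_le_rpow_of_exponent_le (by linarith) (by linarith)).trans hTV
  have hy1 : 1 ≤ T ^ (ε / 4) := Real.one_le_rpow (by linarith) (by positivity)
  have hV0 : 0 < V := by linarith
  have hV6 : V ^ 6 ≤ T := by
    refine (pow_le_pow_left₀ hV0.le hVT 6).trans (le_of_eq ?_)
    rw [← Real.rpow_natCast, ← Real.rpow_mul hT0.le]
    norm_num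
  have hy4 : T ^ ((2:ℝ) + ε) = T ^ 2 * (T ^ (ε / 4)) ^ 4 := by
    rw [Real.rpow_add hT0, Real.rpow_two, ← Real.rpow_natCast (T ^ (ε / 4)), ← Real.rpow_mul hT0.le]
    congr 2
    push_cast
    ring
  have hV12 : V ^ (-(12:ℝ)) = (V ^ 12)⁻¹ := by
    rw [Real.rpow_neg hV0.le]; norm_cast
  rw [mul_assoc, hy4, hV12, ← div_eq_mul_inv]
  set y := T ^ (ε / 4) with hy
  have hdist := @sub_le_of_forall_succ_sub_ge R t hsp
  rcases lt_or_ge T T₁ with hTT | hTT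
  · have hone : 1 ≤ T ^ 2 * y ^ 4 / V ^ 12 := by
      rw [le_div_iff₀ (by positivity), one_mul]
      calc V ^ 12 = (V ^ 6) ^ 2 := by ring
        _ ≤ T ^ 2 * 1 := by rw [mul_one]; gcongr
        _ ≤ _ := by gcongr; exact one_le_pow₀ hy1
    have hR : (R : ℝ) ≤ T₁ + 1 := by
      rcases Nat.eq_zero_or_pos R with rfl | hR
      · push_cast; linarith
      · have h1 := hdist le_rfl hR le_rfl
        have h2 := ht 1 le_rfl hR
        have h3 := ht R hR le_rfl
        push_cast at h1
        linarith [h2.1, h3.2.1]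
    nlinarith
  · obtain ⟨h1, h2⟩ := hT₁ T hTT
    have hcard := hmain T V y (Finset.Icc 1 R) t hT hy1 hyV hV6 h1 (h2.trans hyV)
      (fun r hr => ht r (Finset.mem_Icc.1 hr).1 (Finset.mem_Icc.1 hr).2) (by
        intro r hr s hs hrs
        rw [Finset.mem_Icc] at hr hs
        rcases lt_or_gt_of_ne hrs with h | h
        · have h3 := hdist hr.1 h.le hs.2
          have : (r : ℝ) + 1 ≤ s := by exact_mod_cast h
          rw [abs_sub_comm]
          exact le_trans (by linarith) (le_abs_self _)
        · have h3 := hdist hs.1 h.le hr.2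
          have : (s : ℝ) + 1 ≤ r := by exact_mod_cast h
          exact le_trans (by linarith) (le_abs_self _))
    rw [Nat.card_Icc, Nat.add_sub_cancel] at hcard
    have h0 : 0 ≤ T ^ 2 * y ^ 4 / V ^ 12 := by positivity
    nlinarith
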